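/- Let n ≥ 1, r > 0, k₁ ∈ [1/n, 1] and k₂ ≥ 0. Let μ be the measure on ℝⁿ with density e^{−V}, where V : ℝⁿ → ℝ is an even convex C² function with ∇²V(x) ≽ k₁·Id for all x, and with ∫_M ΔV dμ ≤ k₂ n μ(M) for every origin-symmetric convex body M containing r·B₂ⁿ. Let p ∈ [0,1] and q ∈ [0,p] satisfy (1−p)(n+1)/r² + q(1+k₂)(1+k₁) ≤ 2k₁. Then μ satisfies the (p,q)-inequality for every pair of origin-symmetric convex bodies K, L both containing r·B₂ⁿ. -/

import Mathlib

open MeasureTheory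
open scoped RealInnerProductSpace ENNReal

noncomputable section

abbrev Euc (n : ℕ) : Type := EuclideanSpace ℝ (Fin n)

/-- A convex body: a compact convex set with nonempty interior. -/
def IsConvexBody {n : ℕ} (K : Set (Euc n)) : Prop :=
  IsCompact K ∧ Convex ℝ K ∧ (interior K).Nonempty

/-- The support function `h_K(u) = sup_{y ∈ K} ⟨u, y⟩`. -/
def suppFn {n : ℕ} (K : Set (Euc n)) (u : Euc n) : ℝ :=
  sSup ((fun y => ⟪u, y⟫) '' K)

/-- `lpComb p lam K L` is the `L_p` combination `lam·K +_p (1−lam)·L`;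
for `p = 0` it is the logarithmic combination. -/
def lpComb {n : ℕ} (p lam : ℝ) (K L : Set (Euc n)) : Set (Euc n) :=
  if p = 0 then
    {x | ∀ u : Euc n, ‖u‖ = 1 → ⟪x, u⟫ ≤ suppFn K u ^ lam * suppFn L u ^ (1 - lam)}
  else
    {x | ∀ u : Euc n, ‖u‖ = 1 →
      ⟪x, u⟫ ≤ (lam * suppFn K u ^ p + (1 - lam) * suppFn L u ^ p) ^ (1 / p)}


/-- The `(p,q)`-inequality of Conjecture 1.2 for the measure `μ` and the pair `K, L`:
for `q = 0` the multiplicative form, for `q ≠ 0` the additive `q/n`-form. -/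
def PQIneq {n : ℕ} (μ : Measure (Euc n)) (p q : ℝ) (K L : Set (Euc n)) : Prop :=
  ∀ lam ∈ Set.Icc (0:ℝ) 1,
    (q = 0 → μ K ^ lam * μ L ^ (1 - lam) ≤ μ (lpComb p lam K L)) ∧
    (q ≠ 0 →
      ENNReal.ofReal lam * μ K ^ (q / (n : ℝ)) + ENNReal.ofReal (1 - lam) * μ L ^ (q / (n : ℝ))
        ≤ μ (lpComb p lam K L) ^ (q / (n : ℝ)))

/-- The Laplacian `Δ V` of a function on `ℝⁿ`, as the trace of its Hessian. -/
def lapl {n : ℕ} (V : Euc n → ℝ) (x : Euc n) : ℝ :=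
  ∑ i : Fin n,
    iteratedFDeriv ℝ 2 V x ![EuclideanSpace.single i 1, EuclideanSpace.single i 1]

section Auxiliary

open scoped ContDiff

/-- The `i`-th partial derivative of a function on `ℝⁿ`. -/
def pd {n : ℕ} (i : Fin n) (f : Euc n → ℝ) (x : Euc n) : ℝ :=
  fderiv ℝ f x (EuclideanSpace.single i 1)

section PartialDerivatives

variable {n : ℕ} {f g : Euc n → ℝ} {i j : Fin n} {x : Euc n}

lemma pd_contDiff {k m : WithTop ℕ∞} (hf : ContDiff ℝ m f) (hk : k + 1 ≤ m) :
    ContDiff ℝ k (pd i f) :=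
  (hf.fderiv_right hk).clm_apply contDiff_const

lemma pd_contDiff_infty (hf : ContDiff ℝ ∞ f) : ContDiff ℝ ∞ (pd i f) :=
  pd_contDiff hf (by simp)

lemma pd_continuous (hf : ContDiff ℝ 1 f) : Continuous (pd i f) :=
  (pd_contDiff (k := 0) hf (by simp)).continuous

lemma pd_hasCompactSupport (hf : HasCompactSupport f) : HasCompactSupport (pd i f) :=
  hf.fderiv_apply ℝ _

lemma pd_add (hf : Differentiable ℝ f) (hg : Differentiable ℝ g) :
    pd i (fun y => f y + g y) x = pd i f x + pd i g x := by
  simp [pd, fderiv_fun_add (hf x) (hg x)]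

lemma pd_sub (hf : Differentiable ℝ f) (hg : Differentiable ℝ g) :
    pd i (fun y => f y - g y) x = pd i f x - pd i g x := by
  simp [pd, fderiv_fun_sub (hf x) (hg x)]

lemma pd_mul (hf : Differentiable ℝ f) (hg : Differentiable ℝ g) :
    pd i (fun y => f y * g y) x = pd i f x * g x + f x * pd i g x := by
  simp [pd, fderiv_fun_mul (hf x) (hg x)]; ring

lemma pd_const_mul (c : ℝ) (hf : Differentiable ℝ f) :
    pd i (fun y => c * f y) x = c * pd i f x := by
  simp [pd, fderiv_const_mul (hf x)]

lemma pd_sum {ι : Type*} (s : Finset ι) {F : ι → Euc n → ℝ}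
    (hF : ∀ a ∈ s, Differentiable ℝ (F a)) :
    pd i (fun y => ∑ a ∈ s, F a y) x = ∑ a ∈ s, pd i (F a) x := by
  simp only [pd]
  rw [fderiv_fun_sum (fun a ha => hF a ha x)]
  simp

lemma pd_comp {φ : ℝ → ℝ} {φ' : ℝ} (hφ : HasDerivAt φ φ' (f x)) (hf : DifferentiableAt ℝ f x) :
    pd i (fun y => φ (f y)) x = φ' * pd i f x := by
  have h : HasFDerivAt (fun y => φ (f y)) (φ' • fderiv ℝ f x) x :=
    hφ.comp_hasFDerivAt x hf.hasFDerivAt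
  simp [pd, h.fderiv]

lemma pd_inner (a : Euc n) : pd i (fun y => ⟪y, a⟫) x = a i := by
  have h : (fun y : Euc n => ⟪y, a⟫) = fun y => innerSL ℝ a y := by
    ext y; simp [real_inner_comm]
  simp only [pd, h, ContinuousLinearMap.fderiv]
  simp [EuclideanSpace.inner_single_right]

lemma pd_coord : pd i (fun y : Euc n => y j) x = if i = j then 1 else 0 := by
  have h : (fun y : Euc n => y j) = fun y => EuclideanSpace.proj (𝕜 := ℝ) j y := by
    ext y; simp
  simp only [pd, h, ContinuousLinearMap.fderiv]
  simp [eq_comm]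

lemma euc_eq_sum (v : Euc n) : v = ∑ i, v i • EuclideanSpace.single i (1 : ℝ) := by
  ext j
  simp [Finset.sum_apply, Pi.single_apply]

lemma fderiv_eq_sum_pd (v : Euc n) : fderiv ℝ f x v = ∑ i, v i * pd i f x := by
  conv_lhs => rw [euc_eq_sum v]
  simp [pd]

lemma pd_pd_eq (hf : ContDiff ℝ 2 f) :
    pd i (pd j f) x =
      fderiv ℝ (fderiv ℝ f) x (EuclideanSpace.single i 1) (EuclideanSpace.single j 1) := by
  have hd : Differentiable ℝ (fderiv ℝ f) :=
    (hf.fderiv_right (m := 1) (by norm_num)).differentiable (by norm_num)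
  have h : HasFDerivAt (pd j f)
      ((fderiv ℝ (fderiv ℝ f) x).flip (EuclideanSpace.single j 1)) x := by
    have := (hd x).hasFDerivAt.clm_apply (hasFDerivAt_const (EuclideanSpace.single j (1:ℝ)) x)
    have h0 : (fun y => fderiv ℝ f y (EuclideanSpace.single j 1)) = pd j f := rfl
    rw [h0] at this
    simpa using this
  simp [pd, h.fderiv]

lemma pd_comm (hf : ContDiff ℝ 2 f) : pd i (pd j f) x = pd j (pd i f) x := by
  rw [pd_pd_eq hf, pd_pd_eq hf]
  exact (hf.contDiffAt.isSymmSndFDerivAt (by simp)).eq _ _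

lemma iteratedFDeriv_two_eq_sum (hf : ContDiff ℝ 2 f) (v : Euc n) :
    iteratedFDeriv ℝ 2 f x ![v, v] = ∑ i, ∑ j, pd i (pd j f) x * (v i * v j) := by
  rw [iteratedFDeriv_two_apply]
  simp only [Matrix.cons_val_zero, Matrix.cons_val_one]
  conv_lhs => rw [euc_eq_sum v]
  simp only [map_sum, map_smul, sum_apply, smul_apply,
    smul_eq_mul, pd_pd_eq hf, Finset.mul_sum]
  rw [Finset.sum_comm]
  exact Finset.sum_congr rfl fun i _ => Finset.sum_congr rfl fun j _ => by ring

lemma pd_comp_smul (c : ℝ) : pd i (fun y => f (c • y)) x = c * pd i f (c • x) := by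
  simp [pd, fderiv_comp_smul]

lemma pd_odd_of_even (hf : ∀ y, f (-y) = f y) (x : Euc n) : pd i f (-x) = - pd i f x := by
  have h : (fun y => f ((-1 : ℝ) • y)) = f := by ext y; simp [hf]
  have h2 := pd_comp_smul (f := f) (i := i) (x := x) (-1)
  rw [h] at h2
  simp [h2]

end PartialDerivatives

section Gibbs

variable {n : ℕ}

/-- The measure with density `e^{-Φ}`. -/
def gibbs (Φ : Euc n → ℝ) : Measure (Euc n) :=
  volume.withDensity fun x => ENNReal.ofReal (Real.exp (-Φ x))

lemma integral_gibbs {Φ : Euc n → ℝ} (hΦ : Continuous Φ) (f : Euc n → ℝ) :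
    ∫ x, f x ∂gibbs Φ = ∫ x, f x * Real.exp (-Φ x) := by
  rw [gibbs, integral_withDensity_eq_integral_toReal_smul (by fun_prop)
    (Filter.Eventually.of_forall fun _ => ENNReal.ofReal_lt_top)]
  exact integral_congr_ae (Filter.Eventually.of_forall fun x => by
    simp [ENNReal.toReal_ofReal (Real.exp_pos _).le, mul_comm])

lemma integrable_gibbs_iff {Φ : Euc n → ℝ} (hΦ : Continuous Φ) {f : Euc n → ℝ} :
    Integrable f (gibbs Φ) ↔ Integrable fun x => f x * Real.exp (-Φ x) := by
  rw [gibbs, integrable_withDensity_iff (by fun_prop)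
    (Filter.Eventually.of_forall fun _ => ENNReal.ofReal_lt_top)]
  simp [ENNReal.toReal_ofReal (Real.exp_pos _).le]

/-- Continuous functions with compact support. -/
def IsCc (f : Euc n → ℝ) : Prop := Continuous f ∧ HasCompactSupport f

namespace IsCc

variable {f g : Euc n → ℝ}

lemma mul_left (hg : IsCc g) (hf : Continuous f) : IsCc fun x => f x * g x :=
  ⟨hf.mul hg.1, hg.2.mul_left⟩

lemma mul_right (hf : IsCc f) (hg : Continuous g) : IsCc fun x => f x * g x :=
  ⟨hf.1.mul hg, hf.2.mul_right⟩

lemma add (hf : IsCc f) (hg : IsCc g) : IsCc fun x => f x + g x :=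
  ⟨hf.1.add hg.1, hf.2.add hg.2⟩

lemma neg (hf : IsCc f) : IsCc fun x => - f x := ⟨hf.1.neg, hf.2.neg⟩

lemma sub (hf : IsCc f) (hg : IsCc g) : IsCc fun x => f x - g x := by
  simpa [sub_eq_add_neg] using hf.add hg.neg

lemma zero : IsCc fun _ : Euc n => (0 : ℝ) := ⟨continuous_const, HasCompactSupport.zero⟩

lemma sum {ι : Type*} {s : Finset ι} {F : ι → Euc n → ℝ} (hF : ∀ a ∈ s, IsCc (F a)) :
    IsCc fun x => ∑ a ∈ s, F a x := by
  classical
  induction s using Finset.induction_on with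
  | empty => simpa using zero
  | insert a s ha ih =>
    simp only [Finset.sum_insert ha]
    exact (hF a (by simp)).add (ih fun b hb => hF b (by simp [hb]))

lemma sq (hf : IsCc f) : IsCc fun x => f x ^ 2 := by
  simpa [pow_two] using hf.mul_left hf.1

lemma integrable (hf : IsCc f) (ν : Measure (Euc n)) [IsFiniteMeasureOnCompacts ν] :
    Integrable f ν := hf.1.integrable_of_hasCompactSupport hf.2

lemma memLp (hf : IsCc f) (ν : Measure (Euc n)) [IsFiniteMeasureOnCompacts ν] (p : ℝ≥0∞) :
    MemLp f p ν := hf.1.memLp_of_hasCompactSupport hf.2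

lemma pd {i : Fin n} (hf : ContDiff ℝ 1 f) (hc : HasCompactSupport f) : IsCc (_root_.pd i f) :=
  ⟨pd_continuous hf, pd_hasCompactSupport hc⟩

lemma pd_pd {i j : Fin n} (hf : ContDiff ℝ 2 f) (hc : HasCompactSupport f) :
    IsCc (_root_.pd i (_root_.pd j f)) :=
  pd (pd_contDiff hf (by norm_num)) (pd_hasCompactSupport hc)

end IsCc

lemma integral_pd_eq_zero {i : Fin n} {f : Euc n → ℝ} (hf : ContDiff ℝ 1 f)
    (hc : HasCompactSupport f) : ∫ x, pd i f x = 0 := by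
  have h := integral_mul_fderiv_eq_neg_fderiv_mul_of_integrable (μ := (volume : Measure (Euc n)))
    (𝕜 := ℝ) (f := fun _ : Euc n => (1 : ℝ)) (g := f) (v := EuclideanSpace.single i 1)
    (by simp) (by simpa using! (IsCc.pd hf hc).integrable volume)
    (by simpa using IsCc.integrable ⟨hf.continuous, hc⟩ volume)
    (by fun_prop) (fun x _ => (hf.differentiable (by norm_num)) x)
  simpa [pd] using h

lemma integral_gibbs_pd {Φ : Euc n → ℝ} (hΦ : ContDiff ℝ 1 Φ) {i : Fin n} {f : Euc n → ℝ}
    (hf : ContDiff ℝ 1 f) (hc : HasCompactSupport f) :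
    ∫ x, pd i f x ∂gibbs Φ = ∫ x, f x * pd i Φ x ∂gibbs Φ := by
  rw [integral_gibbs hΦ.continuous, integral_gibbs hΦ.continuous]
  have hd := hΦ.differentiable (by norm_num)
  have he : ContDiff ℝ 1 fun x => Real.exp (-Φ x) := hΦ.neg.exp
  have h := integral_pd_eq_zero (i := i) (hf.mul he) hc.mul_right
  have h1 : ∀ x, pd i (fun x => f x * Real.exp (-Φ x)) x
      = pd i f x * Real.exp (-Φ x) - f x * pd i Φ x * Real.exp (-Φ x) := by
    intro x
    rw [pd_mul (hf.differentiable (by norm_num)) (he.differentiable (by norm_num)),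
      pd_comp (f := Φ) (φ := fun s => Real.exp (-s)) (φ' := -Real.exp (-Φ x)) ?_ (hd x)]
    · ring
    · simpa using (hasDerivAt_neg (Φ x)).exp
  simp only [h1] at h
  rw [integral_sub] at h
  · linarith
  · exact ((IsCc.pd hf hc).mul_right he.continuous).integrable _
  · exact ((IsCc.mul_right ⟨hf.continuous, hc⟩ (pd_continuous hΦ)).mul_right
      he.continuous).integrable _

lemma gibbs_isLocallyFinite {Φ : Euc n → ℝ} (hΦ : Continuous Φ) :
    IsLocallyFiniteMeasure (gibbs Φ) :=
  IsLocallyFiniteMeasure.withDensity_ofReal (by fun_prop)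

end Gibbs

section Generator

variable {n : ℕ} {Φ u v : Euc n → ℝ}

/-- The operator `Δu - ⟨∇Φ, ∇u⟩`, symmetric with respect to `e^{-Φ} dx`. -/
def genL (Φ u : Euc n → ℝ) (x : Euc n) : ℝ := ∑ i, (pd i (pd i u) x - pd i Φ x * pd i u x)

lemma genL_contDiff_one (hΦ : ContDiff ℝ 2 Φ) (hu : ContDiff ℝ 3 u) :
    ContDiff ℝ 1 (genL Φ u) := by
  refine ContDiff.sum fun i _ => ContDiff.sub ?_ (ContDiff.mul ?_ ?_)
  · exact pd_contDiff (pd_contDiff (k := 2) hu (by norm_num)) (by norm_num)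
  · exact pd_contDiff hΦ (by norm_num)
  · exact pd_contDiff hu (by norm_num)

lemma IsCc.genL (hΦ : ContDiff ℝ 1 Φ) (hu : ContDiff ℝ 2 u) (hc : HasCompactSupport u) :
    IsCc (genL Φ u) :=
  IsCc.sum fun _ _ => (IsCc.pd_pd hu hc).sub
    ((IsCc.pd (hu.of_le (by norm_num)) hc).mul_left (pd_continuous hΦ))

lemma integral_mul_genL (hΦ : ContDiff ℝ 1 Φ) (hu : ContDiff ℝ 2 u) (hc : HasCompactSupport u)
    (hv : ContDiff ℝ 1 v) :
    ∫ x, v x * genL Φ u x ∂gibbs Φ = - ∫ x, ∑ i, pd i v x * pd i u x ∂gibbs Φ := by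
  have := gibbs_isLocallyFinite hΦ.continuous
  have hu1 : ContDiff ℝ 1 u := hu.of_le (by norm_num)
  have hvd := hv.differentiable (by norm_num)
  have hpu (i) : ContDiff ℝ 1 (pd i u) := pd_contDiff hu (by norm_num)
  have key (i : Fin n) : ∫ x, v x * (pd i (pd i u) x - pd i Φ x * pd i u x) ∂gibbs Φ
      = - ∫ x, pd i v x * pd i u x ∂gibbs Φ := by
    have h := integral_gibbs_pd (i := i) hΦ (hv.mul (hpu i)) (pd_hasCompactSupport hc).mul_left
    simp only [pd_mul hvd ((hpu i).differentiable (by norm_num))] at h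
    have i1 : Integrable (fun x => pd i v x * pd i u x) (gibbs Φ) :=
      ((IsCc.pd hu1 hc).mul_left (pd_continuous hv)).integrable _
    have i2 : Integrable (fun x => v x * pd i (pd i u) x) (gibbs Φ) :=
      ((IsCc.pd_pd hu hc).mul_left hv.continuous).integrable _
    have i3 : Integrable (fun x => v x * pd i u x * pd i Φ x) (gibbs Φ) :=
      (((IsCc.pd hu1 hc).mul_left hv.continuous).mul_right (pd_continuous hΦ)).integrable _
    rw [integral_add i1 i2] at h
    have : ∀ x, v x * (pd i (pd i u) x - pd i Φ x * pd i u x)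
        = v x * pd i (pd i u) x - v x * pd i u x * pd i Φ x := fun x => by ring
    simp only [this]
    rw [integral_sub i2 i3]
    linarith
  simp only [genL, Finset.mul_sum]
  rw [integral_finsetSum, integral_finsetSum, ← Finset.sum_neg_distrib]
  · exact Finset.sum_congr rfl fun i _ => key i
  · exact fun i _ => ((IsCc.pd hu1 hc).mul_left (pd_continuous hv)).integrable _
  · exact fun i _ => (((IsCc.pd_pd hu hc).sub ((IsCc.pd hu1 hc).mul_left
      (pd_continuous hΦ))).mul_left hv.continuous).integrable _

lemma integral_genL (hΦ : ContDiff ℝ 1 Φ) (hu : ContDiff ℝ 2 u) (hc : HasCompactSupport u) :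
    ∫ x, genL Φ u x ∂gibbs Φ = 0 := by
  have := integral_mul_genL (v := fun _ => 1) hΦ hu hc contDiff_const
  simpa [pd] using this

/-- Bochner's formula, integrated against `e^{-Φ} dx`. -/
lemma integral_genL_sq (hΦ : ContDiff ℝ 2 Φ) (hu : ContDiff ℝ 3 u) (hc : HasCompactSupport u) :
    ∫ x, genL Φ u x ^ 2 ∂gibbs Φ = ∫ x, ((∑ i, ∑ j, pd i (pd j u) x ^ 2)
      + ∑ i, ∑ j, pd i (pd j Φ) x * (pd i u x * pd j u x)) ∂gibbs Φ := by
  have := gibbs_isLocallyFinite hΦ.continuous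
  have hΦ1 : ContDiff ℝ 1 Φ := hΦ.of_le (by norm_num)
  have hu2 : ContDiff ℝ 2 u := hu.of_le (by norm_num)
  have hu1 : ContDiff ℝ 1 u := hu.of_le (by norm_num)
  have hpu (i) : ContDiff ℝ 2 (pd i u) := pd_contDiff hu (by norm_num)
  have hpu1 (i) : ContDiff ℝ 1 (pd i u) := pd_contDiff hu2 (by norm_num)
  have hppu (i j) : ContDiff ℝ 1 (pd i (pd j u)) := pd_contDiff (hpu j) (by norm_num)
  have hpΦ (i) : ContDiff ℝ 1 (pd i Φ) := pd_contDiff hΦ (by norm_num)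
  have d1 {f : Euc n → ℝ} (hf : ContDiff ℝ 1 f) : Differentiable ℝ f :=
    hf.differentiable (by norm_num)
  have hL := genL_contDiff_one hΦ hu
  have e1 : ∫ x, genL Φ u x ^ 2 ∂gibbs Φ = - ∫ x, ∑ j, pd j (genL Φ u) x * pd j u x ∂gibbs Φ := by
    rw [← integral_mul_genL hΦ1 hu2 hc hL]; simp [pow_two]
  have e2 (j x) : pd j (genL Φ u) x
      = genL Φ (pd j u) x - ∑ i, pd i (pd j Φ) x * pd i u x := by
    have : genL Φ u = fun x => ∑ i, (pd i (pd i u) x - pd i Φ x * pd i u x) := rfl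
    rw [this, pd_sum (F := fun i x => pd i (pd i u) x - pd i Φ x * pd i u x) _
      (fun i _ => (d1 (hppu i i)).sub ((d1 (hpΦ i)).mul (d1 (hpu1 i)))),
      genL, ← Finset.sum_sub_distrib]
    refine Finset.sum_congr rfl fun i _ => ?_
    rw [pd_sub (g := fun x => pd i Φ x * pd i u x) (d1 (hppu i i)) ((d1 (hpΦ i)).mul (d1 (hpu1 i))),
      pd_mul (d1 (hpΦ i)) (d1 (hpu1 i)), pd_comm hΦ (i := j) (j := i), pd_comm (hpu i),
      pd_comm hu2 (i := j) (j := i)]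
    have : pd j (pd i u) = pd i (pd j u) := by ext y; exact pd_comm hu2
    rw [this]
    ring
  have i1 (j) : Integrable (fun x => pd j u x * genL Φ (pd j u) x) (gibbs Φ) :=
    ((IsCc.genL hΦ1 (hpu j) (pd_hasCompactSupport hc)).mul_left (hpu1 j).continuous).integrable _
  have c2 : IsCc fun x => ∑ i, ∑ j, pd i (pd j Φ) x * (pd i u x * pd j u x) :=
    IsCc.sum fun i _ => IsCc.sum fun j _ => ((IsCc.pd hu1 hc).mul_left
      (hpu1 i).continuous).mul_left (pd_continuous (hpΦ j))
  have c3 : IsCc fun x => ∑ i, ∑ j, pd i (pd j u) x ^ 2 :=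
    IsCc.sum fun i _ => IsCc.sum fun j _ => (IsCc.pd_pd hu2 hc).sq
  have e3 : ∀ x, ∑ j, pd j (genL Φ u) x * pd j u x = ∑ j, pd j u x * genL Φ (pd j u) x
      - ∑ i, ∑ j, pd i (pd j Φ) x * (pd i u x * pd j u x) := by
    intro x
    rw [Finset.sum_comm, ← Finset.sum_sub_distrib]
    refine Finset.sum_congr rfl fun j _ => ?_
    rw [e2, sub_mul, Finset.sum_mul, mul_comm]
    congr 1
    exact Finset.sum_congr rfl fun i _ => by ring
  rw [e1, integral_add (c3.integrable _) (c2.integrable _)]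
  simp only [e3]
  rw [integral_sub (integrable_finsetSum _ fun j _ => i1 j) (c2.integrable _),
    integral_finsetSum _ fun j _ => i1 j]
  have e4 (j) : ∫ x, pd j u x * genL Φ (pd j u) x ∂gibbs Φ
      = - ∫ x, ∑ i, pd i (pd j u) x ^ 2 ∂gibbs Φ := by
    rw [integral_mul_genL hΦ1 (hpu j) (pd_hasCompactSupport hc) (hpu1 j)]
    simp [pow_two]
  simp only [e4]
  rw [Finset.sum_neg_distrib, ← integral_finsetSum]
  · simp only [Finset.sum_comm (f := fun i j => pd i (pd j u) _ ^ 2)]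
    ring
  · exact fun j _ => (IsCc.sum fun i _ => (IsCc.pd_pd hu2 hc).sq).integrable _

end Generator

section Mollification

variable {n : ℕ} {η f g w : Euc n → ℝ}

/-- Mollification of `g` by the kernel `η`. -/
def moll (η g : Euc n → ℝ) (x : Euc n) : ℝ := ∫ y, g y * η (x - y)

lemma moll_eq_convolution (η g : Euc n → ℝ) :
    moll η g = convolution g η (ContinuousLinearMap.mul ℝ ℝ) volume := rfl

lemma IsCc.reflect (hη : IsCc η) (x : Euc n) : IsCc fun y => η (x - y) :=
  ⟨hη.1.comp (by fun_prop), hη.2.comp_homeomorph (Homeomorph.subLeft x)⟩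

lemma moll_integrable (hη : IsCc η) (hg : LocallyIntegrable g) (x : Euc n) :
    Integrable fun y => g y * η (x - y) := by
  have h := hη.reflect x
  exact hg.integrable_smul_right_of_hasCompactSupport h.1 h.2

lemma locallyIntegrable_mul_cont (hg : LocallyIntegrable g) (hf : Continuous f) :
    LocallyIntegrable fun x => g x * f x := by
  rw [locallyIntegrable_iff] at *
  intro k hk
  have := (hg k hk).continuousOn_mul hf.continuousOn hk
  simpa [mul_comm] using this

lemma moll_contDiff (hη : ContDiff ℝ ∞ η) (hc : HasCompactSupport η) (hg : LocallyIntegrable g) :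
    ContDiff ℝ ∞ (moll η g) :=
  HasCompactSupport.contDiff_convolution_right (ContinuousLinearMap.mul ℝ ℝ) hc hg hη

lemma pd_moll {i : Fin n} (hη : ContDiff ℝ 1 η) (hc : HasCompactSupport η)
    (hg : LocallyIntegrable g) (x : Euc n) : pd i (moll η g) x = moll (pd i η) g x := by
  have h := hc.hasFDerivAt_convolution_right (ContinuousLinearMap.mul ℝ ℝ) hg hη x
  rw [pd, moll_eq_convolution, h.fderiv,
    convolution_precompR_apply _ hg (hc.fderiv ℝ) (hη.continuous_fderiv (by norm_num))]
  rfl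

lemma moll_sub_le_of_dist_le {ε c : ℝ} (hη : IsCc η) (h0 : ∀ y, 0 ≤ η y)
    (h1 : ∫ y, η y = 1) (hg : LocallyIntegrable g) (x : Euc n)
    (hx : ∀ y, η (x - y) ≠ 0 → |g y - c| ≤ ε) : |moll η g x - c| ≤ ε := by
  have hi := moll_integrable hη hg x
  have hr := (hη.reflect x).integrable volume
  have h1' : ∫ y, η (x - y) = 1 := by rw [integral_sub_left_eq_self]; exact h1
  have e : moll η g x - c = ∫ y, (g y - c) * η (x - y) := by
    simp_rw [sub_mul]
    rw [integral_sub hi (hr.const_mul c), integral_const_mul, h1', moll]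
    ring
  have hi2 : Integrable fun y => (g y - c) * η (x - y) := by
    simp_rw [sub_mul]; exact hi.sub (hr.const_mul c)
  rw [e]
  calc |∫ y, (g y - c) * η (x - y)| ≤ ∫ y, |(g y - c) * η (x - y)| := abs_integral_le_integral_abs
    _ ≤ ∫ y, ε * η (x - y) := by
      refine integral_mono hi2.abs (hr.const_mul ε) fun y => ?_
      simp only [abs_mul, abs_of_nonneg (h0 _)]
      by_cases hy : η (x - y) = 0
      · simp [hy]
      · exact mul_le_mul_of_nonneg_right (hx y hy) (h0 _)
    _ = ε := by rw [integral_const_mul, h1', mul_one]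

/-- Jensen's inequality for mollification. -/
lemma sq_moll_le (hη : IsCc η) (h0 : ∀ y, 0 ≤ η y) (h1 : ∫ y, η y = 1)
    (hg : LocallyIntegrable g) (hg2 : LocallyIntegrable fun y => g y ^ 2) (x : Euc n) :
    moll η g x ^ 2 ≤ moll η (fun y => g y ^ 2) x := by
  have hi := moll_integrable hη hg x
  have hi2 := moll_integrable hη hg2 x
  have hr := (hη.reflect x).integrable volume
  have h1' : ∫ y, η (x - y) = 1 := by rw [integral_sub_left_eq_self]; exact h1
  set c := moll η g x with hcdef
  have h : 0 ≤ ∫ y, (g y - c) ^ 2 * η (x - y) :=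
    integral_nonneg fun y => mul_nonneg (sq_nonneg _) (h0 _)
  have e : (fun y => (g y - c) ^ 2 * η (x - y)) = fun y =>
      (g y ^ 2 * η (x - y) - (2 * c) * (g y * η (x - y))) + c ^ 2 * η (x - y) := by
    ext y; ring
  rw [e, integral_add (hi2.sub' (hi.const_mul _)) (hr.const_mul _), integral_sub hi2
    (hi.const_mul _), integral_const_mul, integral_const_mul, h1'] at h
  change 0 ≤ moll η (fun y => g y ^ 2) x - 2 * c * c + c ^ 2 * 1 at h
  linarith

/-- The commutator of mollification and multiplication by `b`. -/
lemma sq_commutator_le {b : Euc n → ℝ} {κ : ℝ} (hη : IsCc η) (h0 : ∀ y, 0 ≤ η y)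
    (h1 : ∫ y, η y = 1) (hg : LocallyIntegrable g) (hg2 : LocallyIntegrable fun y => g y ^ 2)
    (hb : Continuous b) (x : Euc n) (hk : ∀ y, η (x - y) ≠ 0 → |b x - b y| ≤ κ) :
    (moll η g x * b x - moll η (fun y => g y * b y) x) ^ 2
      ≤ κ ^ 2 * moll η (fun y => g y ^ 2) x := by
  have hga : LocallyIntegrable fun y => |g y| :=
    hg.mono hg.aestronglyMeasurable.norm (Filter.Eventually.of_forall fun y => by simp)
  have hi := moll_integrable hη hg x
  have hib := moll_integrable hη (locallyIntegrable_mul_cont hg hb) x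
  have hia := moll_integrable hη hga x
  have e : moll η g x * b x - moll η (fun y => g y * b y) x
      = ∫ y, (b x - b y) * (g y * η (x - y)) := by
    rw [moll, moll, ← integral_mul_const, ← integral_sub (hi.mul_const _) hib]
    exact integral_congr_ae (Filter.Eventually.of_forall fun y => by ring)
  have h_int : Integrable fun y => (b x - b y) * (g y * η (x - y)) := by
    have := (hi.mul_const (b x)).sub hib
    refine this.congr (Filter.Eventually.of_forall fun y => ?_)
    simp only [Pi.sub_apply]; ring
  have h2 : |moll η g x * b x - moll η (fun y => g y * b y) x| ≤ κ * moll η (fun y => |g y|) x := by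
    rw [e]
    calc _ ≤ ∫ y, |(b x - b y) * (g y * η (x - y))| := abs_integral_le_integral_abs
      _ ≤ ∫ y, κ * (|g y| * η (x - y)) := by
        refine integral_mono h_int.abs (hia.const_mul κ) fun y => ?_
        simp only [abs_mul, abs_of_nonneg (h0 _)]
        by_cases hy : η (x - y) = 0
        · simp [hy]
        · exact mul_le_mul_of_nonneg_right (hk y hy) (mul_nonneg (abs_nonneg _) (h0 _))
      _ = _ := by rw [integral_const_mul, moll]
  have h3 : moll η (fun y => |g y|) x ^ 2 ≤ moll η (fun y => g y ^ 2) x := by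
    have := sq_moll_le hη h0 h1 hga (by simpa using hg2) x
    simpa using this
  calc _ = |moll η g x * b x - moll η (fun y => g y * b y) x| ^ 2 := (sq_abs _).symm
    _ ≤ (κ * moll η (fun y => |g y|) x) ^ 2 := by gcongr
    _ = κ ^ 2 * moll η (fun y => |g y|) x ^ 2 := by ring
    _ ≤ _ := by gcongr

/-- Mollification by an even kernel is symmetric. -/
lemma integral_mul_moll (hη : IsCc η) (he : ∀ y, η (-y) = η y) (hw : IsCc w)
    (hg : Integrable g) : ∫ x, w x * moll η g x = ∫ y, g y * moll η w y := by
  obtain ⟨C, hC⟩ : ∃ C, ∀ x, ‖w x‖ ≤ C := hw.2.exists_bound_of_continuous hw.1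
  have h_int : Integrable (Function.uncurry fun x y : Euc n => w x * (g y * η (x - y)))
      (volume.prod volume) := by
    have := Integrable.convolution_integrand (ContinuousLinearMap.mul ℝ ℝ) hg
      (hη.integrable (volume : Measure (Euc n))) 
    refine Integrable.bdd_mul (c := C) this ?_ ?_
    · exact (hw.1.comp continuous_fst).aestronglyMeasurable
    · exact Filter.Eventually.of_forall fun p => hC p.1
  have h := integral_integral_swap h_int
  simp only [integral_const_mul] at h
  rw [show (∫ x, w x * moll η g x) = ∫ x, w x * ∫ y, g y * η (x - y) from rfl, h]
  refine integral_congr_ae (Filter.Eventually.of_forall fun y => ?_)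
  simp only [moll]
  rw [← integral_const_mul]
  refine integral_congr_ae (Filter.Eventually.of_forall fun x => ?_)
  simp only
  rw [← he (x - y), neg_sub]; ring

/-- A standard mollifying sequence. -/
def stdBump (n k : ℕ) : ContDiffBump (0 : Euc n) where
  rIn := 1 / (2 * ((k : ℝ) + 1))
  rOut := 1 / ((k : ℝ) + 1)
  rIn_pos := by positivity
  rIn_lt_rOut := by
    apply one_div_lt_one_div_of_lt (by positivity)
    have : (0:ℝ) ≤ k := k.cast_nonneg
    linarith

def stdMoll (n k : ℕ) : Euc n → ℝ := (stdBump n k).normed volume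

lemma stdMoll_contDiff (n k : ℕ) : ContDiff ℝ ∞ (stdMoll n k) := (stdBump n k).contDiff_normed

lemma stdMoll_hasCompactSupport (n k : ℕ) : HasCompactSupport (stdMoll n k) :=
  (stdBump n k).hasCompactSupport_normed

lemma stdMoll_isCc (n k : ℕ) : IsCc (stdMoll n k) :=
  ⟨(stdMoll_contDiff n k).continuous, stdMoll_hasCompactSupport n k⟩

lemma stdMoll_nonneg (n k : ℕ) (y : Euc n) : 0 ≤ stdMoll n k y := (stdBump n k).nonneg_normed y

lemma stdMoll_integral (n k : ℕ) : ∫ y, stdMoll n k y = 1 := (stdBump n k).integral_normed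

lemma stdMoll_neg (n k : ℕ) (y : Euc n) : stdMoll n k (-y) = stdMoll n k y :=
  (stdBump n k).normed_neg y

lemma dist_lt_of_stdMoll_ne_zero {k : ℕ} {x y : Euc n} (h : stdMoll n k (x - y) ≠ 0) :
    dist x y < 1 / ((k : ℝ) + 1) := by
  have : x - y ∈ Function.support ((stdBump n k).normed volume) := h
  rw [(stdBump n k).support_normed_eq] at this
  rw [Metric.mem_ball, dist_zero_right] at this
  rw [dist_eq_norm]
  exact this

lemma ae_tendsto_moll (hg : LocallyIntegrable g) :
    ∀ᵐ x, Filter.Tendsto (fun k => moll (stdMoll n k) g x) Filter.atTop (nhds (g x)) := by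
  have := ContDiffBump.ae_convolution_tendsto_right_of_locallyIntegrable (φ := stdBump n)
    (l := Filter.atTop) (K := 2) (g := g) (μ := volume) tendsto_one_div_add_atTop_nhds_zero_nat
    (Filter.Eventually.of_forall fun k => le_of_eq (by
      simp only [stdBump]; field_simp)) hg
  filter_upwards [this] with x hx
  refine hx.congr fun k => ?_
  rw [convolution_lsmul_swap, moll]
  simp [stdMoll, mul_comm]

/-- Weak convergence of mollifications. -/
lemma tendsto_integral_mul_moll (hw : IsCc w) (hg : Integrable g) :
    Filter.Tendsto (fun k => ∫ x, w x * moll (stdMoll n k) g x) Filter.atTop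
      (nhds (∫ x, w x * g x)) := by
  have hloc : LocallyIntegrable w := hw.1.locallyIntegrable
  obtain ⟨C, hC⟩ : ∃ C, ∀ x, ‖w x‖ ≤ C := hw.2.exists_bound_of_continuous hw.1
  have hC0 : 0 ≤ C := (norm_nonneg _).trans (hC 0)
  have e (k : ℕ) : ∫ x, w x * moll (stdMoll n k) g x = ∫ x, moll (stdMoll n k) w x * g x := by
    rw [integral_mul_moll (stdMoll_isCc n k) (stdMoll_neg n k) hw hg]
    simp_rw [mul_comm]
  simp_rw [e]
  refine tendsto_integral_of_dominated_convergence (fun x => C * ‖g x‖) (fun k => ?_)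
    (hg.norm.const_mul C) (fun k => Filter.Eventually.of_forall fun x => ?_) ?_
  · exact ((moll_contDiff (stdMoll_contDiff n k) (stdMoll_hasCompactSupport n k)
      hloc).continuous.aestronglyMeasurable).mul hg.aestronglyMeasurable
  · rw [norm_mul]
    gcongr
    have := moll_sub_le_of_dist_le (c := 0) (ε := C) (stdMoll_isCc n k) (stdMoll_nonneg n k)
      (stdMoll_integral n k) hloc x (fun y _ => by simpa using hC y)
    simpa using this
  · filter_upwards [ae_tendsto_moll hloc] with x hx
    exact hx.mul_const _

end Mollification

section Cutoff

variable {n : ℕ}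

/-- A smooth even cutoff function equal to `1` on the ball of radius `R`. -/
def cutoff (n : ℕ) (R : ℝ) (x : Euc n) : ℝ :=
  (⟨1, 2, one_pos, one_lt_two⟩ : ContDiffBump (0 : Euc n)) (R⁻¹ • x)

lemma cutoff_contDiff (R : ℝ) : ContDiff ℝ ∞ (cutoff n R) :=
  (ContDiffBump.contDiff _).comp (by fun_prop)

lemma cutoff_hasCompactSupport {R : ℝ} (hR : 0 < R) : HasCompactSupport (cutoff n R) :=
  (ContDiffBump.hasCompactSupport _).comp_homeomorph
    (Homeomorph.smulOfNeZero R⁻¹ (inv_ne_zero hR.ne'))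

lemma cutoff_isCc {R : ℝ} (hR : 0 < R) : IsCc (cutoff n R) :=
  ⟨(cutoff_contDiff R).continuous, cutoff_hasCompactSupport hR⟩

lemma cutoff_nonneg (R : ℝ) (x : Euc n) : 0 ≤ cutoff n R x := ContDiffBump.nonneg _

lemma cutoff_le_one (R : ℝ) (x : Euc n) : cutoff n R x ≤ 1 := ContDiffBump.le_one _

lemma cutoff_eq_one {R : ℝ} (hR : 0 < R) {x : Euc n} (hx : ‖x‖ ≤ R) : cutoff n R x = 1 := by
  apply ContDiffBump.one_of_mem_closedBall
  rw [mem_closedBall_zero_iff, norm_smul, norm_inv, Real.norm_of_nonneg hR.le]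
  exact (inv_mul_le_one₀ hR).mpr hx

lemma pd_cutoff (R : ℝ) (i : Fin n) (x : Euc n) :
    pd i (cutoff n R) x = R⁻¹ * pd i (cutoff n 1) (R⁻¹ • x) := by
  have : cutoff n R = fun y => cutoff n 1 (R⁻¹ • y) := by ext y; simp [cutoff]
  rw [this, pd_comp_smul]

lemma exists_pd_cutoff_le (n : ℕ) : ∃ C, 0 ≤ C ∧ ∀ (R : ℝ), 0 < R → ∀ (i : Fin n) (x : Euc n),
    |pd i (cutoff n R) x| ≤ C * R⁻¹ := by
  have h (i : Fin n) : ∃ C, ∀ x, ‖pd i (cutoff n 1) x‖ ≤ C := by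
    have := IsCc.pd (i := i) ((cutoff_contDiff 1).of_le (by simp))
      (cutoff_hasCompactSupport (n := n) one_pos)
    exact this.2.exists_bound_of_continuous this.1
  choose C hC using h
  refine ⟨∑ i, |C i|, Finset.sum_nonneg fun _ _ => abs_nonneg _, fun R hR i x => ?_⟩
  rw [pd_cutoff, abs_mul, abs_of_pos (inv_pos.mpr hR), mul_comm]
  gcongr
  exact (hC i _).trans ((le_abs_self _).trans
    (Finset.single_le_sum (f := fun i => |C i|) (fun _ _ => abs_nonneg _) (Finset.mem_univ i)))

lemma exists_euler_cutoff_le (n : ℕ) : ∃ C, 0 ≤ C ∧ ∀ (R : ℝ) (x : Euc n),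
    |∑ i, x i * pd i (cutoff n R) x| ≤ C := by
  have h : IsCc fun x : Euc n => ∑ i, x i * pd i (cutoff n 1) x :=
    IsCc.sum fun i _ => (IsCc.pd ((cutoff_contDiff 1).of_le (by simp))
      (cutoff_hasCompactSupport one_pos)).mul_left (by fun_prop)
  obtain ⟨C, hC⟩ := h.2.exists_bound_of_continuous h.1
  refine ⟨C, (norm_nonneg _).trans (hC 0), fun R x => ?_⟩
  have := hC (R⁻¹ • x)
  refine le_trans (le_of_eq ?_) this
  rw [Real.norm_eq_abs]
  congr 1
  refine Finset.sum_congr rfl fun i _ => ?_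
  rw [pd_cutoff]; simp; ring

lemma tendsto_cutoff (x : Euc n) :
    Filter.Tendsto (fun k : ℕ => cutoff n ((k : ℝ) + 1) x) Filter.atTop (nhds 1) := by
  refine tendsto_const_nhds.congr' ?_
  filter_upwards [Filter.eventually_ge_atTop ⌈‖x‖⌉₊] with k hk
  refine (cutoff_eq_one (by positivity) ?_).symm
  have := Nat.le_ceil ‖x‖
  have h2 : (⌈‖x‖⌉₊ : ℝ) ≤ k := by exact_mod_cast hk
  linarith

end Cutoff

lemma sq_le_mul_of_quadratic {A B C : ℝ} (h : ∀ s : ℝ, 0 ≤ A * s ^ 2 + 2 * B * s + C) :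
    B ^ 2 ≤ A * C := by
  have := discrim_le_zero (a := A) (b := 2 * B) (c := C) fun s => by
    have := h s; rw [pow_two] at this; exact this
  rw [discrim] at this
  nlinarith

lemma sq_integral_mul_le {α : Type*} [MeasurableSpace α] {ν : Measure α} {a b : α → ℝ}
    (ha : Integrable (fun x => a x ^ 2) ν) (hb : Integrable (fun x => b x ^ 2) ν)
    (hab : Integrable (fun x => a x * b x) ν) :
    (∫ x, a x * b x ∂ν) ^ 2 ≤ (∫ x, a x ^ 2 ∂ν) * ∫ x, b x ^ 2 ∂ν := by
  refine sq_le_mul_of_quadratic fun s => ?_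
  have h : 0 ≤ ∫ x, (s * a x + b x) ^ 2 ∂ν := integral_nonneg fun x => sq_nonneg _
  have e : (fun x => (s * a x + b x) ^ 2) = fun x =>
      (s ^ 2 * a x ^ 2 + (2 * s) * (a x * b x)) + b x ^ 2 := by ext x; ring
  rw [e, integral_add ((ha.const_mul _).fun_add (hab.const_mul _)) hb,
    integral_add (ha.const_mul _) (hab.const_mul _), integral_const_mul, integral_const_mul] at h
  linarith

section Liouville

lemma contDiff_infty_two {n : ℕ} {f : Euc n → ℝ} (h : ContDiff ℝ ∞ f) : ContDiff ℝ 2 f := by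
  exact_mod_cast contDiff_infty.mp h 2

lemma contDiff_infty_three {n : ℕ} {f : Euc n → ℝ} (h : ContDiff ℝ ∞ f) : ContDiff ℝ 3 f := by
  exact_mod_cast contDiff_infty.mp h 3

variable {n : ℕ} {Φ f η χ ζ : Euc n → ℝ}

lemma pd_reflect (i : Fin n) (f : Euc n → ℝ) (x y : Euc n) :
    pd i (fun y => f (x - y)) y = - pd i f (x - y) := by
  have h : (fun y => f (x - y)) = fun y => (fun z => f (x + z)) ((-1 : ℝ) • y) := by
    ext y; simp [sub_eq_add_neg]
  rw [h]
  refine (pd_comp_smul (f := fun z => f (x + z)) (-1)).trans ?_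
  simp [pd, fderiv_comp_add_left, sub_eq_add_neg]

lemma sum_pd_moll_eq_zero (hΦ : ContDiff ℝ 2 Φ) (hf : LocallyIntegrable f)
    (hη : ContDiff ℝ ∞ η) (hc : HasCompactSupport η)
    (hL : ∀ u : Euc n → ℝ, ContDiff ℝ ∞ u → HasCompactSupport u → ∫ x, f x * genL Φ u x = 0)
    (x : Euc n) :
    ∑ i, (moll (pd i (pd i η)) f x + moll (pd i η) (fun y => f y * pd i Φ y) x) = 0 := by
  have h := hL (fun y => η (x - y)) (hη.comp (by fun_prop))
    (hc.comp_homeomorph (Homeomorph.subLeft x))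
  rw [← h]
  have e (y : Euc n) : f y * genL Φ (fun y => η (x - y)) y =
      ∑ i, (f y * pd i (pd i η) (x - y) + f y * pd i Φ y * pd i η (x - y)) := by
    rw [genL, Finset.mul_sum]
    refine Finset.sum_congr rfl fun i _ => ?_
    have e1 : pd i (fun y => η (x - y)) = fun y => (-1) * pd i η (x - y) := by
      ext y; rw [pd_reflect]; ring
    have hd : Differentiable ℝ fun y => pd i η (x - y) :=
      ((pd_contDiff_infty hη).differentiable (by simp)).comp (by fun_prop)
    rw [e1, pd_const_mul _ hd, pd_reflect]
    ring
  simp_rw [e]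
  have hη1 : ContDiff ℝ 1 η := hη.of_le (by simp)
  have hη2 : ContDiff ℝ 2 η := contDiff_infty_two hη
  have i1 (i : Fin n) := moll_integrable (IsCc.pd_pd (i := i) (j := i) hη2 hc) hf x
  have i2 (i : Fin n) := moll_integrable (IsCc.pd (i := i) hη1 hc)
    (locallyIntegrable_mul_cont hf (pd_continuous (i := i) (hΦ.of_le (by norm_num)))) x
  rw [integral_finsetSum _ fun i _ => (i1 i).fun_add (i2 i)]
  refine Finset.sum_congr rfl fun i _ => ?_
  rw [integral_add (i1 i) (i2 i), moll, moll]

lemma caccioppoli {κ : ℝ} (hΦ : ContDiff ℝ 2 Φ) (hf : LocallyIntegrable f)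
    (hf2 : LocallyIntegrable fun x => f x ^ 2)
    (hη : ContDiff ℝ ∞ η) (hc : HasCompactSupport η) (h0 : ∀ y, 0 ≤ η y) (h1 : ∫ y, η y = 1)
    (hL : ∀ u : Euc n → ℝ, ContDiff ℝ ∞ u → HasCompactSupport u → ∫ x, f x * genL Φ u x = 0)
    (hχ : ContDiff ℝ ∞ χ) (hχc : HasCompactSupport χ)
    (hκ : ∀ x, χ x ≠ 0 → ∀ i y, η (x - y) ≠ 0 → |pd i Φ x - pd i Φ y| ≤ κ) :
    ∫ x, χ x ^ 2 * Real.exp (-Φ x) * ∑ i, pd i (fun y => moll η f y * Real.exp (Φ y)) x ^ 2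
      ≤ 10 * (∫ x, (∑ i, pd i χ x ^ 2) * Real.exp (Φ x) * moll η (fun y => f y ^ 2) x)
        + 4 * n * κ ^ 2 * ∫ x, χ x ^ 2 * Real.exp (Φ x) * moll η (fun y => f y ^ 2) x := by
  have hηcc : IsCc η := ⟨hη.continuous, hc⟩
  have hη1 : ContDiff ℝ 1 η := hη.of_le (by simp)
  have hχ1 : ContDiff ℝ 1 χ := hχ.of_le (by simp)
  have hχcc : IsCc χ := ⟨hχ.continuous, hχc⟩
  have hΦ1 : ContDiff ℝ 1 Φ := hΦ.of_le (by norm_num)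
  have hΦd : Differentiable ℝ Φ := hΦ1.differentiable (by norm_num)
  set F := moll η f with hF
  set m := moll η (fun y => f y ^ 2) with hm
  have hFs : ContDiff ℝ ∞ F := moll_contDiff hη hc hf
  have hFd : Differentiable ℝ F := hFs.differentiable (by simp)
  have hms : ContDiff ℝ ∞ m := moll_contDiff hη hc hf2
  have hfb (i : Fin n) : LocallyIntegrable fun y => f y * pd i Φ y :=
    locallyIntegrable_mul_cont hf (pd_continuous hΦ1)
  set H : Euc n → ℝ := fun y => F y * Real.exp (Φ y) with hH
  have hE2 : ContDiff ℝ 2 fun y => Real.exp (Φ y) := hΦ.exp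
  have hEd : Differentiable ℝ fun y => Real.exp (Φ y) := hE2.differentiable (by norm_num)
  have hHs : ContDiff ℝ 2 H := (contDiff_infty_two hFs).mul hE2
  have hH1 : ContDiff ℝ 1 H := hHs.of_le (by norm_num)
  have hHd : Differentiable ℝ H := hHs.differentiable (by norm_num)
  set A : Fin n → Euc n → ℝ := fun i x => moll (pd i η) f x + moll η (fun y => f y * pd i Φ y) x
    with hA
  have hAs (i : Fin n) : ContDiff ℝ ∞ (A i) :=
    (moll_contDiff (pd_contDiff_infty hη) (pd_hasCompactSupport hc) hf).add
      (moll_contDiff hη hc (hfb i))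
  have hAd (i : Fin n) : Differentiable ℝ (A i) := (hAs i).differentiable (by simp)
  have hdiv (x : Euc n) : ∑ i, pd i (A i) x = 0 := by
    rw [← sum_pd_moll_eq_zero hΦ hf hη hc hL x]
    refine Finset.sum_congr rfl fun i _ => ?_
    rw [hA, pd_add ((moll_contDiff (pd_contDiff_infty hη) (pd_hasCompactSupport hc)
      hf).differentiable (by simp)) ((moll_contDiff hη hc (hfb i)).differentiable (by simp)),
      pd_moll ((pd_contDiff_infty hη).of_le (by simp)) (pd_hasCompactSupport hc) hf,
      pd_moll hη1 hc (hfb i)]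
  set θ : Euc n → ℝ := fun x => χ x ^ 2 * H x with hθ
  have hθ1 : ContDiff ℝ 1 θ := (hχ1.pow 2).mul hH1
  have hθd : Differentiable ℝ θ := hθ1.differentiable (by norm_num)
  have hθc : HasCompactSupport θ := (hχcc.sq.mul_right hH1.continuous).2
  have hS : ∫ x, ∑ i, A i x * pd i θ x = 0 := by
    have e (i : Fin n) : ∫ x, A i x * pd i θ x = - ∫ x, pd i (A i) x * θ x := by
      have h := integral_pd_eq_zero (i := i) (f := fun x => A i x * θ x)
        (((hAs i).of_le (by simp)).mul hθ1) hθc.mul_left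
      have e2 : pd i (fun x => A i x * θ x) = fun x => pd i (A i) x * θ x + A i x * pd i θ x := by
        ext x; rw [pd_mul (hAd i) hθd]
      rw [e2, integral_add] at h
      · linarith
      · exact (IsCc.mul_left ⟨hθ1.continuous, hθc⟩
          (pd_contDiff_infty (hAs i)).continuous).integrable _
      · exact ((IsCc.pd hθ1 hθc).mul_left (hAs i).continuous).integrable _
    rw [integral_finsetSum _ fun i _ =>
      ((IsCc.pd hθ1 hθc).mul_left (hAs i).continuous).integrable _]
    simp_rw [e]
    rw [Finset.sum_neg_distrib, ← integral_finsetSum _ fun i _ => (IsCc.mul_left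
      ⟨hθ1.continuous, hθc⟩ (pd_contDiff_infty (hAs i)).continuous).integrable _]
    simp_rw [← Finset.sum_mul, hdiv]
    simp
  have hpt (x : Euc n) : χ x ^ 2 * Real.exp (-Φ x) * ∑ i, pd i H x ^ 2 ≤
      2 * (∑ i, A i x * pd i θ x) + (10 * ((∑ i, pd i χ x ^ 2) * Real.exp (Φ x) * m x)
        + 4 * n * κ ^ 2 * (χ x ^ 2 * Real.exp (Φ x) * m x)) := by
    have hm0 : F x ^ 2 ≤ m x := sq_moll_le hηcc h0 h1 hf hf2 x
    have hi (i : Fin n) : χ x ^ 2 * Real.exp (-Φ x) * pd i H x ^ 2 ≤ 2 * (A i x * pd i θ x) +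
        (10 * (pd i χ x ^ 2 * Real.exp (Φ x) * m x)
          + 4 * κ ^ 2 * (χ x ^ 2 * Real.exp (Φ x) * m x)) := by
      set E := Real.exp (Φ x) with hE
      have hEpos : 0 < E := Real.exp_pos _
      have hEinv : Real.exp (-Φ x) = E⁻¹ := Real.exp_neg _
      set g := pd i F x + F x * pd i Φ x with hg
      set c := F x * pd i Φ x - moll η (fun y => f y * pd i Φ y) x with hcdef
      have hHi : pd i H x = E * g := by
        rw [hH, pd_mul hFd hEd, pd_comp (Real.hasDerivAt_exp _) (hΦd x)]
        rw [hg, ← hE]; ring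
      have hAi : A i x = g - c := by
        rw [hA, hg, hcdef, hF, pd_moll hη1 hc hf]; ring
      have hθi : pd i θ x = 2 * χ x * pd i χ x * (F x * E) + χ x ^ 2 * (E * g) := by
        rw [hθ, pd_mul ((hχ1.pow 2).differentiable (by norm_num)) hHd, hHi,
          pd_comp (φ := fun t => t ^ 2) (hasDerivAt_pow 2 (χ x))
            ((hχ1.differentiable (by norm_num)) x)]
        simp [hH, hE]
      have hcc : χ x ^ 2 * c ^ 2 ≤ κ ^ 2 * (χ x ^ 2 * m x) := by
        by_cases hx : χ x = 0
        · simp [hx]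
        · have := sq_commutator_le (b := pd i Φ) hηcc h0 h1 hf hf2 (pd_continuous hΦ1) x
            (hκ x hx i)
          calc _ ≤ χ x ^ 2 * (κ ^ 2 * m x) := by gcongr
            _ = _ := by ring
      have hFF : pd i χ x ^ 2 * F x ^ 2 ≤ pd i χ x ^ 2 * m x := by gcongr
      have key : χ x ^ 2 * g ^ 2 ≤ 2 * ((g - c) * (2 * χ x * pd i χ x * F x + χ x ^ 2 * g))
          + (10 * (pd i χ x ^ 2 * m x) + 4 * κ ^ 2 * (χ x ^ 2 * m x)) := by
        have := sq_nonneg (χ x * g + 2 * (pd i χ x * F x) - χ x * c)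
        nlinarith [sq_nonneg (pd i χ x * F x), sq_nonneg (χ x * c)]
      rw [hHi, hAi, hθi, hEinv]
      have l : χ x ^ 2 * E⁻¹ * (E * g) ^ 2 = E * (χ x ^ 2 * g ^ 2) := by field_simp
      rw [l]
      calc _ ≤ E * _ := mul_le_mul_of_nonneg_left key hEpos.le
        _ = _ := by ring
    calc _ = ∑ i, χ x ^ 2 * Real.exp (-Φ x) * pd i H x ^ 2 := by rw [Finset.mul_sum]
      _ ≤ _ := Finset.sum_le_sum fun i _ => hi i
      _ = _ := by
        simp only [Finset.sum_add_distrib, ← Finset.mul_sum, ← Finset.sum_mul, Finset.sum_const,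
          Finset.card_univ, Fintype.card_fin, nsmul_eq_mul]
        ring
  have hEc : Continuous fun x => Real.exp (Φ x) := hE2.continuous
  have hEc' : Continuous fun x => Real.exp (-Φ x) := hΦ1.continuous.neg.rexp
  have hm' := hms.continuous
  have i1 : Integrable fun x => χ x ^ 2 * Real.exp (-Φ x) * ∑ i, pd i H x ^ 2 :=
    ((hχcc.sq.mul_right hEc').mul_right (continuous_finsetSum _ fun i _ =>
      (pd_continuous hH1).pow 2)).integrable _
  have i2 : Integrable fun x => ∑ i, A i x * pd i θ x :=
    (IsCc.sum fun i _ => (IsCc.pd hθ1 hθc).mul_left (hAs i).continuous).integrable _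
  have i3 : Integrable fun x => (∑ i, pd i χ x ^ 2) * Real.exp (Φ x) * m x :=
    (((IsCc.sum fun i _ => (IsCc.pd hχ1 hχc).sq).mul_right hEc).mul_right hm').integrable _
  have i4 : Integrable fun x => χ x ^ 2 * Real.exp (Φ x) * m x :=
    ((hχcc.sq.mul_right hEc).mul_right hm').integrable _
  have := integral_mono i1 ((i2.const_mul 2).fun_add ((i3.const_mul 10).fun_add
    (i4.const_mul (4 * n * κ ^ 2)))) hpt
  rw [integral_add (i2.const_mul 2) ((i3.const_mul 10).fun_add (i4.const_mul _)),
    integral_add (i3.const_mul 10) (i4.const_mul _), integral_const_mul, integral_const_mul,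
    integral_const_mul, hS] at this
  linarith

end Liouville

section Liouville

variable {n : ℕ} {Φ f g h u v χ ζ : Euc n → ℝ}

lemma sq_integral_weak_deriv_le (hΦ : ContDiff ℝ 2 Φ) (hf : Integrable f)
    (hf2 : Integrable fun x => f x ^ 2)
    (hL : ∀ u : Euc n → ℝ, ContDiff ℝ ∞ u → HasCompactSupport u → ∫ x, f x * genL Φ u x = 0)
    (hχ : ContDiff ℝ ∞ χ) (hχc : HasCompactSupport χ)
    (hζ : ContDiff ℝ ∞ ζ) (hζc : HasCompactSupport ζ) (h1 : ∀ x, ζ x ≠ 0 → χ x = 1) (i : Fin n) :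
    (∫ x, Real.exp (Φ x) * pd i ζ x * f x) ^ 2 ≤ (∫ x, ζ x ^ 2 * Real.exp (Φ x)) *
      (10 * ∫ x, (∑ i, pd i χ x ^ 2) * Real.exp (Φ x) * f x ^ 2) := by
  have hΦ1 : ContDiff ℝ 1 Φ := hΦ.of_le (by norm_num)
  have hχ1 : ContDiff ℝ 1 χ := hχ.of_le (by simp)
  have hζ1 : ContDiff ℝ 1 ζ := hζ.of_le (by simp)
  have hχcc : IsCc χ := ⟨hχ.continuous, hχc⟩
  have hζcc : IsCc ζ := ⟨hζ.continuous, hζc⟩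
  have hE : ContDiff ℝ 2 fun x => Real.exp (Φ x) := hΦ.exp
  have hEc := hE.continuous
  have t1 := tendsto_integral_mul_moll (w := fun x => Real.exp (Φ x) * pd i ζ x)
    ((IsCc.pd hζ1 hζc).mul_left hEc) hf
  have t2 := tendsto_integral_mul_moll (w := fun x => (∑ i, pd i χ x ^ 2) * Real.exp (Φ x))
    ((IsCc.sum fun i _ => (IsCc.pd hχ1 hχc).sq).mul_right hEc) hf2
  have t3 := tendsto_integral_mul_moll (w := fun x => χ x ^ 2 * Real.exp (Φ x))
    (hχcc.sq.mul_right hEc) hf2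
  set Z := ∫ x, ζ x ^ 2 * Real.exp (Φ x) with hZ
  set W := ∫ x, χ x ^ 2 * Real.exp (Φ x) * f x ^ 2 with hW
  set D := ∫ x, (∑ i, pd i χ x ^ 2) * Real.exp (Φ x) * f x ^ 2 with hD
  have hZ0 : 0 ≤ Z := integral_nonneg fun x => by positivity
  have key (κ : ℝ) (hκ : 0 < κ) : (∫ x, Real.exp (Φ x) * pd i ζ x * f x) ^ 2 ≤
      Z * (10 * D + 4 * n * κ ^ 2 * W) := by
    refine le_of_tendsto_of_tendsto (t1.pow 2)
      (((t2.const_mul 10).add (t3.const_mul (4 * n * κ ^ 2))).const_mul Z) ?_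
    have hev : ∀ᶠ k : ℕ in Filter.atTop, ∀ x, χ x ≠ 0 → ∀ (i : Fin n) y,
        stdMoll n k (x - y) ≠ 0 → |pd i Φ x - pd i Φ y| ≤ κ := by
      have hu (i : Fin n) : ∃ ε > 0, ∀ x y : Euc n, dist x y < ε → χ x ≠ 0 →
          |pd i Φ x - pd i Φ y| ≤ κ := by
        have := IsCompact.uniformContinuousAt_of_continuousAt (s := tsupport χ) hχc (pd i Φ)
          (fun x _ => (pd_continuous hΦ1).continuousAt) (Metric.dist_mem_uniformity hκ)
        obtain ⟨ε, hε, hh⟩ := Metric.mem_uniformity_dist.mp this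
        exact ⟨ε, hε, fun x y hxy hx => (hh hxy (subset_tsupport _ hx)).le⟩
      choose ε hε hh using hu
      have : ∀ᶠ k : ℕ in Filter.atTop, ∀ i : Fin n, 1 / ((k : ℝ) + 1) < ε i :=
        Filter.eventually_all.mpr fun i =>
          tendsto_one_div_add_atTop_nhds_zero_nat.eventually (gt_mem_nhds (hε i))
      filter_upwards [this] with k hk x hx i y hy
      exact hh i x y ((dist_lt_of_stdMoll_ne_zero hy).trans (hk i)) hx
    filter_upwards [hev] with k hk
    set F := moll (stdMoll n k) f with hF
    have hFs : ContDiff ℝ ∞ F :=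
      moll_contDiff (stdMoll_contDiff n k) (stdMoll_hasCompactSupport n k) hf.locallyIntegrable
    set H : Euc n → ℝ := fun y => F y * Real.exp (Φ y) with hH
    have hH1 : ContDiff ℝ 1 H := (hFs.of_le (by simp)).mul (hE.of_le (by norm_num))
    have hc := caccioppoli hΦ hf.locallyIntegrable hf2.locallyIntegrable (stdMoll_contDiff n k)
      (stdMoll_hasCompactSupport n k) (stdMoll_nonneg n k) (stdMoll_integral n k) hL hχ hχc hk
    have hE2 : Continuous fun x => Real.exp (Φ x / 2) := (hΦ.continuous.div_const 2).rexp
    have hE3 : Continuous fun x => Real.exp (-(Φ x / 2)) := (hΦ.continuous.div_const 2).neg.rexp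
    have ibp : ∫ x, Real.exp (Φ x) * pd i ζ x * F x
        = - ∫ x, (ζ x * Real.exp (Φ x / 2)) * (χ x * Real.exp (-(Φ x / 2)) * pd i H x) := by
      have h := integral_pd_eq_zero (i := i) (f := fun x => ζ x * H x) (hζ1.mul hH1) hζc.mul_right
      have e2 : pd i (fun x => ζ x * H x) = fun x => Real.exp (Φ x) * pd i ζ x * F x +
          (ζ x * Real.exp (Φ x / 2)) * (χ x * Real.exp (-(Φ x / 2)) * pd i H x) := by
        ext x
        rw [pd_mul (hζ1.differentiable (by norm_num)) (hH1.differentiable (by norm_num))]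
        have : (ζ x * Real.exp (Φ x / 2)) * (χ x * Real.exp (-(Φ x / 2)) * pd i H x)
            = ζ x * χ x * pd i H x := by
          rw [Real.exp_neg]; field_simp
        rw [this]
        by_cases hx : ζ x = 0
        · simp [hx, hH]; ring
        · rw [h1 x hx]; simp [hH]; ring
      rw [e2, integral_add] at h
      · linarith
      · exact (((IsCc.pd hζ1 hζc).mul_left hEc).mul_right hFs.continuous).integrable _
      · exact ((hζcc.mul_right hE2).mul_right
          ((hχ.continuous.mul hE3).mul (pd_continuous hH1))).integrable _
    rw [ibp, neg_sq]
    have hb : IsCc fun x => χ x * Real.exp (-(Φ x / 2)) * pd i H x :=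
      (hχcc.mul_right hE3).mul_right (pd_continuous hH1)
    have ha : IsCc fun x => ζ x * Real.exp (Φ x / 2) := hζcc.mul_right hE2
    refine (sq_integral_mul_le (ha.sq.integrable _) (hb.sq.integrable _)
      ((ha.mul_right hb.1).integrable _)).trans ?_
    have e3 : ∫ x, (ζ x * Real.exp (Φ x / 2)) ^ 2 = Z := by
      refine integral_congr_ae (Filter.Eventually.of_forall fun x => ?_)
      simp only [mul_pow, ← Real.exp_nat_mul]
      congr 2; push_cast; ring
    rw [e3]
    refine mul_le_mul_of_nonneg_left (le_trans ?_ hc) hZ0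
    refine integral_mono (hb.sq.integrable _) ?_ fun x => ?_
    · exact ((hχcc.sq.mul_right hΦ.continuous.neg.rexp).mul_right
        (continuous_finsetSum _ fun i _ => (pd_continuous hH1).pow 2)).integrable _
    · simp only [mul_pow, ← Real.exp_nat_mul]
      have : ((2 : ℕ) : ℝ) * -(Φ x / 2) = -Φ x := by push_cast; ring
      rw [this]
      gcongr
      exact Finset.single_le_sum (f := fun i => pd i H x ^ 2) (fun _ _ => sq_nonneg _)
        (Finset.mem_univ i)
  have t : Filter.Tendsto (fun κ : ℝ => Z * (10 * D + 4 * n * κ ^ 2 * W)) (nhdsWithin 0 (Set.Ioi 0))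
      (nhds (Z * (10 * D + 4 * n * (0 : ℝ) ^ 2 * W))) :=
    ((Continuous.tendsto (by fun_prop) 0)).mono_left nhdsWithin_le_nhds
  have := ge_of_tendsto t (eventually_nhdsWithin_of_forall fun κ hκ => key κ hκ)
  simpa using this

/-- An `L²` function which is weakly harmonic for `Δ - ∇Φ·∇` is constant. -/
lemma ae_const_of_weakly_harmonic {c : ℝ} (hΦ : ContDiff ℝ 2 Φ) (hb : ∀ x, c ≤ Φ x)
    [IsFiniteMeasure (gibbs Φ)] (hh : MemLp h 2 (gibbs Φ))
    (hL : ∀ u : Euc n → ℝ, ContDiff ℝ ∞ u → HasCompactSupport u →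
      ∫ x, h x * genL Φ u x ∂gibbs Φ = 0) :
    ∃ a : ℝ, ∀ᵐ x, h x = a := by
  have hΦc := hΦ.continuous
  have hf : Integrable fun x => h x * Real.exp (-Φ x) :=
    (integrable_gibbs_iff hΦc).mp (hh.integrable (by norm_num))
  have hh2 : Integrable fun x => h x ^ 2 * Real.exp (-Φ x) :=
    (integrable_gibbs_iff hΦc).mp hh.integrable_sq
  have hf2 : Integrable fun x => (h x * Real.exp (-Φ x)) ^ 2 := by
    have := hh2.mul_bdd (c := Real.exp (-c)) (f := fun x => h x ^ 2 * Real.exp (-Φ x))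
      (g := fun x => Real.exp (-Φ x)) (by fun_prop)
      (Filter.Eventually.of_forall fun x => by
        rw [Real.norm_of_nonneg (Real.exp_pos _).le]; gcongr; exact hb x)
    refine this.congr (Filter.Eventually.of_forall fun x => ?_)
    simp only; ring
  have hhl : LocallyIntegrable h := by
    have := locallyIntegrable_mul_cont hf.locallyIntegrable (hΦc.rexp)
    refine this.congr (Filter.Eventually.of_forall fun x => ?_)
    simp only; rw [Real.exp_neg]; field_simp
  have hL' (u : Euc n → ℝ) (hu : ContDiff ℝ ∞ u) (hc : HasCompactSupport u) :
      ∫ x, h x * Real.exp (-Φ x) * genL Φ u x = 0 := by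
    rw [← hL u hu hc, integral_gibbs hΦc]
    exact integral_congr_ae (Filter.Eventually.of_forall fun x => by simp only; ring)
  obtain ⟨C, hC0, hC⟩ := exists_pd_cutoff_le n
  have weak (ζ : Euc n → ℝ) (hζ : ContDiff ℝ ∞ ζ) (hζc : HasCompactSupport ζ) (i : Fin n) :
      ∫ x, h x * pd i ζ x = 0 := by
    obtain ⟨R₀, hR₀⟩ : ∃ R₀, ∀ x, ζ x ≠ 0 → ‖x‖ ≤ R₀ := by
      obtain ⟨R₀, hR₀⟩ := (isBounded_iff_forall_norm_le).mp hζc.isBounded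
      exact ⟨R₀, fun x hx => hR₀ x (subset_tsupport _ hx)⟩
    have e : ∫ x, h x * pd i ζ x = ∫ x, Real.exp (Φ x) * pd i ζ x * (h x * Real.exp (-Φ x)) := by
      refine integral_congr_ae (Filter.Eventually.of_forall fun x => ?_)
      simp only; rw [Real.exp_neg]; field_simp
    rw [e]
    set Z := ∫ x, ζ x ^ 2 * Real.exp (Φ x) with hZ
    have hZ0 : 0 ≤ Z := integral_nonneg fun x => by positivity
    set J := ∫ x, h x ^ 2 * Real.exp (-Φ x) with hJ
    have key (R : ℝ) (hR : 0 < R) (hRR : R₀ ≤ R) :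
        (∫ x, Real.exp (Φ x) * pd i ζ x * (h x * Real.exp (-Φ x))) ^ 2 ≤
          Z * (10 * (n * (C * R⁻¹) ^ 2 * J)) := by
      refine (sq_integral_weak_deriv_le hΦ hf hf2 hL' (cutoff_contDiff R)
        (cutoff_hasCompactSupport hR) hζ hζc
        (fun x hx => cutoff_eq_one hR ((hR₀ x hx).trans hRR)) i).trans ?_
      refine mul_le_mul_of_nonneg_left (mul_le_mul_of_nonneg_left ?_ (by norm_num)) hZ0
      rw [hJ, ← integral_const_mul]
      refine integral_mono_of_nonneg (Filter.Eventually.of_forall fun x => by positivity)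
        (hh2.const_mul _) (Filter.Eventually.of_forall fun x => ?_)
      have e1 : Real.exp (Φ x) * (h x * Real.exp (-Φ x)) ^ 2 = h x ^ 2 * Real.exp (-Φ x) := by
        rw [Real.exp_neg]; field_simp
      simp only
      rw [mul_assoc, e1]
      gcongr
      calc _ ≤ ∑ i : Fin n, (C * R⁻¹) ^ 2 := by
            refine Finset.sum_le_sum fun i _ => ?_
            rw [← sq_abs]
            gcongr
            exact hC R hR i x
        _ = _ := by simp
    have t : Filter.Tendsto (fun R : ℝ => Z * (10 * (n * (C * R⁻¹) ^ 2 * J))) Filter.atTop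
        (nhds (Z * (10 * (n * (C * 0) ^ 2 * J)))) :=
      (((((tendsto_inv_atTop_zero.const_mul C).pow 2).const_mul _).mul_const J).const_mul
        10).const_mul Z
    have := ge_of_tendsto t (by
      filter_upwards [Filter.eventually_gt_atTop 0, Filter.eventually_ge_atTop R₀] with R h1 h2
      exact key R h1 h2)
    have h0 : (∫ x, Real.exp (Φ x) * pd i ζ x * (h x * Real.exp (-Φ x))) ^ 2 ≤ 0 := by
      simpa using this
    exact pow_eq_zero_iff (two_ne_zero) |>.mp (le_antisymm h0 (sq_nonneg _))
  have hconst (k : ℕ) (x : Euc n) : moll (stdMoll n k) h x = moll (stdMoll n k) h 0 := by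
    have hs := stdMoll_contDiff n k
    have hc := stdMoll_hasCompactSupport n k
    refine is_const_of_fderiv_eq_zero (𝕜 := ℝ)
      ((moll_contDiff hs hc hhl).differentiable (by simp)) (fun x => ?_) x 0
    ext v
    rw [fderiv_eq_sum_pd]
    refine Finset.sum_eq_zero fun i _ => ?_
    rw [pd_moll (hs.of_le (by simp)) hc hhl, moll]
    have := weak (fun y => stdMoll n k (x - y)) (hs.comp (by fun_prop))
      (hc.comp_homeomorph (Homeomorph.subLeft x)) i
    simp only [pd_reflect, mul_neg, integral_neg, neg_eq_zero] at this
    rw [this, mul_zero]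
  have hae := ae_tendsto_moll hhl
  obtain ⟨x₀, hx₀⟩ := hae.exists
  refine ⟨h x₀, ?_⟩
  filter_upwards [hae] with x hx
  refine tendsto_nhds_unique hx (hx₀.congr fun k => ?_)
  rw [hconst k x, hconst k x₀]

end Liouville

section Density

variable {n : ℕ} {Φ g u v : Euc n → ℝ}

lemma genL_add (hu : ContDiff ℝ 2 u) (hv : ContDiff ℝ 2 v) (x : Euc n) :
    genL Φ (fun y => u y + v y) x = genL Φ u x + genL Φ v x := by
  have h1 (i : Fin n) : pd i (fun y => u y + v y) = fun y => pd i u y + pd i v y := by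
    ext y; exact pd_add (hu.differentiable (by norm_num)) (hv.differentiable (by norm_num))
  have d {w : Euc n → ℝ} (hw : ContDiff ℝ 2 w) (i : Fin n) : Differentiable ℝ (pd i w) :=
    (pd_contDiff (k := 1) hw (by norm_num)).differentiable (by norm_num)
  simp only [genL, h1]
  rw [← Finset.sum_add_distrib]
  refine Finset.sum_congr rfl fun i _ => ?_
  rw [pd_add (d hu i) (d hv i)]; ring

lemma genL_const_mul (c : ℝ) (hu : ContDiff ℝ 2 u) (x : Euc n) :
    genL Φ (fun y => c * u y) x = c * genL Φ u x := by
  have h1 (i : Fin n) : pd i (fun y => c * u y) = fun y => c * pd i u y := by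
    ext y; exact pd_const_mul c (hu.differentiable (by norm_num))
  simp only [genL, h1]
  rw [Finset.mul_sum]
  refine Finset.sum_congr rfl fun i _ => ?_
  rw [pd_const_mul c ((pd_contDiff (k := 1) hu (by norm_num)).differentiable (by norm_num))]
  ring

/-- Mean-zero `L²` functions are approximated by `Δu - ∇Φ·∇u` with `u` a test function. -/
lemma exists_genL_approx {c δ : ℝ} (hΦ : ContDiff ℝ 2 Φ) (hb : ∀ x, c ≤ Φ x)
    [IsFiniteMeasure (gibbs Φ)] (hg : MemLp g 2 (gibbs Φ)) (hg0 : ∫ x, g x ∂gibbs Φ = 0)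
    (hδ : 0 < δ) : ∃ u : Euc n → ℝ, ContDiff ℝ ∞ u ∧ HasCompactSupport u ∧
      ∫ x, (genL Φ u x - g x) ^ 2 ∂gibbs Φ < δ := by
  set ν := gibbs Φ with hν
  have hΦ1 : ContDiff ℝ 1 Φ := hΦ.of_le (by norm_num)
  let S : Submodule ℝ (Lp ℝ 2 ν) :=
    { carrier := {F | ∃ u : Euc n → ℝ, ContDiff ℝ ∞ u ∧ HasCompactSupport u ∧ F =ᵐ[ν] genL Φ u}
      add_mem' := by
        rintro F G ⟨u, hu, huc, hF⟩ ⟨v, hv, hvc, hG⟩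
        refine ⟨fun y => u y + v y, hu.add hv, huc.add hvc, ?_⟩
        filter_upwards [Lp.coeFn_add F G, hF, hG] with x h1 h2 h3
        rw [h1, Pi.add_apply, h2, h3, genL_add (contDiff_infty_two hu) (contDiff_infty_two hv)]
      zero_mem' := by
        refine ⟨fun _ => 0, contDiff_const, HasCompactSupport.zero, ?_⟩
        filter_upwards [Lp.coeFn_zero ℝ 2 ν] with x h1
        rw [h1]
        simpa using (genL_const_mul (Φ := Φ) (u := fun _ => 0) 0 contDiff_const x).symm
      smul_mem' := by
        rintro a F ⟨u, hu, huc, hF⟩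
        refine ⟨fun y => a * u y, contDiff_const.mul hu, huc.mul_left, ?_⟩
        filter_upwards [Lp.coeFn_smul a F, hF] with x h1 h2
        rw [h1, Pi.smul_apply, h2, genL_const_mul a (contDiff_infty_two hu), smul_eq_mul] }
  have hmem : hg.toLp g ∈ S.topologicalClosure := by
    rw [← Submodule.orthogonal_orthogonal_eq_closure, Submodule.mem_orthogonal]
    intro h hh
    rw [Submodule.mem_orthogonal'] at hh
    obtain ⟨a, ha⟩ := ae_const_of_weakly_harmonic (h := h) hΦ hb (Lp.memLp h) (by
      intro u hu huc
      have hcc : IsCc (genL Φ u) := IsCc.genL hΦ1 (contDiff_infty_two hu) huc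
      have hm : MemLp (genL Φ u) 2 ν := hcc.memLp ν 2
      have := hh (hm.toLp _) ⟨u, hu, huc, hm.coeFn_toLp⟩
      rw [L2.inner_def] at this
      rw [← this]
      refine integral_congr_ae ?_
      filter_upwards [hm.coeFn_toLp] with x hx
      rw [hx]; simp [mul_comm])
    have ha' : ∀ᵐ x ∂ν, h x = a := (withDensity_absolutelyContinuous _ _).ae_le ha
    rw [L2.inner_def]
    have : ∫ x, ⟪h x, hg.toLp g x⟫ ∂ν = ∫ x, a * g x ∂ν := by
      refine integral_congr_ae ?_
      filter_upwards [hg.coeFn_toLp, ha'] with x h1 h2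
      rw [h1, h2]; simp [mul_comm]
    rw [this, integral_const_mul, hg0, mul_zero]
  obtain ⟨F, ⟨u, hu, huc, hF⟩, hd⟩ := Metric.mem_closure_iff.mp hmem (Real.sqrt δ)
    (Real.sqrt_pos.mpr hδ)
  refine ⟨u, hu, huc, ?_⟩
  have e : ∫ x, (genL Φ u x - g x) ^ 2 ∂ν = dist (hg.toLp g) F ^ 2 := by
    rw [dist_eq_norm, ← real_inner_self_eq_norm_sq, L2.inner_def]
    refine integral_congr_ae ?_
    filter_upwards [hg.coeFn_toLp, hF, Lp.coeFn_sub (hg.toLp g) F] with x h1 h2 h3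
    rw [h3, Pi.sub_apply, h1, h2]
    simp; ring
  rw [e]
  calc _ < Real.sqrt δ ^ 2 := by gcongr
    _ = δ := Real.sq_sqrt hδ.le

lemma integral_gibbs_neg (hΦ : Continuous Φ) (he : ∀ x, Φ (-x) = Φ x) (f : Euc n → ℝ) :
    ∫ x, f (-x) ∂gibbs Φ = ∫ x, f x ∂gibbs Φ := by
  rw [integral_gibbs hΦ, integral_gibbs hΦ, ← integral_neg_eq_self]
  simp [he]

lemma pd_comp_neg (i : Fin n) (f : Euc n → ℝ) (x : Euc n) :
    pd i (fun y => f (-y)) x = - pd i f (-x) := by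
  have := pd_comp_smul (f := f) (i := i) (x := x) (-1)
  simpa using this

lemma genL_comp_neg (he : ∀ x, Φ (-x) = Φ x) (hu : ContDiff ℝ 2 u) (x : Euc n) :
    genL Φ (fun y => u (-y)) x = genL Φ u (-x) := by
  have h1 (i : Fin n) : pd i (fun y => u (-y)) = fun y => (-1) * pd i u (-y) := by
    ext y; rw [pd_comp_neg]; ring
  simp only [genL, h1]
  refine Finset.sum_congr rfl fun i _ => ?_
  have hd : Differentiable ℝ fun y => pd i u (-y) :=
    ((pd_contDiff (k := 1) hu (by norm_num)).differentiable (by norm_num)).comp (by fun_prop)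
  rw [pd_const_mul _ hd, pd_comp_neg, pd_odd_of_even he]
  ring

lemma exists_even_genL_approx {c δ : ℝ} (hΦ : ContDiff ℝ 2 Φ) (hb : ∀ x, c ≤ Φ x)
    (he : ∀ x, Φ (-x) = Φ x) (hge : ∀ x, g (-x) = g x)
    [IsFiniteMeasure (gibbs Φ)] (hg : MemLp g 2 (gibbs Φ)) (hg0 : ∫ x, g x ∂gibbs Φ = 0)
    (hδ : 0 < δ) : ∃ u : Euc n → ℝ, ContDiff ℝ ∞ u ∧ HasCompactSupport u ∧ (∀ x, u (-x) = u x) ∧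
      ∫ x, (genL Φ u x - g x) ^ 2 ∂gibbs Φ < δ := by
  obtain ⟨u, hu, huc, h⟩ := exists_genL_approx hΦ hb hg hg0 hδ
  have hu2 := contDiff_infty_two hu
  have hun : ContDiff ℝ ∞ fun y => u (-y) := hu.comp (by fun_prop)
  have hunc : HasCompactSupport fun y => u (-y) := huc.comp_homeomorph (Homeomorph.neg _)
  refine ⟨fun x => (1 / 2) * (u x + u (-x)), contDiff_const.mul (hu.add hun),
    (huc.add hunc).mul_left, fun x => by simp [add_comm], lt_of_le_of_lt ?_ h⟩
  have e (x) : genL Φ (fun x => (1 / 2) * (u x + u (-x))) x =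
      (1 / 2) * (genL Φ u x + genL Φ u (-x)) := by
    rw [genL_const_mul _ ((contDiff_infty_two hu).add (contDiff_infty_two hun)),
      genL_add hu2 (contDiff_infty_two hun), genL_comp_neg he hu2]
  have hcc : IsCc (genL Φ u) := IsCc.genL (hΦ.of_le (by norm_num)) hu2 huc
  have hI : Integrable (fun x => (genL Φ u x - g x) ^ 2) (gibbs Φ) :=
    ((hcc.memLp _ 2).sub hg).integrable_sq
  have hIn : Integrable (fun x => (genL Φ u (-x) - g (-x)) ^ 2) (gibbs Φ) := by
    rw [integrable_gibbs_iff hΦ.continuous] at hI ⊢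
    simpa [he] using hI.comp_neg
  calc _ ≤ ∫ x, ((1 / 2) * (genL Φ u x - g x) ^ 2 + (1 / 2) * (genL Φ u (-x) - g (-x)) ^ 2)
        ∂gibbs Φ := by
        refine integral_mono_of_nonneg (Filter.Eventually.of_forall fun x => sq_nonneg _)
          ((hI.const_mul _).add (hIn.const_mul _)) (Filter.Eventually.of_forall fun x => ?_)
        simp only [e, hge]
        nlinarith [sq_nonneg ((genL Φ u x - g x) - (genL Φ u (-x) - g x))]
    _ = _ := by
        rw [integral_add (hI.const_mul _) (hIn.const_mul _), integral_const_mul,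
          integral_const_mul, integral_gibbs_neg hΦ.continuous he
            (fun x => (genL Φ u x - g x) ^ 2)]
        ring

end Density

section Variance

variable {n : ℕ} {Φ V f u w : Euc n → ℝ} {c δ : ℝ}

/-- The Hessian quadratic form. -/
def hess (f : Euc n → ℝ) (x : Euc n) (v : Fin n → ℝ) : ℝ :=
  ∑ i, ∑ j, pd i (pd j f) x * (v i * v j)

/-- The gradient, as a coordinate vector. -/
def grad (f : Euc n → ℝ) (x : Euc n) (i : Fin n) : ℝ := pd i f x

lemma IsCc.hess (hΦ : ContDiff ℝ 2 Φ) (hu : ContDiff ℝ 1 u) (hc : HasCompactSupport u) :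
    IsCc fun x => _root_.hess Φ x (grad u x) :=
  IsCc.sum fun i _ => IsCc.sum fun j _ => IsCc.mul_left
    ((IsCc.pd hu hc).mul_right (pd_continuous hu))
    (pd_continuous (pd_contDiff (k := 1) hΦ (by norm_num)))

lemma IsCc.norm_hess (hu : ContDiff ℝ 2 u) (hc : HasCompactSupport u) :
    IsCc fun x => ∑ i, ∑ j, _root_.pd i (_root_.pd j u) x ^ 2 :=
  IsCc.sum fun _ _ => IsCc.sum fun _ _ => (IsCc.pd_pd hu hc).sq

lemma integral_sq_le_of_approx (hΦ : ContDiff ℝ 2 Φ) (hf : ContDiff ℝ 1 f)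
    (hf2 : MemLp f 2 (gibbs Φ)) (hu : ContDiff ℝ ∞ u) (hc : HasCompactSupport u)
    (h : ∫ x, (genL Φ u x - f x) ^ 2 ∂gibbs Φ < δ) :
    ∫ x, f x ^ 2 ∂gibbs Φ ≤ δ - 2 * (∫ x, ∑ i, pd i f x * pd i u x ∂gibbs Φ)
      - (∫ x, hess Φ x (grad u x) ∂gibbs Φ)
      - ∫ x, ∑ i, ∑ j, pd i (pd j u) x ^ 2 ∂gibbs Φ := by
  have := gibbs_isLocallyFinite hΦ.continuous
  have hΦ1 : ContDiff ℝ 1 Φ := hΦ.of_le (by norm_num)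
  have hu2 := contDiff_infty_two hu
  have hcc : IsCc (genL Φ u) := IsCc.genL hΦ1 hu2 hc
  have i1 : Integrable (fun x => (genL Φ u x - f x) ^ 2) (gibbs Φ) :=
    ((hcc.memLp _ 2).sub hf2).integrable_sq
  have i2 : Integrable (fun x => f x * genL Φ u x) (gibbs Φ) :=
    (hcc.mul_left hf.continuous).integrable _
  have i3 : Integrable (fun x => genL Φ u x ^ 2) (gibbs Φ) := hcc.sq.integrable _
  have i4 := (IsCc.hess hΦ (hu.of_le (by simp)) hc).integrable (gibbs Φ)
  simp only [hess, grad] at i4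
  have e : ∫ x, f x ^ 2 ∂gibbs Φ = (∫ x, (genL Φ u x - f x) ^ 2 ∂gibbs Φ) +
      2 * (∫ x, f x * genL Φ u x ∂gibbs Φ) - ∫ x, genL Φ u x ^ 2 ∂gibbs Φ := by
    rw [← integral_const_mul, ← integral_add i1 (i2.const_mul 2), ← integral_sub
      (i1.fun_add (i2.const_mul 2)) i3]
    exact integral_congr_ae (Filter.Eventually.of_forall fun x => by simp only; ring)
  rw [integral_mul_genL hΦ1 hu2 hc hf, integral_genL_sq hΦ (contDiff_infty_three hu) hc,
    integral_add ((IsCc.norm_hess hu2 hc).integrable _) i4] at e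
  unfold hess grad
  linarith

lemma integral_sq_le_of_pointwise {G : Euc n → ℝ} (hΦ : ContDiff ℝ 2 Φ) (hb : ∀ x, c ≤ Φ x)
    [IsFiniteMeasure (gibbs Φ)] (hf : ContDiff ℝ 1 f)
    (hf2 : MemLp f 2 (gibbs Φ)) (hf0 : ∫ x, f x ∂gibbs Φ = 0) (hG : Integrable G (gibbs Φ))
    (h : ∀ x (v : Fin n → ℝ), -2 * (∑ i, pd i f x * v i) - hess Φ x v ≤ G x) :
    ∫ x, f x ^ 2 ∂gibbs Φ ≤ ∫ x, G x ∂gibbs Φ := by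
  refine le_of_forall_pos_le_add fun δ hδ => ?_
  obtain ⟨u, hu, hc, hux⟩ := exists_genL_approx hΦ hb hf2 hf0 hδ
  have h1 := integral_sq_le_of_approx hΦ hf hf2 hu hc hux
  have h2 : 0 ≤ ∫ x, ∑ i, ∑ j, pd i (pd j u) x ^ 2 ∂gibbs Φ :=
    integral_nonneg fun x => by positivity
  have hu1 : ContDiff ℝ 1 u := hu.of_le (by simp)
  have i1 : Integrable (fun x => ∑ i, pd i f x * pd i u x) (gibbs Φ) :=
    (IsCc.sum fun i _ => (IsCc.pd hu1 hc).mul_left (pd_continuous hf)).integrable _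
  have i2 : Integrable (fun x => hess Φ x (grad u x)) (gibbs Φ) :=
    (IsCc.hess hΦ hu1 hc).integrable _
  have h3 : ∫ x, (-2 * (∑ i, pd i f x * pd i u x) - hess Φ x (grad u x)) ∂gibbs Φ ≤
      ∫ x, G x ∂gibbs Φ :=
    integral_mono ((i1.const_mul _).sub i2) hG fun x => h x _
  rw [integral_sub (i1.const_mul _) i2, integral_const_mul] at h3
  linarith

/-- The Poincaré inequality under a uniform convexity assumption. -/
lemma poincare {k : ℝ} (hk : 0 < k) (hΦ : ContDiff ℝ 2 Φ) (hb : ∀ x, c ≤ Φ x)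
    [IsFiniteMeasure (gibbs Φ)] (hconv : ∀ x v, k * (∑ i, v i ^ 2) ≤ hess Φ x v)
    (hf : ContDiff ℝ 1 f) (hc : HasCompactSupport f) (hf0 : ∫ x, f x ∂gibbs Φ = 0) :
    k * ∫ x, f x ^ 2 ∂gibbs Φ ≤ ∫ x, ∑ i, pd i f x ^ 2 ∂gibbs Φ := by
  have hcc : IsCc f := ⟨hf.continuous, hc⟩
  have hi : Integrable (fun x => ∑ i, pd i f x ^ 2) (gibbs Φ) :=
    (IsCc.sum fun i _ => (IsCc.pd hf hc).sq).integrable _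
  have := integral_sq_le_of_pointwise hΦ hb hf (hcc.memLp _ 2) hf0 (hi.const_mul k⁻¹)
    fun x v => by
      have h1 : -2 * (∑ i, pd i f x * v i) - k * (∑ i, v i ^ 2) ≤ k⁻¹ * ∑ i, pd i f x ^ 2 := by
        rw [Finset.mul_sum, Finset.mul_sum, Finset.mul_sum, ← Finset.sum_sub_distrib]
        refine Finset.sum_le_sum fun i _ => ?_
        have : k⁻¹ * pd i f x ^ 2 - (-2 * (pd i f x * v i) - k * v i ^ 2)
            = k⁻¹ * (pd i f x + k * v i) ^ 2 := by field_simp; ring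
        have : 0 ≤ k⁻¹ * (pd i f x + k * v i) ^ 2 := by positivity
        linarith
      linarith [hconv x v]
  rw [integral_const_mul] at this
  calc _ ≤ k * (k⁻¹ * ∫ x, ∑ i, pd i f x ^ 2 ∂gibbs Φ) := by gcongr
    _ = _ := by field_simp

lemma hess_add_single (hV : ContDiff ℝ 2 V) (x : Euc n) (i : Fin n) (s : ℝ) (v : Fin n → ℝ) :
    hess V x (fun j => (if j = i then s else 0) + v j) =
      s ^ 2 * pd i (pd i V) x + 2 * s * (∑ j, pd j (pd i V) x * v j) + hess V x v := by
  have hc : ∑ j, pd i (pd j V) x * v j = ∑ j, pd j (pd i V) x * v j :=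
    Finset.sum_congr rfl fun j _ => by rw [pd_comm hV]
  simp only [hess, add_mul, mul_add, Finset.sum_add_distrib, ite_mul, mul_ite, zero_mul, mul_zero,
    Finset.sum_ite_eq', Finset.mem_univ, if_true, Finset.sum_ite_irrel, Finset.sum_const_zero]
  have e1 : ∑ j, pd i (pd j V) x * (s * v j) = s * ∑ j, pd i (pd j V) x * v j := by
    rw [Finset.mul_sum]; exact Finset.sum_congr rfl fun _ _ => by ring
  have e2 : ∑ j, pd j (pd i V) x * (v j * s) = s * ∑ j, pd j (pd i V) x * v j := by
    rw [Finset.mul_sum]; exact Finset.sum_congr rfl fun _ _ => by ring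
  rw [e1, e2, hc]; ring

/-- A bounded odd truncation of the identity. -/
def trunc (ε s : ℝ) : ℝ := s / (1 + ε * s ^ 2)

lemma trunc_contDiff {ε : ℝ} (hε : 0 < ε) : ContDiff ℝ 1 (trunc ε) :=
  contDiff_id.div (by fun_prop) fun s => by positivity

lemma trunc_hasDerivAt {ε : ℝ} (hε : 0 < ε) (s : ℝ) :
    HasDerivAt (trunc ε) ((1 - ε * s ^ 2) / (1 + ε * s ^ 2) ^ 2) s := by
  have h1 : HasDerivAt (fun s : ℝ => 1 + ε * s ^ 2) (ε * (2 * s)) s := by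
    simpa using ((hasDerivAt_pow 2 s).const_mul ε).const_add 1
  have := (hasDerivAt_id s).div h1 (by positivity)
  refine this.congr_deriv ?_
  simp only [id]
  congr 1; ring

lemma trunc_deriv_sq_le {ε : ℝ} (hε : 0 < ε) (s : ℝ) :
    ((1 - ε * s ^ 2) / (1 + ε * s ^ 2) ^ 2) ^ 2 ≤ 1 := by
  have h : 0 ≤ ε * s ^ 2 := by positivity
  rw [sq_le_one_iff_abs_le_one, abs_div, abs_of_pos (by positivity : 0 < (1 + ε * s ^ 2) ^ 2),
    div_le_one (by positivity), abs_le]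
  constructor <;> nlinarith

lemma abs_trunc_le {ε : ℝ} (hε : 0 < ε) (s : ℝ) : |trunc ε s| ≤ |s| := by
  have h : 0 ≤ ε * s ^ 2 := by positivity
  rw [trunc, abs_div, abs_of_pos (by positivity : 0 < 1 + ε * s ^ 2)]
  exact div_le_self (abs_nonneg _) (by linarith)

lemma abs_trunc_le' {ε : ℝ} (hε : 0 < ε) (hε1 : ε ≤ 1) (s : ℝ) : |trunc ε s| ≤ ε⁻¹ := by
  rw [trunc, abs_div, abs_of_pos (by positivity : 0 < 1 + ε * s ^ 2), div_le_iff₀ (by positivity)]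
  have : ε⁻¹ * (1 + ε * s ^ 2) = ε⁻¹ + s ^ 2 := by field_simp
  rw [this]
  have h1 : 1 ≤ ε⁻¹ := (one_le_inv₀ hε).mpr hε1
  nlinarith [sq_nonneg (|s| - 1), sq_abs s]

lemma trunc_neg (ε s : ℝ) : trunc ε (-s) = - trunc ε s := by simp [trunc, neg_div]

lemma integral_eq_zero_of_odd (hΦ : Continuous Φ) (he : ∀ x, Φ (-x) = Φ x)
    (hf : ∀ x, f (-x) = - f x) : ∫ x, f x ∂gibbs Φ = 0 := by
  have := integral_gibbs_neg hΦ he f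
  simp only [hf, integral_neg] at this
  linarith

/-- A Brascamp–Lieb estimate for the gradient of `V`. -/
lemma sq_integral_grad_le (hΦ : ContDiff ℝ 2 Φ) (hb : ∀ x, c ≤ Φ x) (he : ∀ x, Φ (-x) = Φ x)
    [IsFiniteMeasure (gibbs Φ)] (hV : ContDiff ℝ 2 V) (hVe : ∀ x, V (-x) = V x)
    (hV0 : ∀ x v, 0 ≤ hess V x v) (hVΦ : ∀ x v, hess V x v ≤ hess Φ x v)
    (h_int : ∀ i, Integrable (pd i (pd i V)) (gibbs Φ))
    (hw : ContDiff ℝ 1 w) (hc : HasCompactSupport w) :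
    (∫ x, ∑ i, pd i V x * pd i w x ∂gibbs Φ) ^ 2 ≤
      (∫ x, ∑ i, pd i (pd i V) x ∂gibbs Φ) * ∫ x, ∑ i, pd i w x ^ 2 ∂gibbs Φ := by
  have hV1 : ContDiff ℝ 1 V := hV.of_le (by norm_num)
  have hpV (i : Fin n) : ContDiff ℝ 1 (pd i V) := pd_contDiff hV (by norm_num)
  have bl (ε : ℝ) (hε : 0 < ε) (hε1 : ε ≤ 1) (i : Fin n) :
      ∫ x, trunc ε (pd i V x) ^ 2 ∂gibbs Φ ≤ ∫ x, pd i (pd i V) x ∂gibbs Φ := by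
    refine integral_sq_le_of_pointwise hΦ hb ((trunc_contDiff hε).comp (hpV i)) ?_ ?_ (h_int i) ?_
    · exact MemLp.of_bound ((trunc_contDiff hε).continuous.comp
        (hpV i).continuous).aestronglyMeasurable ε⁻¹
        (Filter.Eventually.of_forall fun x => abs_trunc_le' hε hε1 _)
    · exact integral_eq_zero_of_odd hΦ.continuous he fun x => by
        rw [pd_odd_of_even hVe, trunc_neg]
    · intro x v
      have e (j : Fin n) := pd_comp (i := j) (trunc_hasDerivAt hε (pd i V x))
        (((hpV i).differentiable (by norm_num)) x)
      simp only [e]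
      set s := (1 - ε * pd i V x ^ 2) / (1 + ε * pd i V x ^ 2) ^ 2 with hs
      have hs1 : s ^ 2 ≤ 1 := trunc_deriv_sq_le hε _
      have h1 := hV0 x (fun j => (if j = i then s else 0) + v j)
      have h2 := hV0 x (fun j => (if j = i then 1 else 0) + 0)
      rw [hess_add_single hV] at h1
      have h3 := hess_add_single hV x i 1 0
      simp only [Pi.zero_apply] at h3
      rw [h3] at h2
      simp [hess] at h2
      have h4 := hVΦ x v
      have e2 : ∑ j, s * pd j (pd i V) x * v j = s * ∑ j, pd j (pd i V) x * v j := by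
        rw [Finset.mul_sum]; exact Finset.sum_congr rfl fun _ _ => by ring
      rw [e2]
      nlinarith
  have hcs (ε : ℝ) (hε : 0 < ε) (hε1 : ε ≤ 1) :
      (∫ x, ∑ i, trunc ε (pd i V x) * pd i w x ∂gibbs Φ) ^ 2 ≤
      (∫ x, ∑ i, pd i (pd i V) x ∂gibbs Φ) * ∫ x, ∑ i, pd i w x ^ 2 ∂gibbs Φ := by
    have ht (i : Fin n) : Continuous fun x => trunc ε (pd i V x) :=
      (trunc_contDiff hε).continuous.comp (hpV i).continuous
    have ii (i : Fin n) : Integrable (fun x => trunc ε (pd i V x) ^ 2) (gibbs Φ) :=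
      (MemLp.of_bound (ht i).aestronglyMeasurable ε⁻¹
        (Filter.Eventually.of_forall fun x => abs_trunc_le' hε hε1 _)).integrable_sq
    have i1 : Integrable (fun x => ∑ i, trunc ε (pd i V x) ^ 2) (gibbs Φ) :=
      integrable_finsetSum _ fun i _ => ii i
    have i2 : Integrable (fun x => ∑ i, trunc ε (pd i V x) * pd i w x) (gibbs Φ) :=
      (IsCc.sum fun i _ => (IsCc.pd hw hc).mul_left (ht i)).integrable _
    have i3 : Integrable (fun x => ∑ i, pd i w x ^ 2) (gibbs Φ) :=
      (IsCc.sum fun i _ => (IsCc.pd hw hc).sq).integrable _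
    have h1 : (∫ x, ∑ i, trunc ε (pd i V x) * pd i w x ∂gibbs Φ) ^ 2 ≤
        (∫ x, ∑ i, trunc ε (pd i V x) ^ 2 ∂gibbs Φ) * ∫ x, ∑ i, pd i w x ^ 2 ∂gibbs Φ := by
      refine sq_le_mul_of_quadratic fun s => ?_
      have h0 : 0 ≤ ∫ x, ∑ i, (s * trunc ε (pd i V x) + pd i w x) ^ 2 ∂gibbs Φ :=
        integral_nonneg fun x => Finset.sum_nonneg fun _ _ => sq_nonneg _
      have e : (fun x => ∑ i, (s * trunc ε (pd i V x) + pd i w x) ^ 2) = fun x =>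
          (s ^ 2 * (∑ i, trunc ε (pd i V x) ^ 2) + (2 * s) * (∑ i, trunc ε (pd i V x) * pd i w x))
            + ∑ i, pd i w x ^ 2 := by
        ext x
        simp only [Finset.mul_sum, ← Finset.sum_add_distrib]
        exact Finset.sum_congr rfl fun i _ => by ring
      rw [e, integral_add ((i1.const_mul _).fun_add (i2.const_mul _)) i3,
        integral_add (i1.const_mul _) (i2.const_mul _), integral_const_mul,
        integral_const_mul] at h0
      linarith
    refine h1.trans (mul_le_mul_of_nonneg_right ?_ (integral_nonneg fun x =>
      Finset.sum_nonneg fun _ _ => sq_nonneg _))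
    rw [integral_finsetSum _ fun i _ => ii i, integral_finsetSum _ fun i _ => h_int i]
    exact Finset.sum_le_sum fun i _ => bl ε hε hε1 i
  have ht : Filter.Tendsto (fun k : ℕ => ∫ x, ∑ i, trunc (1 / ((k : ℝ) + 1)) (pd i V x) * pd i w x
      ∂gibbs Φ) Filter.atTop (nhds (∫ x, ∑ i, pd i V x * pd i w x ∂gibbs Φ)) := by
    refine tendsto_integral_of_dominated_convergence (fun x => ∑ i, |pd i V x * pd i w x|)
      (fun k => ?_) ?_ (fun k => Filter.Eventually.of_forall fun x => ?_)
      (Filter.Eventually.of_forall fun x => ?_)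
    · exact (continuous_finsetSum _ fun i _ => ((trunc_contDiff
        (by positivity)).continuous.comp (hpV i).continuous).mul
        (pd_continuous hw)).aestronglyMeasurable
    · exact integrable_finsetSum _ fun i _ =>
        (((IsCc.pd hw hc).mul_left (pd_continuous hV1)).integrable _).abs
    · refine (norm_sum_le _ _).trans (Finset.sum_le_sum fun i _ => ?_)
      rw [Real.norm_eq_abs, abs_mul, abs_mul]
      exact mul_le_mul_of_nonneg_right (abs_trunc_le (by positivity) _) (abs_nonneg _)
    · refine tendsto_finsetSum _ fun i _ => Filter.Tendsto.mul_const _ ?_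
      have hcont : ContinuousAt (fun ε => trunc ε (pd i V x)) 0 := by
        unfold trunc
        exact ContinuousAt.div continuousAt_const (by fun_prop) (by simp)
      have := hcont.tendsto.comp tendsto_one_div_add_atTop_nhds_zero_nat
      simpa [trunc] using! this
  refine le_of_tendsto' (ht.pow 2) fun k => hcs _ (by positivity) ?_
  rw [div_le_one (by positivity)]
  have : (0:ℝ) ≤ k := k.cast_nonneg
  linarith

end Variance

section LayerCake

variable {n : ℕ} {V Ψ F : Euc n → ℝ} {r C : ℝ}

lemma withDensity_le_of_convex_bodies {μ : Measure (Euc n)} [IsFiniteMeasureOnCompacts μ]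
    (hF : Continuous F) (hF0 : ∀ x, 0 ≤ F x) (hC : 0 ≤ C) (hr : 0 < r)
    (h : ∀ M : Set (Euc n), IsConvexBody M → M = -M → Metric.closedBall (0 : Euc n) r ⊆ M →
      ∫ x in M, F x ∂μ ≤ C * (μ M).toReal)
    {S : Set (Euc n)} (hS : IsClosed S) (hSc : Convex ℝ S) (hSs : S = -S)
    (hrS : Metric.closedBall (0 : Euc n) r ⊆ S) :
    μ.withDensity (fun x => ENNReal.ofReal (F x)) S ≤ ENNReal.ofReal C * μ S := by
  set T : ℕ → Set (Euc n) := fun k => S ∩ Metric.closedBall 0 (r + k) with hT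
  have hTm : Monotone T := fun a b hab =>
    Set.inter_subset_inter_right _ (Metric.closedBall_subset_closedBall (by gcongr))
  have hTU : ⋃ k, T k = S := by
    rw [hT, ← Set.inter_iUnion]
    refine Set.inter_eq_left.mpr fun x _ => Set.mem_iUnion.mpr ?_
    obtain ⟨k, hk⟩ := exists_nat_ge ‖x‖
    exact ⟨k, by rw [mem_closedBall_zero_iff]; linarith⟩
  have hTk (k : ℕ) : μ.withDensity (fun x => ENNReal.ofReal (F x)) (T k) ≤
      ENNReal.ofReal C * μ S := by
    have hcomp : IsCompact (T k) := (isCompact_closedBall _ _).inter_left hS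
    have hsub : Metric.closedBall (0 : Euc n) r ⊆ T k :=
      Set.subset_inter hrS (Metric.closedBall_subset_closedBall (by simp))
    have hb := h (T k) ⟨hcomp, hSc.inter (convex_closedBall _ _),
      ⟨0, mem_interior.mpr ⟨Metric.ball 0 r, Metric.ball_subset_closedBall.trans hsub,
        Metric.isOpen_ball, Metric.mem_ball_self hr⟩⟩⟩
      (by
        ext x
        have hx : x ∈ S ↔ -x ∈ S := by
          conv_lhs => rw [hSs]
          rfl
        simp [hT, hx]) hsub
    rw [withDensity_apply _ hcomp.measurableSet,
      ← ofReal_integral_eq_lintegral_ofReal (hF.continuousOn.integrableOn_compact hcomp)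
        (Filter.Eventually.of_forall hF0)]
    calc _ ≤ ENNReal.ofReal (C * (μ (T k)).toReal) := ENNReal.ofReal_le_ofReal hb
      _ = ENNReal.ofReal C * μ (T k) := by
        rw [ENNReal.ofReal_mul hC, ENNReal.ofReal_toReal hcomp.measure_lt_top.ne]
      _ ≤ _ := by gcongr; exact Set.inter_subset_left
  have ht := tendsto_measure_iUnion_atTop (μ := μ.withDensity (fun x => ENNReal.ofReal (F x))) hTm
  rw [hTU] at ht
  exact le_of_tendsto' ht hTk

lemma gibbs_add (hV : Continuous V) (hΨ : Continuous Ψ) :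
    gibbs (fun x => V x + Ψ x) =
      (gibbs V).withDensity fun x => ENNReal.ofReal (Real.exp (-Ψ x)) := by
  rw [gibbs, gibbs, ← withDensity_mul _ (by fun_prop) (by fun_prop)]
  congr 1
  ext x
  simp [← ENNReal.ofReal_mul (Real.exp_pos _).le, ← Real.exp_add, add_comm]

lemma integral_gibbs_le_of_convex_bodies (hV : Continuous V) (hΨ : Continuous Ψ)
    (hΨ0 : ∀ x, 0 ≤ Ψ x) (hΨc : ConvexOn ℝ Set.univ Ψ) (hΨe : ∀ x, Ψ (-x) = Ψ x)
    (hΨr : ∀ x, ‖x‖ ≤ r → Ψ x = 0) (hr : 0 < r)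
    (hF : Continuous F) (hF0 : ∀ x, 0 ≤ F x) (hC : 0 ≤ C)
    (h : ∀ M : Set (Euc n), IsConvexBody M → M = -M → Metric.closedBall (0 : Euc n) r ⊆ M →
      ∫ x in M, F x ∂gibbs V ≤ C * (gibbs V M).toReal)
    [IsFiniteMeasure (gibbs fun x => V x + Ψ x)] :
    Integrable F (gibbs fun x => V x + Ψ x) ∧
      ∫ x, F x ∂(gibbs fun x => V x + Ψ x) ≤
        C * ((gibbs fun x => V x + Ψ x) Set.univ).toReal := by
  have := gibbs_isLocallyFinite hV
  set μ := gibbs V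
  set κ := μ.withDensity fun x => ENNReal.ofReal (F x) with hκ
  have hexp : Continuous fun x => Real.exp (-Ψ x) := hΨ.neg.rexp
  have key : ∫⁻ x, ENNReal.ofReal (Real.exp (-Ψ x)) ∂κ ≤
      ENNReal.ofReal C * ∫⁻ x, ENNReal.ofReal (Real.exp (-Ψ x)) ∂μ := by
    rw [lintegral_eq_lintegral_meas_le κ (Filter.Eventually.of_forall fun x => (Real.exp_pos _).le)
      hexp.aemeasurable, lintegral_eq_lintegral_meas_le μ
      (Filter.Eventually.of_forall fun x => (Real.exp_pos _).le) hexp.aemeasurable,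
      ← lintegral_const_mul' _ _ ENNReal.ofReal_ne_top]
    refine setLIntegral_mono' measurableSet_Ioi fun t (ht : 0 < t) => ?_
    have hset : {x | t ≤ Real.exp (-Ψ x)} = {x | Ψ x ≤ -Real.log t} := by
      ext x
      simp only [Set.mem_ofPred_eq]
      rw [← Real.log_le_iff_le_exp ht]
      constructor <;> intro h <;> linarith
    rw [hset]
    by_cases h1 : t ≤ 1
    · have hl : 0 ≤ -Real.log t := by linarith [Real.log_nonpos ht.le h1]
      refine withDensity_le_of_convex_bodies hF hF0 hC hr h (isClosed_le hΨ continuous_const)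
        ?_ ?_ ?_
      · simpa using hΨc.convex_le (-Real.log t)
      · ext x; simp [hΨe]
      · intro x hx
        rw [mem_closedBall_zero_iff] at hx
        simpa [hΨr x hx] using hl
    · have : {x | Ψ x ≤ -Real.log t} = ∅ := by
        ext x
        simp only [Set.mem_ofPred_eq, Set.mem_empty_iff_false, iff_false, not_le]
        linarith [Real.log_pos (not_le.mp h1), hΨ0 x]
      rw [this]; simp
  have e1 : ∫⁻ x, ENNReal.ofReal (Real.exp (-Ψ x)) ∂κ =
      ∫⁻ x, ENNReal.ofReal (F x) ∂(gibbs fun x => V x + Ψ x) := by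
    rw [hκ, gibbs_add hV hΨ, lintegral_withDensity_eq_lintegral_mul _ (by fun_prop) (by fun_prop),
      lintegral_withDensity_eq_lintegral_mul _ (by fun_prop) (by fun_prop)]
    simp only [Pi.mul_apply, mul_comm]
    rfl
  have e2 : ∫⁻ x, ENNReal.ofReal (Real.exp (-Ψ x)) ∂μ = (gibbs fun x => V x + Ψ x) Set.univ := by
    rw [gibbs_add hV hΨ, withDensity_apply _ MeasurableSet.univ, setLIntegral_univ]
  rw [e1, e2] at key
  have hi : Integrable F (gibbs fun x => V x + Ψ x) := by
    refine ⟨hF.aestronglyMeasurable, ?_⟩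
    rw [hasFiniteIntegral_iff_ofReal (Filter.Eventually.of_forall hF0)]
    exact key.trans_lt (ENNReal.mul_lt_top ENNReal.ofReal_lt_top (measure_lt_top _ _))
  refine ⟨hi, ?_⟩
  rw [← ofReal_integral_eq_lintegral_ofReal hi (Filter.Eventually.of_forall hF0)] at key
  rw [← ENNReal.ofReal_le_ofReal_iff (by positivity), ENNReal.ofReal_mul hC,
    ENNReal.ofReal_toReal (measure_ne_top _ _)]
  exact key

end LayerCake

section Penalty

/-- A convex penalty function vanishing on the negative half-line. -/
def pen (N s : ℝ) : ℝ := max s 0 ^ 3 * Real.exp (N * s)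

/-- The first derivative of the penalty. -/
def pen₁ (N s : ℝ) : ℝ := (3 * max s 0 ^ 2 + N * max s 0 ^ 3) * Real.exp (N * s)

/-- The second derivative of the penalty. -/
def pen₂ (N s : ℝ) : ℝ :=
  (6 * max s 0 + 6 * N * max s 0 ^ 2 + N ^ 2 * max s 0 ^ 3) * Real.exp (N * s)

lemma hasDerivAt_max_zero_pow (k : ℕ) (s : ℝ) :
    HasDerivAt (fun s : ℝ => max s 0 ^ (k + 2)) ((k + 2) * max s 0 ^ (k + 1)) s := by
  rcases lt_trichotomy s 0 with h | h | h
  · have : (fun s : ℝ => max s 0 ^ (k + 2)) =ᶠ[nhds s] fun _ => 0 := by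
      filter_upwards [gt_mem_nhds h] with y hy
      simp [max_eq_right hy.le]
    refine ((hasDerivAt_const s (0:ℝ)).congr_of_eventuallyEq this).congr_deriv ?_
    simp [max_eq_right h.le]
  · subst h
    rw [hasDerivAt_iff_isLittleO_nhds_zero]
    simp only [zero_add, max_self, ne_eq, Nat.add_eq_zero_iff, OfNat.ofNat_ne_zero, and_false,
      not_false_eq_true, zero_pow, sub_zero, smul_eq_mul, one_ne_zero, mul_zero]
    have h1 : (fun h : ℝ => h ^ (k + 2)) =o[nhds 0] fun h : ℝ => h := by
      simpa using Asymptotics.isLittleO_pow_pow (𝕜 := ℝ) (show 1 < k + 2 by omega)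
    refine Asymptotics.IsBigO.trans_isLittleO (Asymptotics.IsBigO.of_bound 1 ?_) h1
    refine Filter.Eventually.of_forall fun x => ?_
    rw [one_mul, norm_pow, norm_pow]
    gcongr
    rw [Real.norm_eq_abs, Real.norm_eq_abs, abs_of_nonneg (le_max_right _ _)]
    exact max_le (le_abs_self _) (abs_nonneg _)
  · have : (fun s : ℝ => max s 0 ^ (k + 2)) =ᶠ[nhds s] fun s => s ^ (k + 2) := by
      filter_upwards [lt_mem_nhds h] with y hy
      simp [max_eq_left hy.le]
    refine ((hasDerivAt_pow (k + 2) s).congr_of_eventuallyEq this).congr_deriv ?_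
    simp [max_eq_left h.le]

lemma hasDerivAt_pen (N s : ℝ) : HasDerivAt (pen N) (pen₁ N s) s := by
  have h3 := hasDerivAt_max_zero_pow 1 s
  have he : HasDerivAt (fun s => Real.exp (N * s)) (Real.exp (N * s) * N) s := by
    simpa using ((hasDerivAt_id s).const_mul N).exp
  refine (h3.mul he).congr_deriv ?_
  simp only [pen₁]; push_cast; ring

lemma hasDerivAt_pen₁ (N s : ℝ) : HasDerivAt (pen₁ N) (pen₂ N s) s := by
  have h2 := hasDerivAt_max_zero_pow 0 s
  have h3 := hasDerivAt_max_zero_pow 1 s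
  have he : HasDerivAt (fun s => Real.exp (N * s)) (Real.exp (N * s) * N) s := by
    simpa using ((hasDerivAt_id s).const_mul N).exp
  refine (((h2.const_mul 3).fun_add (h3.const_mul N)).mul he).congr_deriv ?_
  simp only [pen₂]; push_cast; ring

lemma continuous_pen₂ (N : ℝ) : Continuous (pen₂ N) := by unfold pen₂; fun_prop

lemma contDiff_pen₁ (N : ℝ) : ContDiff ℝ 1 (pen₁ N) := by
  rw [contDiff_one_iff_deriv]
  refine ⟨fun s => (hasDerivAt_pen₁ N s).differentiableAt, ?_⟩
  rw [funext fun s => (hasDerivAt_pen₁ N s).deriv]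
  exact continuous_pen₂ N

lemma contDiff_pen (N : ℝ) : ContDiff ℝ 2 (pen N) := by
  rw [show (2 : WithTop ℕ∞) = 1 + 1 by norm_num, contDiff_succ_iff_deriv]
  refine ⟨fun s => (hasDerivAt_pen N s).differentiableAt, by simp, ?_⟩
  rw [funext fun s => (hasDerivAt_pen N s).deriv]
  exact contDiff_pen₁ N

variable {N : ℝ}

lemma pen_nonneg (N s : ℝ) : 0 ≤ pen N s := by unfold pen; positivity

lemma pen₁_nonneg (hN : 0 ≤ N) (s : ℝ) : 0 ≤ pen₁ N s := by unfold pen₁; positivity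

lemma pen₂_nonneg (hN : 0 ≤ N) (s : ℝ) : 0 ≤ pen₂ N s := by unfold pen₂; positivity

lemma mul_pen₁_le (hN : 0 ≤ N) (s : ℝ) : N * pen₁ N s ≤ pen₂ N s := by
  have h : pen₂ N s - N * pen₁ N s =
    (6 * max s 0 + 3 * N * max s 0 ^ 2) * Real.exp (N * s) := by unfold pen₁ pen₂; ring
  have : 0 ≤ (6 * max s 0 + 3 * N * max s 0 ^ 2) * Real.exp (N * s) := by positivity
  linarith

lemma pen_of_nonpos {s : ℝ} (N : ℝ) (hs : s ≤ 0) : pen N s = 0 := by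
  simp [pen, max_eq_right hs]

lemma pen₁_of_nonpos {s : ℝ} (N : ℝ) (hs : s ≤ 0) : pen₁ N s = 0 := by
  simp [pen₁, max_eq_right hs]

lemma convexOn_pen (hN : 0 ≤ N) : ConvexOn ℝ Set.univ (pen N) := by
  refine MonotoneOn.convexOn_of_deriv convex_univ (contDiff_pen N).continuous.continuousOn
    (fun s _ => (hasDerivAt_pen N s).differentiableAt.differentiableWithinAt) ?_
  rw [funext fun s => (hasDerivAt_pen N s).deriv]
  refine (monotone_of_deriv_nonneg (fun s => (hasDerivAt_pen₁ N s).differentiableAt)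
    fun s => ?_).monotoneOn _
  rw [(hasDerivAt_pen₁ N s).deriv]
  exact pen₂_nonneg hN s

lemma pen_bounds (hN : 0 ≤ N) {s ρ : ℝ} (hs : s ≤ ρ) (hρ : 0 ≤ ρ) :
    pen₁ N s ≤ 6 * (1 + N) ^ 2 * Real.exp ((N + 1) * ρ) ∧
      pen₂ N s ≤ 6 * (1 + N) ^ 2 * Real.exp ((N + 1) * ρ) := by
  have hm0 : 0 ≤ max s 0 := le_max_right _ _
  have hm : max s 0 ≤ ρ := max_le hs hρ
  have e0 : 1 ≤ Real.exp (max s 0) := Real.one_le_exp hm0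
  have e1 : max s 0 ≤ Real.exp (max s 0) := by linarith [Real.add_one_le_exp (max s 0)]
  have e2 : max s 0 ^ 2 ≤ 2 * Real.exp (max s 0) := by
    have := Real.pow_div_factorial_le_exp _ hm0 2
    norm_num [Nat.factorial] at this; linarith
  have e3 : max s 0 ^ 3 ≤ 6 * Real.exp (max s 0) := by
    have := Real.pow_div_factorial_le_exp _ hm0 3
    norm_num [Nat.factorial] at this; linarith
  have hE : Real.exp (max s 0) * Real.exp (N * s) ≤ Real.exp ((N + 1) * ρ) := by
    rw [← Real.exp_add, Real.exp_le_exp]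
    nlinarith
  have hx := Real.exp_pos (N * s)
  have key (A : ℝ) (hA : A ≤ 6 * (1 + N) ^ 2 * Real.exp (max s 0)) :
      A * Real.exp (N * s) ≤ 6 * (1 + N) ^ 2 * Real.exp ((N + 1) * ρ) :=
    calc _ ≤ 6 * (1 + N) ^ 2 * Real.exp (max s 0) * Real.exp (N * s) := by gcongr
      _ = 6 * (1 + N) ^ 2 * (Real.exp (max s 0) * Real.exp (N * s)) := by ring
      _ ≤ _ := by gcongr
  have h3 : N * max s 0 ^ 3 ≤ N * (6 * Real.exp (max s 0)) := by gcongr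
  have h2 : N * max s 0 ^ 2 ≤ N * (2 * Real.exp (max s 0)) := by gcongr
  have h4 : N ^ 2 * max s 0 ^ 3 ≤ N ^ 2 * (6 * Real.exp (max s 0)) := by gcongr
  have h5 : 0 ≤ N * Real.exp (max s 0) := by positivity
  have h6 : 0 ≤ N ^ 2 * Real.exp (max s 0) := by positivity
  exact ⟨key _ (by nlinarith), key _ (by nlinarith)⟩

end Penalty

section Gaussian

variable {n : ℕ} {Φ V f : Euc n → ℝ} {c k : ℝ}

lemma integrable_exp_sub_sq (hk : 0 < k) (α : ℝ) :
    Integrable fun x : Euc n => Real.exp (α * ‖x‖ - k * ‖x‖ ^ 2 / 2) := by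
  have h0 : Integrable fun x : Euc n => Real.exp (-(k / 4) * ‖x‖ ^ 2) := by
    have := (GaussianFourier.integrable_cexp_neg_mul_sq_norm_add (V := Euc n) (b := (k / 4 : ℝ))
      (by simpa using hk) 0 0).norm
    refine this.congr (Filter.Eventually.of_forall fun x => ?_)
    simp only [Complex.norm_exp]
    congr 1
    simp [← Complex.ofReal_pow]
  refine (h0.const_mul (Real.exp (α ^ 2 / k))).mono'
    (by fun_prop) (Filter.Eventually.of_forall fun x => ?_)
  rw [Real.norm_eq_abs, Real.abs_exp, ← Real.exp_add, Real.exp_le_exp]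
  have : α ^ 2 / k + -(k / 4) * ‖x‖ ^ 2 - (α * ‖x‖ - k * ‖x‖ ^ 2 / 2) =
      (α - k * ‖x‖ / 2) ^ 2 / k := by field_simp; ring
  have : 0 ≤ (α - k * ‖x‖ / 2) ^ 2 / k := by positivity
  linarith

lemma integrable_gibbs_of_exp_bound (hk : 0 < k) (hΦ : Continuous Φ)
    (hb : ∀ x, c + k * ‖x‖ ^ 2 / 2 ≤ Φ x) (hf : Continuous f) {C α : ℝ}
    (h : ∀ x, |f x| ≤ C * Real.exp (α * ‖x‖)) : Integrable f (gibbs Φ) := by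
  rw [integrable_gibbs_iff hΦ]
  refine ((integrable_exp_sub_sq (n := n) hk α).const_mul (C * Real.exp (-c))).mono'
    (by fun_prop) (Filter.Eventually.of_forall fun x => ?_)
  rw [Real.norm_eq_abs, abs_mul, Real.abs_exp]
  calc |f x| * Real.exp (-Φ x)
      ≤ C * Real.exp (α * ‖x‖) * Real.exp (-(c + k * ‖x‖ ^ 2 / 2)) :=
        mul_le_mul (h x) (Real.exp_le_exp.mpr (neg_le_neg (hb x))) (Real.exp_pos _).le
          ((abs_nonneg _).trans (h x))
    _ = C * Real.exp (-c) * Real.exp (α * ‖x‖ - k * ‖x‖ ^ 2 / 2) := by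
        rw [mul_assoc, mul_assoc, ← Real.exp_add, ← Real.exp_add]
        congr 2; ring

lemma hasDerivAt_smul_line (hf : Differentiable ℝ f) (x : Euc n) (t : ℝ) :
    HasDerivAt (fun t : ℝ => f (t • x)) (∑ i, x i * pd i f (t • x)) t := by
  have h1 : HasDerivAt (fun t : ℝ => t • x) x t := by
    simpa using (hasDerivAt_id t).smul_const x
  have := (hf (t • x)).hasFDerivAt.comp_hasDerivAt t h1
  refine this.congr_deriv ?_
  rw [fderiv_eq_sum_pd]

lemma euler_le (hV : ContDiff ℝ 2 V) (hVe : ∀ x, V (-x) = V x)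
    (hconv : ∀ x v, k * (∑ i, v i ^ 2) ≤ hess V x v) (x : Euc n) :
    k * (∑ i, x i ^ 2) ≤ ∑ i, x i * pd i V x := by
  have hd (t : ℝ) : HasDerivAt (fun t : ℝ => ∑ i, x i * pd i V (t • x)) (hess V (t • x) x) t := by
    have := HasDerivAt.fun_sum (u := Finset.univ) fun i _ =>
      (hasDerivAt_smul_line ((pd_contDiff (i := i) (k := 1) hV (by norm_num)).differentiable
        (by norm_num)) x t).const_mul (x i)
    refine this.congr_deriv ?_
    rw [hess, Finset.sum_comm]
    refine Finset.sum_congr rfl fun i _ => ?_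
    rw [Finset.mul_sum]
    exact Finset.sum_congr rfl fun j _ => by ring
  have h0 : ∑ i, x i * pd i V ((0:ℝ) • x) = 0 := by
    refine Finset.sum_eq_zero fun i _ => ?_
    have := pd_odd_of_even hVe (i := i) (x := 0)
    simp only [neg_zero] at this
    have h : pd i V 0 = 0 := by linarith
    simp [h]
  have := (convex_Icc (0:ℝ) 1).mul_sub_le_image_sub_of_le_deriv
    (f := fun t : ℝ => ∑ i, x i * pd i V (t • x)) (C := k * (∑ i, x i ^ 2))
    (fun t _ => (hd t).continuousAt.continuousWithinAt)
    (fun t _ => (hd t).differentiableAt.differentiableWithinAt)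
    (fun t _ => by rw [(hd t).deriv]; exact hconv _ _) 0 (by simp) 1 (by simp) zero_le_one
  rw [h0] at this
  simpa using this

lemma quadratic_le (hV : ContDiff ℝ 2 V) (hVe : ∀ x, V (-x) = V x)
    (hconv : ∀ x v, k * (∑ i, v i ^ 2) ≤ hess V x v) (x : Euc n) :
    V 0 + k * ‖x‖ ^ 2 / 2 ≤ V x := by
  have hd (t : ℝ) : HasDerivAt (fun t : ℝ => V (t • x) - k * ‖x‖ ^ 2 / 2 * t ^ 2)
      ((∑ i, x i * pd i V (t • x)) - k * ‖x‖ ^ 2 * t) t := by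
    refine ((hasDerivAt_smul_line (hV.differentiable (by norm_num)) x t).sub
      ((hasDerivAt_pow 2 t).const_mul _)).congr_deriv ?_
    push_cast; ring
  have := (convex_Icc (0:ℝ) 1).mul_sub_le_image_sub_of_le_deriv
    (f := fun t : ℝ => V (t • x) - k * ‖x‖ ^ 2 / 2 * t ^ 2) (C := 0)
    (fun t _ => (hd t).continuousAt.continuousWithinAt)
    (fun t _ => (hd t).differentiableAt.differentiableWithinAt)
    (fun t ht => by
      rw [(hd t).deriv]
      rw [interior_Icc] at ht
      have h1 := euler_le hV hVe hconv (t • x)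
      have h2 : ∑ i, (t • x) i * pd i V (t • x) = t * ∑ i, x i * pd i V (t • x) := by
        rw [Finset.mul_sum]; exact Finset.sum_congr rfl fun i _ => by simp; ring
      have h3 : ∑ i, (t • x) i ^ 2 = t ^ 2 * ‖x‖ ^ 2 := by
        rw [EuclideanSpace.real_norm_sq_eq, Finset.mul_sum]
        exact Finset.sum_congr rfl fun i _ => by simp; ring
      rw [h2, h3] at h1
      have : k * ‖x‖ ^ 2 * t ≤ ∑ i, x i * pd i V (t • x) := by
        refine le_of_mul_le_mul_left ?_ ht.1
        linarith
      linarith) 0 (by simp) 1 (by simp) zero_le_one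
  simp at this
  linarith

end Gaussian

section Algebra

lemma two_mul_sub_sq_le {k₁ k₂ X Y y z : ℝ} (hk : 0 < k₁) (hk1 : k₁ ≤ 1) (hk2 : 0 ≤ k₂)
    (hX : 0 ≤ X) (hXY : X ≤ Y) (hy : y ^ 2 ≤ Y) (hz : k₁ * z ^ 2 ≤ k₂ * X) :
    2 * k₁ * (y - z) ^ 2 ≤ (1 + k₁) * (1 + k₂) * (X + Y) := by
  rcases le_or_gt k₂ 1 with h | h
  · have h1 : k₁ * (y - z) ^ 2 ≤ (k₁ + k₂) * (X + Y) := by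
      rcases hk2.eq_or_lt with h0 | h0
      · subst h0
        have : z = 0 := by
          have : z ^ 2 ≤ 0 := by
            by_contra! hc
            nlinarith
          exact pow_eq_zero_iff (two_ne_zero) |>.mp (le_antisymm this (sq_nonneg z))
        subst this
        nlinarith
      · have e : k₂ * ((k₁ + k₂) * (Y + X) - k₁ * (y - z) ^ 2) =
            (k₁ * z + k₂ * y) ^ 2 + k₂ * (k₁ + k₂) * (Y - y ^ 2)
              + (k₁ + k₂) * (k₂ * X - k₁ * z ^ 2) + (k₂ ^ 2 - k₁ * k₂ - k₂ ^ 2 + k₁ * k₂) * y ^ 2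
              := by ring
        have : 0 ≤ k₂ * ((k₁ + k₂) * (Y + X) - k₁ * (y - z) ^ 2) := by
          rw [e]
          have t1 : 0 ≤ k₂ * (k₁ + k₂) * (Y - y ^ 2) :=
            mul_nonneg (by positivity) (by linarith)
          have t2 : 0 ≤ (k₁ + k₂) * (k₂ * X - k₁ * z ^ 2) :=
            mul_nonneg (by positivity) (by linarith)
          nlinarith [sq_nonneg (k₁ * z + k₂ * y)]
        have := nonneg_of_mul_nonneg_right this h0
        linarith
    have h2 : 0 ≤ (1 - k₁) * (1 - k₂) * (X + Y) :=
      mul_nonneg (mul_nonneg (by linarith) (by linarith)) (by linarith)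
    nlinarith
  · set s := Real.sqrt k₁ with hs
    set t := Real.sqrt k₂ with ht
    have hs2 : s ^ 2 = k₁ := Real.sq_sqrt hk.le
    have ht2 : t ^ 2 = k₂ := Real.sq_sqrt hk2
    have hs0 : 0 < s := Real.sqrt_pos.mpr hk
    have hst : s ≤ t := Real.sqrt_le_sqrt (by linarith)
    set A := Real.sqrt Y with hA
    set B := Real.sqrt X with hB
    have hA2 : A ^ 2 = Y := Real.sq_sqrt (hX.trans hXY)
    have hB2 : B ^ 2 = X := Real.sq_sqrt hX
    have hB0 : 0 ≤ B := Real.sqrt_nonneg _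
    have hBA : B ≤ A := Real.sqrt_le_sqrt hXY
    have h1 : |y| ≤ A := Real.abs_le_sqrt hy
    have h2 : s * |z| ≤ t * B := by
      rw [← abs_of_pos hs0, ← abs_mul]
      refine abs_le_of_sq_le_sq (by nlinarith) (by positivity)
    have h3 : |s * (y - z)| ≤ s * A + t * B := by
      rw [abs_mul, abs_of_pos hs0]
      have := abs_sub y z
      nlinarith
    have h4 : k₁ * (y - z) ^ 2 ≤ (s * A + t * B) ^ 2 := by
      rw [← hs2, ← mul_pow, ← sq_abs]
      gcongr
    have h5 : 2 * (s * A + t * B) ^ 2 ≤ (s + t) ^ 2 * (A ^ 2 + B ^ 2) := by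
      have e : (s + t) ^ 2 * (A ^ 2 + B ^ 2) - 2 * (s * A + t * B) ^ 2 =
        (A - B) * ((t ^ 2 + 2 * s * t - s ^ 2) * (A - B) + 2 * (t ^ 2 - s ^ 2) * B) := by ring
      have : 0 ≤ (A - B) * ((t ^ 2 + 2 * s * t - s ^ 2) * (A - B) + 2 * (t ^ 2 - s ^ 2) * B) := by
        have u1 : 0 ≤ A - B := by linarith
        have u2 : 0 ≤ t ^ 2 - s ^ 2 := by nlinarith
        have u3 : 0 ≤ t ^ 2 + 2 * s * t - s ^ 2 := by nlinarith
        positivity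
      linarith
    have h6 : (s + t) ^ 2 ≤ (1 + k₁) * (1 + k₂) := by
      rw [← hs2, ← ht2]; nlinarith [sq_nonneg (s * t - 1)]
    have h7 : (s + t) ^ 2 * (A ^ 2 + B ^ 2) ≤ (1 + k₁) * (1 + k₂) * (A ^ 2 + B ^ 2) := by gcongr
    rw [hA2, hB2] at h5 h7
    linarith

/-- The smallness of `ε` and largeness of `N` used in the local inequality. -/
structure Params (n : ℕ) (r k₁ k₂ p q C ε N : ℝ) : Prop where
  n_pos : 1 ≤ n
  r_pos : 0 < r
  k₁_pos : 0 < k₁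
  k₁_le : k₁ ≤ 1
  k₂_nonneg : 0 ≤ k₂
  p_le : p ≤ 1
  q_nonneg : 0 ≤ q
  C_nonneg : 0 ≤ C
  ε_pos : 0 < ε
  N_pos : 0 < N
  small : (1 + ε) * ((1 - p) * ((n : ℝ) + 1) / r ^ 2 + q * (1 + k₂) * (1 + k₁)) ≤ 2 * k₁
  large : (1 + ε⁻¹) * ((1 - p) / r + q * (n + C) / (n * r)) ≤ N

lemma Params.final {n : ℕ} {r k₁ k₂ p q C ε N : ℝ} (P : Params n r k₁ k₂ p q C ε N)
    {m X Y D y z e I E : ℝ} (hm : 0 < m) (hX : 0 ≤ X) (hXY : X ≤ Y) (hD : 0 ≤ D)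
    (hI : -I = y - z + e) (hy : y ^ 2 ≤ n * m * Y) (hz : k₁ * z ^ 2 ≤ k₂ * (n * m * X))
    (he : N * r * e ^ 2 ≤ (n + C) * m * D)
    (hE : E ≤ (1 - p) * ((1 + ε) * ((n + 1) * (X + Y) / (2 * k₁ * r ^ 2))
      + (1 + ε⁻¹) * (D / (r * N)))) :
    q / (n * m) * I ^ 2 + E ≤ X + Y + D := by
  obtain ⟨hn, hr, hk, hk1, hk2, hp, hq, hC, hε, hN, hs, hl⟩ := P
  have hn0 : (0 : ℝ) < n := by exact_mod_cast hn
  have h1 := two_mul_sub_sq_le hk hk1 hk2 (X := n * m * X) (Y := n * m * Y) (by positivity)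
    (by gcongr) hy hz
  have h2 : I ^ 2 ≤ (1 + ε) * (y - z) ^ 2 + (1 + ε⁻¹) * e ^ 2 := by
    rw [← neg_sq, hI]
    have : (1 + ε) * (y - z) ^ 2 + (1 + ε⁻¹) * e ^ 2 - (y - z + e) ^ 2 =
      ε⁻¹ * (ε * (y - z) - e) ^ 2 := by field_simp; ring
    have : 0 ≤ ε⁻¹ * (ε * (y - z) - e) ^ 2 := by positivity
    linarith
  have h3 : (y - z) ^ 2 ≤ (1 + k₁) * (1 + k₂) * (n * m * X + n * m * Y) / (2 * k₁) := by
    rw [le_div_iff₀ (by positivity)]; linarith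
  have h4 : e ^ 2 ≤ (n + C) * m * D / (N * r) := by
    rw [le_div_iff₀ (by positivity)]; linarith
  have h5 : q / (n * m) * I ^ 2 ≤ q / (n * m) * ((1 + ε) *
      ((1 + k₁) * (1 + k₂) * (n * m * X + n * m * Y) / (2 * k₁)) +
      (1 + ε⁻¹) * ((n + C) * m * D / (N * r))) := by
    gcongr
    refine h2.trans ?_
    gcongr
  have h6 : q / (n * m) * ((1 + ε) *
      ((1 + k₁) * (1 + k₂) * (n * m * X + n * m * Y) / (2 * k₁)) +
      (1 + ε⁻¹) * ((n + C) * m * D / (N * r))) + (1 - p) * ((1 + ε) * ((n + 1) * (X + Y) /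
      (2 * k₁ * r ^ 2)) + (1 + ε⁻¹) * (D / (r * N))) =
      ((1 + ε) * ((1 - p) * ((n : ℝ) + 1) / r ^ 2 + q * (1 + k₂) * (1 + k₁))) *
        ((X + Y) / (2 * k₁)) +
      ((1 + ε⁻¹) * ((1 - p) / r + q * (n + C) / (n * r))) * (D / N) := by
    field_simp; ring
  have h7 : ((1 + ε) * ((1 - p) * ((n : ℝ) + 1) / r ^ 2 + q * (1 + k₂) * (1 + k₁))) *
        ((X + Y) / (2 * k₁)) ≤ 2 * k₁ * ((X + Y) / (2 * k₁)) := by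
    have : 0 ≤ Y := hX.trans hXY
    gcongr
  have h8 : ((1 + ε⁻¹) * ((1 - p) / r + q * (n + C) / (n * r))) * (D / N) ≤ N * (D / N) := by
    gcongr
  have e7 : 2 * k₁ * ((X + Y) / (2 * k₁)) = X + Y := by field_simp
  have e8 : N * (D / N) = D := by field_simp
  linarith

end Algebra

section Pot

variable {n : ℕ} {ι : Type*} [Fintype ι] {a : ι → Euc n} {h : ι → ℝ} {N r k : ℝ}
  {V Φ w F : Euc n → ℝ}

/-- The penalty potential attached to the half-spaces `⟪x, a j⟫ ≤ h j`. -/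
def pot (N : ℝ) (a : ι → Euc n) (h : ι → ℝ) (x : Euc n) : ℝ := ∑ j, pen N (⟪x, a j⟫ - h j)

/-- The potential `V` together with a penalty. -/
def tilt (V : Euc n → ℝ) (N : ℝ) (a : ι → Euc n) (h : ι → ℝ) (x : Euc n) : ℝ :=
  V x + pot N a h x

lemma contDiff_inner_sub (a : Euc n) (h : ℝ) {m : WithTop ℕ∞} :
    ContDiff ℝ m fun x : Euc n => ⟪x, a⟫ - h :=
  (contDiff_id.inner ℝ contDiff_const).sub contDiff_const

lemma differentiable_pen (a : Euc n) (h : ℝ) :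
    Differentiable ℝ fun x : Euc n => pen N (⟪x, a⟫ - h) :=
  ((contDiff_pen N).comp (contDiff_inner_sub _ _)).differentiable (by norm_num)

lemma contDiff_pot : ContDiff ℝ 2 (pot N a h) :=
  ContDiff.sum fun _ _ => (contDiff_pen N).comp (contDiff_inner_sub _ _)

lemma contDiff_tilt (hV : ContDiff ℝ 2 V) : ContDiff ℝ 2 (tilt V N a h) := hV.add contDiff_pot

lemma pd_inner_sub (a : Euc n) (h : ℝ) (i : Fin n) (x : Euc n) :
    pd i (fun y => ⟪y, a⟫ - h) x = a i := by
  have hd : Differentiable ℝ fun y : Euc n => ⟪y, a⟫ :=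
    (contDiff_id.inner ℝ contDiff_const).differentiable one_ne_zero
  rw [pd_sub hd (by fun_prop), pd_inner]
  simp [pd]

lemma pd_pen₁ (a : Euc n) (h : ℝ) (i : Fin n) (x : Euc n) :
    pd i (fun y => pen₁ N (⟪y, a⟫ - h)) x = pen₂ N (⟪x, a⟫ - h) * a i := by
  rw [pd_comp (hasDerivAt_pen₁ N _)
    ((contDiff_inner_sub (m := 1) a h).differentiable (by norm_num) x), pd_inner_sub]

lemma contDiff_pen₁_inner (a : Euc n) (h : ℝ) :
    ContDiff ℝ 1 fun x : Euc n => pen₁ N (⟪x, a⟫ - h) :=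
  (contDiff_pen₁ N).comp (contDiff_inner_sub _ _)

lemma pd_pot (i : Fin n) (x : Euc n) :
    pd i (pot N a h) x = ∑ j, pen₁ N (⟪x, a j⟫ - h j) * a j i := by
  unfold pot
  rw [pd_sum _ fun j _ => differentiable_pen (a j) (h j)]
  refine Finset.sum_congr rfl fun j _ => ?_
  rw [pd_comp (hasDerivAt_pen N _)
    ((contDiff_inner_sub (m := 1) _ _).differentiable (by norm_num) x), pd_inner_sub]

lemma hess_pot (x : Euc n) (v : Fin n → ℝ) :
    hess (pot N a h) x v = ∑ j, pen₂ N (⟪x, a j⟫ - h j) * (∑ i, a j i * v i) ^ 2 := by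
  have e (i l : Fin n) : pd i (pd l (pot N a h)) x =
      ∑ j, pen₂ N (⟪x, a j⟫ - h j) * a j i * a j l := by
    rw [show pd l (pot N a h) = fun x => ∑ j, pen₁ N (⟪x, a j⟫ - h j) * a j l from
      funext (pd_pot l), pd_sum _ fun j _ => ((contDiff_pen₁_inner (a j) (h j)).mul
      contDiff_const).differentiable (by norm_num)]
    refine Finset.sum_congr rfl fun j _ => ?_
    rw [pd_mul ((contDiff_pen₁_inner (a j) (h j)).differentiable (by norm_num)) (by fun_prop),
      pd_pen₁]
    simp [pd]
  simp only [hess, e, Finset.sum_mul]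
  simp_rw [sq, Finset.sum_mul_sum, Finset.mul_sum]
  calc _ = ∑ i, ∑ j, ∑ l, pen₂ N (⟪x, a j⟫ - h j) * a j i * a j l * (v i * v l) :=
        Finset.sum_congr rfl fun i _ => Finset.sum_comm
    _ = ∑ j, ∑ i, ∑ l, pen₂ N (⟪x, a j⟫ - h j) * a j i * a j l * (v i * v l) := Finset.sum_comm
    _ = _ := Finset.sum_congr rfl fun j _ => Finset.sum_congr rfl fun i _ =>
        Finset.sum_congr rfl fun l _ => by ring

lemma pd_tilt (hV : ContDiff ℝ 2 V) (i : Fin n) (x : Euc n) :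
    pd i (tilt V N a h) x = pd i V x + ∑ j, pen₁ N (⟪x, a j⟫ - h j) * a j i := by
  unfold tilt
  rw [pd_add (hV.differentiable (by norm_num)) (contDiff_pot.differentiable (by norm_num)), pd_pot]

lemma hess_tilt (hV : ContDiff ℝ 2 V) (x : Euc n) (v : Fin n → ℝ) :
    hess (tilt V N a h) x v =
      hess V x v + ∑ j, pen₂ N (⟪x, a j⟫ - h j) * (∑ i, a j i * v i) ^ 2 := by
  rw [← hess_pot]
  have hp : ContDiff ℝ 2 (pot N a h) := contDiff_pot
  have e (i l : Fin n) : pd i (pd l (tilt V N a h)) x =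
      pd i (pd l V) x + pd i (pd l (pot N a h)) x := by
    rw [show pd l (tilt V N a h) = fun x => pd l V x + pd l (pot N a h) x from
      funext fun x => by
        unfold tilt
        rw [pd_add (hV.differentiable (by norm_num)) (hp.differentiable (by norm_num))]]
    rw [pd_add ((pd_contDiff (k := 1) hV (by norm_num)).differentiable (by norm_num))
      ((pd_contDiff (k := 1) hp (by norm_num)).differentiable (by norm_num))]
  simp only [hess, e, add_mul, Finset.sum_add_distrib]

lemma pot_nonneg (x : Euc n) : 0 ≤ pot N a h x := Finset.sum_nonneg fun _ _ => pen_nonneg _ _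

lemma sum_eq_of_involution (σ : Equiv.Perm ι) (ha : ∀ j, a (σ j) = - a j)
    (hh : ∀ j, h (σ j) = h j) (φ : ℝ → ℝ) {b : ι → ℝ} (hb : ∀ j, b (σ j) = b j) (x : Euc n) :
    ∑ j, φ (⟪-x, a j⟫ - h j) * b j = ∑ j, φ (⟪x, a j⟫ - h j) * b j := by
  rw [← Equiv.sum_comp σ]
  exact Finset.sum_congr rfl fun j _ => by simp [ha, hh, hb]

lemma pot_even (σ : Equiv.Perm ι) (ha : ∀ j, a (σ j) = - a j)
    (hh : ∀ j, h (σ j) = h j) (x : Euc n) : pot N a h (-x) = pot N a h x := by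
  simpa [pot] using sum_eq_of_involution σ ha hh (pen N) (b := fun _ => 1) (fun _ => rfl) x

lemma pot_eq_zero (ha : ∀ j, ‖a j‖ = 1) (hh : ∀ j, r ≤ h j) {x : Euc n} (hx : ‖x‖ ≤ r) :
    pot N a h x = 0 := by
  refine Finset.sum_eq_zero fun j _ => pen_of_nonpos N ?_
  have := real_inner_le_norm x (a j)
  rw [ha, mul_one] at this
  linarith [hh j]

lemma convexOn_pot (hN : 0 ≤ N) : ConvexOn ℝ Set.univ (pot N a h) := by
  have (j : ι) : ConvexOn ℝ Set.univ fun x : Euc n => pen N (⟪x, a j⟫ - h j) := by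
    refine ⟨convex_univ, fun x _ y _ s t hs ht hst => ?_⟩
    have := (convexOn_pen hN).2 (Set.mem_univ (⟪x, a j⟫ - h j)) (Set.mem_univ (⟪y, a j⟫ - h j))
      hs ht hst
    convert this using 2
    simp only [inner_add_left, inner_smul_left, smul_eq_mul]
    simp
    linear_combination h j * hst
  refine ⟨convex_univ, fun x _ y _ s t hs ht hst => ?_⟩
  simp only [pot, smul_eq_mul, Finset.mul_sum, ← Finset.sum_add_distrib]
  exact Finset.sum_le_sum fun j _ => (this j).2 (Set.mem_univ x) (Set.mem_univ y) hs ht hst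

lemma quadratic_le_tilt {c : ℝ} (hb : ∀ x, c + k * ‖x‖ ^ 2 / 2 ≤ V x) (x : Euc n) :
    c + k * ‖x‖ ^ 2 / 2 ≤ tilt V N a h x :=
  (hb x).trans (le_add_of_nonneg_right (pot_nonneg x))

lemma isFiniteMeasure_gibbs {c : ℝ} (hk : 0 < k) (hΦ : Continuous Φ)
    (hb : ∀ x, c + k * ‖x‖ ^ 2 / 2 ≤ Φ x) : IsFiniteMeasure (gibbs Φ) := by
  have := integrable_gibbs_of_exp_bound hk hΦ hb (f := fun _ => 1) (C := 1) (α := 0)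
    continuous_const (by simp)
  simpa [integrable_const_iff] using this

lemma integral_euler (hΦ : ContDiff ℝ 1 Φ) (hF : ContDiff ℝ 1 F) (hc : HasCompactSupport F) :
    ∫ x, (n * F x + ∑ i, x i * pd i F x) ∂gibbs Φ =
      ∫ x, F x * ∑ i, x i * pd i Φ x ∂gibbs Φ := by
  have := gibbs_isLocallyFinite hΦ.continuous
  have hx (i : Fin n) : ContDiff ℝ 1 fun x : Euc n => x i := by fun_prop
  have hcs (i : Fin n) : HasCompactSupport fun x : Euc n => x i * F x := hc.mul_left
  have e (i : Fin n) : ∫ x, (F x + x i * pd i F x) ∂gibbs Φ =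
      ∫ x, F x * (x i * pd i Φ x) ∂gibbs Φ := by
    have h1 := integral_gibbs_pd hΦ (i := i) ((hx i).mul hF) (hcs i)
    have h2 (x : Euc n) : pd i (fun x => x i * F x) x = F x + x i * pd i F x := by
      rw [pd_mul ((hx i).differentiable (by norm_num)) (hF.differentiable (by norm_num)), pd_coord]
      simp
    simp only [h2] at h1
    rw [h1]
    exact integral_congr_ae (Filter.Eventually.of_forall fun x => by simp only; ring)
  have hcc : IsCc F := ⟨hF.continuous, hc⟩
  have i1 (i : Fin n) : Integrable (fun x => F x + x i * pd i F x) (gibbs Φ) :=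
    (hcc.add ((IsCc.pd hF hc).mul_left (hx i).continuous)).integrable _
  have i2 (i : Fin n) : Integrable (fun x => F x * (x i * pd i Φ x)) (gibbs Φ) :=
    (hcc.mul_right ((hx i).continuous.mul (pd_continuous hΦ))).integrable _
  have e1 : (fun x : Euc n => n * F x + ∑ i, x i * pd i F x) =
      fun x => ∑ i, (F x + x i * pd i F x) := by
    ext x; simp [Finset.sum_add_distrib]
  have e2 : (fun x : Euc n => F x * ∑ i, x i * pd i Φ x) =
      fun x => ∑ i, F x * (x i * pd i Φ x) := by
    ext x; rw [Finset.mul_sum]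
  rw [e1, e2, integral_finsetSum _ fun i _ => i1 i, integral_finsetSum _ fun i _ => i2 i]
  exact Finset.sum_congr rfl fun i _ => e i

lemma inner_eq_sum (x y : Euc n) : ⟪x, y⟫ = ∑ i, x i * y i := by
  rw [PiLp.inner_apply]
  exact Finset.sum_congr rfl fun i _ => by simp [mul_comm]

lemma le_sum_mul_pd_tilt (hV : ContDiff ℝ 2 V) (hVe : ∀ x, V (-x) = V x)
    (hconv : ∀ x v, k * (∑ i, v i ^ 2) ≤ hess V x v) (x : Euc n) :
    k * (∑ i, x i ^ 2) + ∑ j, pen₁ N (⟪x, a j⟫ - h j) * ⟪x, a j⟫ ≤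
      ∑ i, x i * pd i (tilt V N a h) x := by
  have e : ∑ i, x i * pd i (tilt V N a h) x =
      (∑ i, x i * pd i V x) + ∑ j, pen₁ N (⟪x, a j⟫ - h j) * ⟪x, a j⟫ := by
    simp only [pd_tilt hV, mul_add, Finset.sum_add_distrib, Finset.mul_sum, inner_eq_sum x]
    rw [Finset.sum_comm]
    congr 1
    exact Finset.sum_congr rfl fun j _ => Finset.sum_congr rfl fun i _ => by ring
  rw [e]
  gcongr
  exact euler_le hV hVe hconv x

end Pot

section Estimates

variable {n : ℕ} {ι : Type*} [Fintype ι] {a : ι → Euc n} {h : ι → ℝ} {N r k c : ℝ}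
  {V Φ w F φ d : Euc n → ℝ}

lemma continuous_pen₁_inner (a : Euc n) (h : ℝ) : Continuous fun x : Euc n => pen₁ N (⟪x, a⟫ - h) :=
  (contDiff_pen₁_inner a h).continuous

lemma continuous_pen₂_inner (a : Euc n) (h : ℝ) : Continuous fun x : Euc n => pen₂ N (⟪x, a⟫ - h) :=
  (continuous_pen₂ N).comp (contDiff_inner_sub (m := 1) _ _).continuous

lemma abs_pen_inner_le (hN : 0 ≤ N) {a : Euc n} {h : ℝ} (ha : ‖a‖ = 1) (hh : 0 ≤ h) (x : Euc n) :
    |pen₁ N (⟪x, a⟫ - h)| ≤ 6 * (1 + N) ^ 2 * Real.exp ((N + 1) * ‖x‖) ∧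
      |pen₂ N (⟪x, a⟫ - h)| ≤ 6 * (1 + N) ^ 2 * Real.exp ((N + 1) * ‖x‖) := by
  rw [abs_of_nonneg (pen₁_nonneg hN _), abs_of_nonneg (pen₂_nonneg hN _)]
  refine pen_bounds hN ?_ (norm_nonneg x)
  have := real_inner_le_norm x a
  rw [ha, mul_one] at this
  linarith

lemma mul_pen₁_inner_le (hN : 0 ≤ N) {ρ h s : ℝ} (hh : ρ ≤ h) : ρ * pen₁ N (s - h) ≤
    pen₁ N (s - h) * s := by
  rcases le_or_gt s h with h1 | h1
  · simp [pen₁_of_nonpos N (sub_nonpos.mpr h1)]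
  · rw [mul_comm]
    exact mul_le_mul_of_nonneg_left (by linarith) (pen₁_nonneg hN _)

lemma integral_pen₁_le (hk : 0 ≤ k) (hN : 0 ≤ N) (hV : ContDiff ℝ 2 V) (hVe : ∀ x, V (-x) = V x)
    (hconv : ∀ x v, k * (∑ i, v i ^ 2) ≤ hess V x v) (hh : ∀ j, r ≤ h j)
    {C : ℝ} (hC : ∀ R x, |∑ i, x i * pd i (cutoff n R) x| ≤ C)
    [IsFiniteMeasure (gibbs (tilt V N a h))]
    (h_int : ∀ j, Integrable (fun x => pen₁ N (⟪x, a j⟫ - h j)) (gibbs (tilt V N a h))) :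
    r * ∫ x, ∑ j, pen₁ N (⟪x, a j⟫ - h j) ∂gibbs (tilt V N a h) ≤
      (n + C) * (gibbs (tilt V N a h)).real Set.univ := by
  have hT : ContDiff ℝ 1 (tilt V N a h) := (contDiff_tilt hV).of_le (by norm_num)
  set P : Euc n → ℝ := fun x => ∑ j, pen₁ N (⟪x, a j⟫ - h j) with hP
  have hP0 (x : Euc n) : 0 ≤ P x := Finset.sum_nonneg fun j _ => pen₁_nonneg hN _
  have hPc : Continuous P := continuous_finsetSum _ fun j _ => continuous_pen₁_inner _ _
  have hPi : Integrable P (gibbs (tilt V N a h)) := integrable_finsetSum _ fun j _ => h_int j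
  have hPr (x : Euc n) : r * P x ≤ ∑ i, x i * pd i (tilt V N a h) x := by
    refine le_trans ?_ (le_sum_mul_pd_tilt hV hVe hconv x)
    have : 0 ≤ k * ∑ i, x i ^ 2 := mul_nonneg hk (Finset.sum_nonneg fun _ _ => sq_nonneg _)
    have h2 : r * P x ≤ ∑ j, pen₁ N (⟪x, a j⟫ - h j) * ⟪x, a j⟫ := by
      rw [hP, Finset.mul_sum]
      exact Finset.sum_le_sum fun j _ => mul_pen₁_inner_le hN (hh j)
    linarith
  have key (R : ℝ) (hR : 0 < R) : ∫ x, cutoff n R x * (r * P x) ∂gibbs (tilt V N a h) ≤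
      (n + C) * (gibbs (tilt V N a h)).real Set.univ := by
    have hχ : ContDiff ℝ 1 (cutoff n R) := (cutoff_contDiff R).of_le (by simp)
    have hχs : HasCompactSupport (cutoff n R) := cutoff_hasCompactSupport hR
    have hχc := cutoff_isCc (n := n) hR
    have e := integral_euler hT hχ hχs
    have hx (i : Fin n) : Continuous fun x : Euc n => x i := by fun_prop
    calc ∫ x, cutoff n R x * (r * P x) ∂gibbs (tilt V N a h)
        ≤ ∫ x, cutoff n R x * ∑ i, x i * pd i (tilt V N a h) x ∂gibbs (tilt V N a h) := by
          refine integral_mono ((hχc.mul_right (hPc.const_mul r)).integrable _)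
            ((hχc.mul_right (continuous_finsetSum _ fun i _ =>
              (hx i).mul (pd_continuous hT))).integrable _) fun x => ?_
          exact mul_le_mul_of_nonneg_left (hPr x) (cutoff_nonneg R x)
      _ = ∫ x, (n * cutoff n R x + ∑ i, x i * pd i (cutoff n R) x) ∂gibbs (tilt V N a h) := e.symm
      _ ≤ ∫ x, (n + C : ℝ) ∂gibbs (tilt V N a h) := by
          refine integral_mono (((hχc.mul_left continuous_const).add (IsCc.sum fun i _ =>
            (IsCc.pd hχ hχs).mul_left (hx i))).integrable _) (integrable_const _) fun x => ?_
          have h1 := cutoff_le_one R x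
          have h2 := le_of_abs_le (hC R x)
          have : (n : ℝ) * cutoff n R x ≤ n := mul_le_of_le_one_right n.cast_nonneg h1
          simp only
          linarith
      _ = _ := by rw [integral_const, smul_eq_mul, mul_comm]
  have ht : Filter.Tendsto (fun m : ℕ => ∫ x, cutoff n (m + 1) x * (r * P x) ∂gibbs (tilt V N a h))
      Filter.atTop (nhds (∫ x, r * P x ∂gibbs (tilt V N a h))) := by
    refine tendsto_integral_of_dominated_convergence (fun x => |r * P x|) (fun m => ?_)
      (hPi.const_mul r).abs (fun m => Filter.Eventually.of_forall fun x => ?_)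
      (Filter.Eventually.of_forall fun x => ?_)
    · exact ((cutoff_contDiff _).continuous.mul (hPc.const_mul r)).aestronglyMeasurable
    · rw [Real.norm_eq_abs, abs_mul, abs_of_nonneg (cutoff_nonneg _ x)]
      exact mul_le_of_le_one_left (abs_nonneg _) (cutoff_le_one _ x)
    · simpa using! (tendsto_cutoff x).mul_const (r * P x)
  rw [← integral_const_mul]
  exact le_of_tendsto' ht fun m => key _ (by positivity)

lemma integral_sq_grad_radial_le (hk : 0 < k) (hV : ContDiff ℝ 2 V) (hVe : ∀ x, V (-x) = V x)
    (hconv : ∀ x v, k * (∑ i, v i ^ 2) ≤ hess V x v) (hw : ContDiff ℝ 2 w)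
    (hc : HasCompactSupport w) :
    k * ∫ x, (∑ i, pd i w x ^ 2) * ∑ j, pen₁ N (⟪x, a j⟫ - h j) * ⟪x, a j⟫ ∂gibbs (tilt V N a h) ≤
      n * (k * ∫ x, ∑ i, pd i w x ^ 2 ∂gibbs (tilt V N a h)) +
        ∫ x, ∑ i, ∑ j, pd i (pd j w) x ^ 2 ∂gibbs (tilt V N a h) := by
  have hT : ContDiff ℝ 1 (tilt V N a h) := (contDiff_tilt hV).of_le (by norm_num)
  have := gibbs_isLocallyFinite hT.continuous
  have hw1 : ContDiff ℝ 1 w := hw.of_le (by norm_num)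
  have hpw (i : Fin n) : ContDiff ℝ 1 (pd i w) := pd_contDiff hw (by norm_num)
  have hpd (i : Fin n) : Differentiable ℝ (pd i w) := (hpw i).differentiable (by norm_num)
  set G : Euc n → ℝ := fun x => ∑ i, pd i w x ^ 2 with hG
  set H : Euc n → ℝ := fun x => ∑ i, ∑ j, pd i (pd j w) x ^ 2 with hH
  have hGc : IsCc G := IsCc.sum fun i _ => (IsCc.pd hw1 hc).sq
  have hHc : IsCc H := IsCc.norm_hess hw hc
  have hG1 : ContDiff ℝ 1 G := ContDiff.sum fun i _ => (hpw i).pow 2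
  have hG0 (x : Euc n) : 0 ≤ G x := Finset.sum_nonneg fun _ _ => sq_nonneg _
  have hx (i : Fin n) : Continuous fun x : Euc n => x i := by fun_prop
  have e := integral_euler hT hG1 hGc.2
  have hpG (i : Fin n) (x : Euc n) : pd i G x = ∑ j, 2 * pd j w x * pd i (pd j w) x := by
    rw [hG, pd_sum _ fun j _ => ((hpw j).pow 2).differentiable (by norm_num)]
    refine Finset.sum_congr rfl fun j _ => ?_
    rw [pd_comp (φ := fun s => s ^ 2) (hasDerivAt_pow 2 _) (hpd j x)]
    simp
  have hq : Continuous fun x : Euc n => ∑ i, x i ^ 2 :=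
    continuous_finsetSum _ fun i _ => (hx i).pow 2
  have hin : Continuous fun x : Euc n => ∑ j, pen₁ N (⟪x, a j⟫ - h j) * ⟪x, a j⟫ :=
    continuous_finsetSum _ fun j _ => (continuous_pen₁_inner _ _).mul
      (continuous_id.inner continuous_const)
  have hiT : Continuous fun x : Euc n => ∑ i, x i * pd i (tilt V N a h) x :=
    continuous_finsetSum _ fun i _ => (hx i).mul (pd_continuous hT)
  have j1 : Integrable (fun x => G x * ∑ j, pen₁ N (⟪x, a j⟫ - h j) * ⟪x, a j⟫)
    (gibbs (tilt V N a h)) := (hGc.mul_right hin).integrable _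
  have j2 : Integrable (fun x => G x * ∑ i, x i * pd i (tilt V N a h) x)
    (gibbs (tilt V N a h)) := (hGc.mul_right hiT).integrable _
  have j3 : Integrable (fun x => G x * (k * ∑ i, x i ^ 2)) (gibbs (tilt V N a h)) :=
    (hGc.mul_right (hq.const_mul k)).integrable _
  have j4 : Integrable (fun x => n * G x + ∑ i, x i * pd i G x) (gibbs (tilt V N a h)) :=
    ((hGc.mul_left continuous_const).add (IsCc.sum fun i _ =>
      (IsCc.pd hG1 hGc.2).mul_left (hx i))).integrable _
  have h1 : ∫ x, G x * ∑ j, pen₁ N (⟪x, a j⟫ - h j) * ⟪x, a j⟫ ∂gibbs (tilt V N a h) ≤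
      ∫ x, (G x * (∑ i, x i * pd i (tilt V N a h) x) - G x * (k * ∑ i, x i ^ 2))
        ∂gibbs (tilt V N a h) := by
    refine integral_mono j1 (j2.sub' j3) fun x => ?_
    have := mul_le_mul_of_nonneg_left (le_sum_mul_pd_tilt (a := a) (h := h) (N := N)
      hV hVe hconv x) (hG0 x)
    simp only
    linarith
  have h2 : ∫ x, (n * G x + ∑ i, x i * pd i G x - G x * (k * ∑ i, x i ^ 2))
      ∂gibbs (tilt V N a h) ≤ ∫ x, (n * G x + k⁻¹ * H x) ∂gibbs (tilt V N a h) := by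
    refine integral_mono (j4.sub' j3) (((hGc.integrable _).const_mul _).fun_add
      ((hHc.integrable _).const_mul _)) fun x => ?_
    have : ∑ i, x i * pd i G x ≤ G x * (k * ∑ i, x i ^ 2) + k⁻¹ * H x := by
      rw [mul_left_comm, mul_comm (G x), hG, hH, Finset.sum_mul_sum, Finset.mul_sum,
        Finset.mul_sum, ← Finset.sum_add_distrib]
      refine Finset.sum_le_sum fun i _ => ?_
      rw [hpG, Finset.mul_sum, Finset.mul_sum, Finset.mul_sum, ← Finset.sum_add_distrib]
      refine Finset.sum_le_sum fun j _ => ?_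
      have e1 : k * (x i ^ 2 * pd j w x ^ 2) + k⁻¹ * pd i (pd j w) x ^ 2 -
          x i * (2 * pd j w x * pd i (pd j w) x) =
          k⁻¹ * (k * (x i * pd j w x) - pd i (pd j w) x) ^ 2 := by field_simp; ring
      have e2 : 0 ≤ k⁻¹ * (k * (x i * pd j w x) - pd i (pd j w) x) ^ 2 := by positivity
      linarith
    simp only
    linarith
  rw [integral_sub j2 j3, ← e] at h1
  rw [integral_sub j4 j3, integral_add ((hGc.integrable _).const_mul _)
    ((hHc.integrable _).const_mul _), integral_const_mul, integral_const_mul] at h2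
  calc _ ≤ k * (n * (∫ x, G x ∂gibbs (tilt V N a h)) + k⁻¹ * ∫ x, H x ∂gibbs (tilt V N a h)) :=
        mul_le_mul_of_nonneg_left (h1.trans h2) hk.le
    _ = _ := by field_simp

lemma integral_sq_grad_le (hk : 0 < k) (hΦ : ContDiff ℝ 2 Φ) (hb : ∀ x, c ≤ Φ x)
    (he : ∀ x, Φ (-x) = Φ x) [IsFiniteMeasure (gibbs Φ)]
    (hconv : ∀ x v, k * (∑ i, v i ^ 2) ≤ hess Φ x v) (hw : ContDiff ℝ 2 w)
    (hc : HasCompactSupport w) (hwe : ∀ x, w (-x) = w x) :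
    k * ∫ x, ∑ i, pd i w x ^ 2 ∂gibbs Φ ≤ ∫ x, ∑ i, ∑ j, pd i (pd j w) x ^ 2 ∂gibbs Φ := by
  have hw1 : ContDiff ℝ 1 w := hw.of_le (by norm_num)
  have hpw (i : Fin n) : ContDiff ℝ 1 (pd i w) := pd_contDiff hw (by norm_num)
  have hj (j : Fin n) := poincare hk hΦ hb hconv (hpw j) (IsCc.pd hw1 hc).2
    (integral_eq_zero_of_odd hΦ.continuous he fun x => pd_odd_of_even hwe x)
  have e : (fun x => ∑ i, ∑ j, pd i (pd j w) x ^ 2) = fun x => ∑ j, ∑ i, pd i (pd j w) x ^ 2 := by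
    ext x; exact Finset.sum_comm
  rw [e, integral_finsetSum _ fun i _ => (IsCc.pd hw1 hc).sq.integrable _,
    integral_finsetSum _ fun j _ => (IsCc.sum fun i _ => (IsCc.pd_pd hw hc).sq).integrable _,
    Finset.mul_sum]
  exact Finset.sum_le_sum fun j _ => hj j

lemma sq_integral_laplacian_le [IsFiniteMeasure (gibbs Φ)]
    (hw : ContDiff ℝ 2 w) (hc : HasCompactSupport w) :
    (∫ x, ∑ i, pd i (pd i w) x ∂gibbs Φ) ^ 2 ≤
      n * (gibbs Φ).real Set.univ * ∫ x, ∑ i, ∑ j, pd i (pd j w) x ^ 2 ∂gibbs Φ := by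
  have hl : IsCc fun x => ∑ i, pd i (pd i w) x := IsCc.sum fun i _ => IsCc.pd_pd hw hc
  have h1 := sq_integral_mul_le (ν := gibbs Φ) (a := fun _ => 1)
    (b := fun x => ∑ i, pd i (pd i w) x) (by simp) (hl.sq.integrable _)
    (by simpa using hl.integrable _)
  simp only [one_mul, one_pow, integral_const, smul_eq_mul, mul_one] at h1
  have h2 : ∫ x, (∑ i, pd i (pd i w) x) ^ 2 ∂gibbs Φ ≤
      ∫ x, n * ∑ i, ∑ j, pd i (pd j w) x ^ 2 ∂gibbs Φ := by
    refine integral_mono (hl.sq.integrable _) (((IsCc.norm_hess hw hc).integrable _).const_mul _)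
      fun x => ?_
    have h3 := sq_sum_le_card_mul_sum_sq (s := Finset.univ) (f := fun i => pd i (pd i w) x)
    rw [Finset.card_univ, Fintype.card_fin] at h3
    refine h3.trans (mul_le_mul_of_nonneg_left (Finset.sum_le_sum fun i _ => ?_) n.cast_nonneg)
    exact Finset.single_le_sum (f := fun j => pd i (pd j w) x ^ 2)
      (fun _ _ => sq_nonneg _) (Finset.mem_univ i)
  rw [integral_const_mul] at h2
  calc _ ≤ _ := h1
    _ ≤ (gibbs Φ).real Set.univ * (n * ∫ x, ∑ i, ∑ j, pd i (pd j w) x ^ 2 ∂gibbs Φ) := by gcongr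
    _ = _ := by ring

lemma integrable_mul_sub {ν : Measure (Euc n)} (hφ : Continuous φ) (hi : Integrable φ ν)
    [IsFiniteMeasureOnCompacts ν]
    (hd : IsCc d) (c : ℝ) : Integrable (fun x => φ x * (c - d x)) ν ∧
      Integrable (fun x => φ x * (c - d x) ^ 2) ν := by
  constructor
  · have := (hi.mul_const c).sub' ((hd.mul_left hφ).integrable ν)
    exact this.congr (Filter.Eventually.of_forall fun x => by simp only; ring)
  · have := ((hi.mul_const (c ^ 2)).sub'
      (((hd.mul_left hφ).integrable ν).const_mul (2 * c))).fun_add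
      ((hd.sq.mul_left hφ).integrable ν)
    exact this.congr (Filter.Eventually.of_forall fun x => by simp only; ring)

lemma sq_integral_sum_mul_le {ν : Measure (Euc n)} {α b : ι → Euc n → ℝ}
    (hα : ∀ j x, 0 ≤ α j x) (h0 : ∀ j, Integrable (α j) ν)
    (h1 : ∀ j, Integrable (fun x => α j x * b j x) ν)
    (h2 : ∀ j, Integrable (fun x => α j x * b j x ^ 2) ν) :
    (∫ x, ∑ j, α j x * b j x ∂ν) ^ 2 ≤
      (∫ x, ∑ j, α j x ∂ν) * ∫ x, ∑ j, α j x * b j x ^ 2 ∂ν := by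
  refine sq_le_mul_of_quadratic fun s => ?_
  have h : 0 ≤ ∫ x, ∑ j, α j x * (s + b j x) ^ 2 ∂ν :=
    integral_nonneg fun x => Finset.sum_nonneg fun j _ => mul_nonneg (hα j x) (sq_nonneg _)
  have i0 : Integrable (fun x => ∑ j, α j x) ν := integrable_finsetSum _ fun j _ => h0 j
  have i1 : Integrable (fun x => ∑ j, α j x * b j x) ν := integrable_finsetSum _ fun j _ => h1 j
  have i2 : Integrable (fun x => ∑ j, α j x * b j x ^ 2) ν := integrable_finsetSum _ fun j _ => h2 j
  have e : (fun x => ∑ j, α j x * (s + b j x) ^ 2) = fun x => (s ^ 2 * (∑ j, α j x) +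
      2 * s * (∑ j, α j x * b j x)) + ∑ j, α j x * b j x ^ 2 := by
    ext x
    simp only [Finset.mul_sum, ← Finset.sum_add_distrib]
    exact Finset.sum_congr rfl fun j _ => by ring
  rw [e, integral_add ((i0.const_mul _).fun_add (i1.const_mul _)) i2,
    integral_add (i0.const_mul _) (i1.const_mul _), integral_const_mul, integral_const_mul] at h
  linarith

end Estimates

section Local

variable {n : ℕ} {ι : Type*} [Fintype ι] {a : ι → Euc n} {h h' h'' : ι → ℝ}
  {r k₁ k₂ p q C ε N c δ : ℝ} {V Φ w F φ d : Euc n → ℝ}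

/-- The derivative of `w` in the direction `a`. -/
def dirD (a : Euc n) (w : Euc n → ℝ) (x : Euc n) : ℝ := ∑ i, a i * pd i w x

lemma isCc_dirD (a : Euc n) (hw : ContDiff ℝ 1 w) (hc : HasCompactSupport w) : IsCc (dirD a w) :=
  IsCc.sum fun _ _ => (IsCc.pd hw hc).mul_left continuous_const

lemma dirD_sq_le {a : Euc n} (ha : ‖a‖ = 1) (w : Euc n → ℝ) (x : Euc n) :
    dirD a w x ^ 2 ≤ ∑ i, pd i w x ^ 2 := by
  have := Finset.sum_mul_sq_le_sq_mul_sq Finset.univ (fun i => a i) (fun i => pd i w x)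
  rwa [← EuclideanSpace.real_norm_sq_eq, ha, one_pow, one_mul] at this

lemma sum_pen₁_mul_le (P : Params n r k₁ k₂ p q C ε N) (ha : ∀ j, ‖a j‖ = 1) (hh : ∀ j, r ≤ h j)
    (h2 : ∀ j, h'' j * h j ≤ (1 - p) * h' j ^ 2) (x : Euc n) :
    ∑ j, pen₁ N (⟪x, a j⟫ - h j) * h'' j ≤
      (1 - p) * ((1 + ε) / r ^ 2) *
        ((∑ i, pd i w x ^ 2) * ∑ j, pen₁ N (⟪x, a j⟫ - h j) * ⟪x, a j⟫) +
      (1 - p) * ((1 + ε⁻¹) / (r * N)) *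
        ∑ j, pen₂ N (⟪x, a j⟫ - h j) * (h' j - dirD (a j) w x) ^ 2 := by
  have hr := P.r_pos
  have hε := P.ε_pos
  have hN := P.N_pos
  have hp : 0 ≤ 1 - p := sub_nonneg.mpr P.p_le
  rw [Finset.mul_sum, Finset.mul_sum, Finset.mul_sum, ← Finset.sum_add_distrib]
  refine Finset.sum_le_sum fun j _ => ?_
  set s := ⟪x, a j⟫
  set α := pen₁ N (s - h j) with hα
  have hα0 : 0 ≤ α := pen₁_nonneg hN.le _
  have hαs : r * α ≤ α * s := mul_pen₁_inner_le hN.le (hh j)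
  have hαβ : N * α ≤ pen₂ N (s - h j) := mul_pen₁_le hN.le _
  set β := pen₂ N (s - h j)
  set D := dirD (a j) w x
  set G := ∑ i, pd i w x ^ 2
  have hG : D ^ 2 ≤ G := dirD_sq_le (ha j) w x
  have hhj : 0 < h j := hr.trans_le (hh j)
  have e1 : h'' j ≤ (1 - p) * h' j ^ 2 / h j := by rw [le_div_iff₀ hhj]; exact h2 j
  have e2 : (1 - p) * h' j ^ 2 / h j ≤ (1 - p) * h' j ^ 2 / r :=
    div_le_div_of_nonneg_left (by positivity) hr (hh j)
  have e3 : h' j ^ 2 ≤ (1 + ε) * D ^ 2 + (1 + ε⁻¹) * (h' j - D) ^ 2 := by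
    have : (1 + ε) * D ^ 2 + (1 + ε⁻¹) * (h' j - D) ^ 2 - h' j ^ 2 =
      ε⁻¹ * (ε * D - (h' j - D)) ^ 2 := by field_simp; ring
    have : 0 ≤ ε⁻¹ * (ε * D - (h' j - D)) ^ 2 := by positivity
    linarith
  calc α * h'' j ≤ α * ((1 - p) * h' j ^ 2 / r) :=
        mul_le_mul_of_nonneg_left (e1.trans e2) hα0
    _ ≤ α * ((1 - p) * ((1 + ε) * D ^ 2 + (1 + ε⁻¹) * (h' j - D) ^ 2) / r) := by gcongr
    _ = (1 - p) * ((1 + ε) / r ^ 2) * (D ^ 2 * (r * α)) +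
        (1 - p) * ((1 + ε⁻¹) / (r * N)) * ((N * α) * (h' j - D) ^ 2) := by field_simp
    _ ≤ _ := by
      have : 0 ≤ r * α := by positivity
      have : 0 ≤ G := (sq_nonneg _).trans hG
      gcongr

lemma local_ineq (P : Params n r k₁ k₂ p q C ε N)
    (hC : ∀ R x, |∑ i, x i * pd i (cutoff n R) x| ≤ C)
    (hV : ContDiff ℝ 2 V) (hVe : ∀ x, V (-x) = V x)
    (hconv : ∀ x v, k₁ * (∑ i, v i ^ 2) ≤ hess V x v)
    (hlap : ∀ M : Set (Euc n), IsConvexBody M → M = -M → Metric.closedBall (0 : Euc n) r ⊆ M →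
      ∫ x in M, ∑ i, pd i (pd i V) x ∂gibbs V ≤ k₂ * n * (gibbs V M).toReal)
    (σ : Equiv.Perm ι) (hσa : ∀ j, a (σ j) = - a j) (hσh : ∀ j, h (σ j) = h j)
    (hσh' : ∀ j, h' (σ j) = h' j) (ha : ∀ j, ‖a j‖ = 1) (hh : ∀ j, r ≤ h j)
    (h2 : ∀ j, h'' j * h j ≤ (1 - p) * h' j ^ 2) :
    (gibbs (tilt V N a h)).real Set.univ *
      ∫ x, ((∑ j, pen₁ N (⟪x, a j⟫ - h j) * h' j) ^ 2 -
        ∑ j, (pen₂ N (⟪x, a j⟫ - h j) * h' j ^ 2 - pen₁ N (⟪x, a j⟫ - h j) * h'' j))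
        ∂gibbs (tilt V N a h) ≤
      (1 - q / n) * (∫ x, ∑ j, pen₁ N (⟪x, a j⟫ - h j) * h' j ∂gibbs (tilt V N a h)) ^ 2 := by
  have hr := P.r_pos
  have hε := P.ε_pos
  have hN := P.N_pos
  have hk := P.k₁_pos
  have hk2 := P.k₂_nonneg
  have hp : 0 ≤ 1 - p := sub_nonneg.mpr P.p_le
  have hn0 : (0 : ℝ) < n := by exact_mod_cast P.n_pos
  have hh0 (j : ι) : 0 ≤ h j := hr.le.trans (hh j)
  have hT := contDiff_tilt (a := a) (h := h) (N := N) hV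
  have hq (x : Euc n) := quadratic_le_tilt (a := a) (h := h) (N := N)
    (fun x => quadratic_le hV hVe hconv x) x
  have hTe (x : Euc n) : tilt V N a h (-x) = tilt V N a h x := by
    simp only [tilt, hVe, pot_even σ hσa hσh]
  have hb (x : Euc n) : V 0 ≤ tilt V N a h x :=
    (le_add_of_nonneg_right (by positivity)).trans (hq x)
  have hfin : IsFiniteMeasure (gibbs (tilt V N a h)) := isFiniteMeasure_gibbs hk hT.continuous hq
  have hTconv (x : Euc n) (v : Fin n → ℝ) : hess V x v ≤ hess (tilt V N a h) x v := by
    rw [hess_tilt hV]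
    exact le_add_of_nonneg_right (Finset.sum_nonneg fun j _ =>
      mul_nonneg (pen₂_nonneg hN.le _) (sq_nonneg _))
  have hV0 (x : Euc n) (v : Fin n → ℝ) : 0 ≤ hess V x v :=
    le_trans (mul_nonneg hk.le (Finset.sum_nonneg fun _ _ => sq_nonneg _)) (hconv x v)
  -- the Laplacian of `V`
  have hdiag (i : Fin n) (x : Euc n) : 0 ≤ pd i (pd i V) x := by
    have h1 := hV0 x (fun j => (if j = i then 1 else 0) + 0)
    have h3 := hess_add_single hV x i 1 0
    simp only [Pi.zero_apply] at h3
    rw [h3] at h1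
    simpa [hess] using h1
  have hdc (i : Fin n) : Continuous (pd i (pd i V)) :=
    pd_continuous (pd_contDiff (k := 1) hV (by norm_num))
  obtain ⟨hLi, hL⟩ : Integrable (fun x => ∑ i, pd i (pd i V) x) (gibbs (tilt V N a h)) ∧
      ∫ x, ∑ i, pd i (pd i V) x ∂gibbs (tilt V N a h) ≤
        k₂ * n * (gibbs (tilt V N a h)).real Set.univ :=
    have : IsFiniteMeasure (gibbs fun x => V x + pot N a h x) := hfin
    integral_gibbs_le_of_convex_bodies hV.continuous contDiff_pot.continuous pot_nonneg
      (convexOn_pot hN.le) (pot_even σ hσa hσh) (fun x hx => pot_eq_zero ha hh hx) hr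
      (continuous_finsetSum _ fun i _ => hdc i) (fun x => Finset.sum_nonneg fun i _ => hdiag i x)
      (by positivity) hlap
  have hLi' (i : Fin n) : Integrable (pd i (pd i V)) (gibbs (tilt V N a h)) :=
    hLi.mono' (hdc i).aestronglyMeasurable (Filter.Eventually.of_forall fun x => by
      rw [Real.norm_eq_abs, abs_of_nonneg (hdiag i x)]
      exact Finset.single_le_sum (f := fun i => pd i (pd i V) x) (fun i _ => hdiag i x)
        (Finset.mem_univ i))
  set ν := gibbs (tilt V N a h) with hν
  set m := ν.real Set.univ with hm
  have hm0 : 0 ≤ m := measureReal_nonneg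
  -- the penalty weights
  set α : ι → Euc n → ℝ := fun j x => pen₁ N (⟪x, a j⟫ - h j) with hα
  set β : ι → Euc n → ℝ := fun j x => pen₂ N (⟪x, a j⟫ - h j) with hβ
  have hα0 (j : ι) (x : Euc n) : 0 ≤ α j x := pen₁_nonneg hN.le _
  have hβ0 (j : ι) (x : Euc n) : 0 ≤ β j x := pen₂_nonneg hN.le _
  have hαβ (j : ι) (x : Euc n) : N * α j x ≤ β j x := mul_pen₁_le hN.le _
  have hαc (j : ι) : Continuous (α j) := continuous_pen₁_inner _ _
  have hβc (j : ι) : Continuous (β j) := continuous_pen₂_inner _ _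
  have hαi (j : ι) : Integrable (α j) ν := integrable_gibbs_of_exp_bound hk hT.continuous hq
    (hαc j) fun x => (abs_pen_inner_le hN.le (ha j) (hh0 j) x).1
  have hβi (j : ι) : Integrable (β j) ν := integrable_gibbs_of_exp_bound hk hT.continuous hq
    (hβc j) fun x => (abs_pen_inner_le hN.le (ha j) (hh0 j) x).2
  set G : Euc n → ℝ := fun x => ∑ j, α j x * h' j with hG
  have hGc : ContDiff ℝ 1 G := ContDiff.sum fun j _ => (contDiff_pen₁_inner _ _).mul contDiff_const
  have hGi : Integrable G ν := integrable_finsetSum _ fun j _ => (hαi j).mul_const _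
  have hG2 : MemLp G 2 ν := by
    rw [memLp_two_iff_integrable_sq hGc.continuous.aestronglyMeasurable]
    refine integrable_gibbs_of_exp_bound hk hT.continuous hq (hGc.continuous.pow 2)
      (C := (∑ j, 6 * (1 + N) ^ 2 * |h' j|) ^ 2) (α := 2 * (N + 1)) fun x => ?_
    have h1 : |G x| ≤ (∑ j, 6 * (1 + N) ^ 2 * |h' j|) * Real.exp ((N + 1) * ‖x‖) := by
      rw [Finset.sum_mul]
      refine (Finset.abs_sum_le_sum_abs _ _).trans (Finset.sum_le_sum fun j _ => ?_)
      rw [abs_mul]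
      calc _ ≤ (6 * (1 + N) ^ 2 * Real.exp ((N + 1) * ‖x‖)) * |h' j| :=
            mul_le_mul_of_nonneg_right (abs_pen_inner_le hN.le (ha j) (hh0 j) x).1 (abs_nonneg _)
        _ = _ := by ring
    rw [abs_pow]
    calc |G x| ^ 2 ≤ ((∑ j, 6 * (1 + N) ^ 2 * |h' j|) * Real.exp ((N + 1) * ‖x‖)) ^ 2 := by gcongr
      _ = _ := by rw [mul_pow, ← Real.exp_nat_mul]; congr 2; push_cast; ring
  have hGe (x : Euc n) : G (-x) = G x := sum_eq_of_involution σ hσa hσh (pen₁ N) hσh' x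
  set I := ∫ x, G x ∂ν with hI
  have hβ2i : Integrable (fun x => ∑ j, β j x * h' j ^ 2) ν :=
    integrable_finsetSum _ fun j _ => (hβi j).mul_const _
  have hα2i : Integrable (fun x => ∑ j, α j x * h'' j) ν :=
    integrable_finsetSum _ fun j _ => (hαi j).mul_const _
  have hsplit : ∫ x, (G x ^ 2 - ∑ j, (β j x * h' j ^ 2 - α j x * h'' j)) ∂ν =
      (∫ x, G x ^ 2 ∂ν) - (∫ x, ∑ j, β j x * h' j ^ 2 ∂ν) + ∫ x, ∑ j, α j x * h'' j ∂ν := by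
    rw [← integral_sub hG2.integrable_sq hβ2i, ← integral_add (hG2.integrable_sq.sub' hβ2i) hα2i]
    refine integral_congr_ae (Filter.Eventually.of_forall fun x => ?_)
    simp only [Finset.sum_sub_distrib]
    ring
  change m * ∫ x, (G x ^ 2 - ∑ j, (β j x * h' j ^ 2 - α j x * h'' j)) ∂ν ≤ (1 - q / n) * I ^ 2
  rw [hsplit]
  rcases hm0.eq_or_lt with hm00 | hmpos
  · rw [← hm00, zero_mul]
    have : ν = 0 := by
      have : ν.real Set.univ = 0 := hm00.symm
      simpa [measureReal_eq_zero_iff] using this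
    simp [hI, this]
  set b : ℝ := I / m with hbdef
  set f : Euc n → ℝ := fun x => b - G x with hf
  have hf1 : ContDiff ℝ 1 f := contDiff_const.sub hGc
  have hf2 : MemLp f 2 ν := (memLp_const b).sub hG2
  have hf0 : ∫ x, f x ∂ν = 0 := by
    rw [hf, integral_sub (integrable_const _) hGi, integral_const, smul_eq_mul, hbdef]
    rw [← hm, ← hI]
    field_simp
    ring
  have hfe (x : Euc n) : f (-x) = f x := by simp only [hf, hGe]
  have hfsq : ∫ x, f x ^ 2 ∂ν = (∫ x, G x ^ 2 ∂ν) - I ^ 2 / m := by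
    have e : (fun x => f x ^ 2) = fun x => G x ^ 2 - 2 * b * G x + b ^ 2 := by
      ext x; simp only [hf]; ring
    rw [e, integral_add (hG2.integrable_sq.sub' (hGi.const_mul _)) (integrable_const _),
      integral_sub hG2.integrable_sq (hGi.const_mul _), integral_const_mul, integral_const,
      smul_eq_mul, hbdef]
    simp only [← hI, ← hm]
    field_simp
    ring
  have hpf (i : Fin n) (x : Euc n) : pd i f x = - ∑ j, β j x * h' j * a j i := by
    have h1 (j : ι) : Differentiable ℝ fun x => α j x :=
      (contDiff_pen₁_inner (a j) (h j)).differentiable (by norm_num)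
    rw [hf, pd_sub (by fun_prop) (hGc.differentiable (by norm_num)), hG,
      pd_sum _ fun j _ => (h1 j).mul_const _]
    have h2 : pd i (fun _ => b) x = 0 := by simp [pd]
    rw [h2, zero_sub]
    congr 1
    refine Finset.sum_congr rfl fun j _ => ?_
    have h3 : pd i (fun _ => h' j) x = 0 := by simp [pd]
    rw [pd_mul (h1 j) (by fun_prop), h3, hα, pd_pen₁]
    ring
  suffices hmain : ∀ δ > 0, (∫ x, G x ^ 2 ∂ν) - (∫ x, ∑ j, β j x * h' j ^ 2 ∂ν) +
      (∫ x, ∑ j, α j x * h'' j ∂ν) ≤ (1 - q / n) * I ^ 2 / m + δ by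
    have := le_of_forall_pos_le_add hmain
    rw [le_div_iff₀ hmpos] at this
    linarith
  intro δ hδ
  obtain ⟨w, hw, hc, hwe, hwx⟩ := exists_even_genL_approx hT hb hTe hfe hf2 hf0 hδ
  have hw2 := contDiff_infty_two hw
  have hw1 : ContDiff ℝ 1 w := hw.of_le (by simp)
  have happ := integral_sq_le_of_approx hT hf1 hf2 hw hc hwx
  set Y := ∫ x, ∑ i, ∑ j, pd i (pd j w) x ^ 2 ∂ν with hY
  set X := k₁ * ∫ x, ∑ i, pd i w x ^ 2 ∂ν with hX
  have hGr : IsCc fun x => ∑ i, pd i w x ^ 2 := IsCc.sum fun i _ => (IsCc.pd hw1 hc).sq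
  have hX0 : 0 ≤ X := mul_nonneg hk.le (integral_nonneg fun x =>
    Finset.sum_nonneg fun _ _ => sq_nonneg _)
  have hXY : X ≤ Y := integral_sq_grad_le hk hT hb hTe (fun x v => (hconv x v).trans (hTconv x v))
    hw2 hc hwe
  have hd (j : ι) : IsCc (dirD (a j) w) := isCc_dirD (a j) hw1 hc
  have hαd (j : ι) := integrable_mul_sub (hαc j) (hαi j) (hd j) (h' j)
  have hβd (j : ι) := integrable_mul_sub (hβc j) (hβi j) (hd j) (h' j)
  set D := ∫ x, ∑ j, β j x * (h' j - dirD (a j) w x) ^ 2 ∂ν with hD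
  have hDi : Integrable (fun x => ∑ j, β j x * (h' j - dirD (a j) w x) ^ 2) ν :=
    integrable_finsetSum _ fun j _ => (hβd j).2
  have hD0 : 0 ≤ D := integral_nonneg fun x => Finset.sum_nonneg fun j _ =>
    mul_nonneg (hβ0 j x) (sq_nonneg _)
  set y := ∫ x, ∑ i, pd i (pd i w) x ∂ν with hy
  set z := ∫ x, ∑ i, pd i V x * pd i w x ∂ν with hz
  set e := -∫ x, ∑ j, α j x * (h' j - dirD (a j) w x) ∂ν with he
  -- the variance estimate
  have hvar : (∫ x, f x ^ 2 ∂ν) + X + Y + D ≤ δ + ∫ x, ∑ j, β j x * h' j ^ 2 ∂ν := by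
    have hfw : IsCc fun x => ∑ i, pd i f x * pd i w x :=
      IsCc.sum fun i _ => (IsCc.pd hw1 hc).mul_left (pd_continuous hf1)
    have hHw := IsCc.hess hT hw1 hc
    have h1 : ∫ x, ((∑ j, β j x * (h' j - dirD (a j) w x) ^ 2) + k₁ * ∑ i, pd i w x ^ 2) ∂ν ≤
        ∫ x, ((∑ j, β j x * h' j ^ 2) + (hess (tilt V N a h) x (grad w x) +
          2 * ∑ i, pd i f x * pd i w x)) ∂ν := by
      refine integral_mono (hDi.add ((hGr.integrable ν).const_mul _))
        (hβ2i.add ((hHw.integrable ν).add ((hfw.integrable ν).const_mul _))) fun x => ?_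
      have e1 : ∑ i, pd i f x * pd i w x = - ∑ j, β j x * h' j * dirD (a j) w x := by
        simp only [hpf, dirD, Finset.mul_sum, neg_mul, Finset.sum_mul, Finset.sum_neg_distrib]
        rw [Finset.sum_comm]
        congr 1
        exact Finset.sum_congr rfl fun j _ => Finset.sum_congr rfl fun i _ => by ring
      have e2 : hess (tilt V N a h) x (grad w x) =
          hess V x (grad w x) + ∑ j, β j x * dirD (a j) w x ^ 2 := hess_tilt hV x _
      have e3 : k₁ * ∑ i, pd i w x ^ 2 ≤ hess V x (grad w x) := hconv x (grad w x)
      have e4 : ∑ j, β j x * (h' j - dirD (a j) w x) ^ 2 = (∑ j, β j x * h' j ^ 2) -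
          2 * (∑ j, β j x * h' j * dirD (a j) w x) + ∑ j, β j x * dirD (a j) w x ^ 2 := by
        rw [Finset.mul_sum, ← Finset.sum_sub_distrib, ← Finset.sum_add_distrib]
        exact Finset.sum_congr rfl fun j _ => by ring
      simp only
      linarith
    rw [integral_add hDi ((hGr.integrable ν).const_mul _), integral_add hβ2i
      ((hHw.integrable ν).fun_add ((hfw.integrable ν).const_mul _)), integral_add (hHw.integrable ν)
      ((hfw.integrable ν).const_mul _), integral_const_mul, integral_const_mul] at h1
    linarith
  have hE : ∫ x, ∑ j, α j x * h'' j ∂ν ≤ (1 - p) * ((1 + ε) * ((n + 1) * (X + Y) /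
      (2 * k₁ * r ^ 2)) + (1 + ε⁻¹) * (D / (r * N))) := by
    have hrad := integral_sq_grad_radial_le (a := a) (h := h) (N := N) hk hV hVe hconv hw2 hc
    set S := ∫ x, (∑ i, pd i w x ^ 2) * ∑ j, pen₁ N (⟪x, a j⟫ - h j) * ⟪x, a j⟫ ∂ν with hS
    have hSi : IsCc fun x => (∑ i, pd i w x ^ 2) * ∑ j, α j x * ⟪x, a j⟫ :=
      hGr.mul_right (continuous_finsetSum _ fun j _ => (hαc j).mul (by fun_prop))
    have h1 := integral_mono hα2i (((hSi.integrable ν).const_mul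
      ((1 - p) * ((1 + ε) / r ^ 2))).add (hDi.const_mul ((1 - p) * ((1 + ε⁻¹) / (r * N)))))
      fun x => sum_pen₁_mul_le (w := w) P ha hh h2 x
    have h3 : ∫ x, ((1 - p) * ((1 + ε) / r ^ 2) * ((∑ i, pd i w x ^ 2) * ∑ j, α j x * ⟪x, a j⟫) +
        (1 - p) * ((1 + ε⁻¹) / (r * N)) * ∑ j, β j x * (h' j - dirD (a j) w x) ^ 2) ∂ν =
        (1 - p) * ((1 + ε) / r ^ 2) * S + (1 - p) * ((1 + ε⁻¹) / (r * N)) * D := by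
      rw [integral_add ((hSi.integrable ν).const_mul _) (hDi.const_mul _), integral_const_mul,
        integral_const_mul]
    refine h1.trans (h3.le.trans ?_)
    have h4 : S ≤ (n + 1) * (X + Y) / (2 * k₁) := by
      rw [le_div_iff₀ (by positivity)]
      have hn1 : (1 : ℝ) ≤ n := by exact_mod_cast P.n_pos
      have : 0 ≤ (n - 1) * (Y - X) := mul_nonneg (by linarith) (by linarith)
      have h5 : k₁ * S ≤ n * X + Y := hrad
      linarith
    calc _ ≤ (1 - p) * ((1 + ε) / r ^ 2) * ((n + 1) * (X + Y) / (2 * k₁)) +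
          (1 - p) * ((1 + ε⁻¹) / (r * N)) * D := by gcongr
      _ = _ := by field_simp
  have hIe : I = y - z - e := by
    have hαdi (j : ι) : IsCc fun x => α j x * dirD (a j) w x := (hd j).mul_left (hαc j)
    have hsd : IsCc fun x => ∑ j, α j x * dirD (a j) w x := IsCc.sum fun j _ => hαdi j
    have hΔ : IsCc fun x => ∑ i, pd i (pd i w) x := IsCc.sum fun i _ => IsCc.pd_pd hw2 hc
    have hVw : IsCc fun x => ∑ i, pd i V x * pd i w x := IsCc.sum fun i _ =>
      (IsCc.pd hw1 hc).mul_left (pd_continuous (hV.of_le (by norm_num)))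
    have h1 := integral_genL (hT.of_le (by norm_num)) hw2 hc
    have e1 (x : Euc n) : genL (tilt V N a h) w x = (∑ i, pd i (pd i w) x) -
        (∑ i, pd i V x * pd i w x) - ∑ j, α j x * dirD (a j) w x := by
      simp only [genL, pd_tilt hV, dirD, add_mul, Finset.sum_sub_distrib, Finset.sum_add_distrib,
        Finset.sum_mul, Finset.mul_sum]
      rw [Finset.sum_comm (f := fun i j => pen₁ N (⟪x, a j⟫ - h j) * a j i * pd i w x)]
      rw [sub_sub]
      congr 2
      exact Finset.sum_congr rfl fun j _ => Finset.sum_congr rfl fun i _ => by ring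
    simp only [e1] at h1
    rw [integral_sub ((hΔ.integrable _).sub' (hVw.integrable _)) (hsd.integrable _),
      integral_sub (hΔ.integrable _) (hVw.integrable _)] at h1
    have e2 : I = (∫ x, ∑ j, α j x * (h' j - dirD (a j) w x) ∂ν) +
        ∫ x, ∑ j, α j x * dirD (a j) w x ∂ν := by
      rw [← integral_add (integrable_finsetSum _ fun j _ => (hαd j).1) (hsd.integrable _)]
      refine integral_congr_ae (Filter.Eventually.of_forall fun x => ?_)
      simp only [hG, ← Finset.sum_add_distrib]
      exact Finset.sum_congr rfl fun j _ => by ring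
    linarith
  have hysq : y ^ 2 ≤ n * m * Y := sq_integral_laplacian_le hw2 hc
  have hzsq : k₁ * z ^ 2 ≤ k₂ * (n * m * X) := by
    have h1 := sq_integral_grad_le hT hb hTe hV hVe hV0 hTconv hLi' hw1 hc
    have h3 : k₁ * z ^ 2 ≤ k₁ * ((k₂ * n * m) * ∫ x, ∑ i, pd i w x ^ 2 ∂ν) := by
      refine mul_le_mul_of_nonneg_left (h1.trans (mul_le_mul_of_nonneg_right hL ?_)) hk.le
      exact integral_nonneg fun x => Finset.sum_nonneg fun _ _ => sq_nonneg _
    calc k₁ * z ^ 2 ≤ _ := h3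
      _ = _ := by rw [hX]; ring
  have hesq : N * r * e ^ 2 ≤ (n + C) * m * D := by
    have h1 := sq_integral_sum_mul_le hα0 hαi (fun j => (hαd j).1) fun j => (hαd j).2
    have h3 := integral_pen₁_le hk.le hN.le hV hVe hconv hh hC hαi
    have h4 : N * ∫ x, ∑ j, α j x * (h' j - dirD (a j) w x) ^ 2 ∂ν ≤ D := by
      rw [← integral_const_mul]
      refine integral_mono ((integrable_finsetSum _ fun j _ => (hαd j).2).const_mul _) hDi
        fun x => ?_
      simp only [Finset.mul_sum, ← mul_assoc]
      exact Finset.sum_le_sum fun j _ => mul_le_mul_of_nonneg_right (hαβ j x) (sq_nonneg _)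
    set A := ∫ x, ∑ j, α j x ∂ν
    set B := ∫ x, ∑ j, α j x * (h' j - dirD (a j) w x) ^ 2 ∂ν
    have hA0 : 0 ≤ A := integral_nonneg fun x => Finset.sum_nonneg fun j _ => hα0 j x
    calc N * r * e ^ 2 ≤ N * r * (A * B) := by
          rw [he, neg_sq]
          exact mul_le_mul_of_nonneg_left h1 (by positivity)
      _ = (r * A) * (N * B) := by ring
      _ ≤ (r * A) * D := by gcongr
      _ ≤ _ := mul_le_mul_of_nonneg_right h3 hD0
  have hfinal := P.final (I := -I) hmpos hX0 hXY hD0 (by rw [neg_neg, hIe]; ring) hysq hzsq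
    (e := -e) (by rwa [neg_sq]) hE
  rw [neg_sq] at hfinal
  rw [hfsq] at hvar
  have e1 : (1 - q / n) * I ^ 2 / m = I ^ 2 / m - q / (n * m) * I ^ 2 := by field_simp
  rw [e1]
  linarith

end Local

section Family

variable {n : ℕ} {ι : Type*} [Fintype ι] {a : ι → Euc n} {h h' h'' : ι → ℝ}
  {r k c N B K α : ℝ} {V : Euc n → ℝ} {P P' Φ : ℝ → Euc n → ℝ}

lemma abs_mul_exp_le {y u K α c k s : ℝ} (h1 : |y| ≤ K * Real.exp (α * s))
    (h2 : c + k * s ^ 2 / 2 ≤ u) :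
    |y * Real.exp (-u)| ≤ K * Real.exp (-c) * Real.exp (α * s - k * s ^ 2 / 2) := by
  rw [abs_mul, Real.abs_exp]
  calc _ ≤ (K * Real.exp (α * s)) * Real.exp (-(c + k * s ^ 2 / 2)) := by
        gcongr
        exact (abs_nonneg y).trans h1
    _ = _ := by rw [mul_assoc, mul_assoc, ← Real.exp_add, ← Real.exp_add]; congr 2; ring

lemma hasDerivAt_integral_mul_exp (hk : 0 < k) (hP : ∀ t, Continuous (P t))
    (hP' : ∀ t, Continuous (P' t)) (hΦ : ∀ t, Continuous (Φ t))
    (hq : ∀ t x, c + k * ‖x‖ ^ 2 / 2 ≤ Φ t x) {s : Set ℝ} (hs : IsOpen s)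
    (hb : ∀ t ∈ s, ∀ x, |P t x| ≤ K * Real.exp (α * ‖x‖))
    (hb' : ∀ t ∈ s, ∀ x, |P' t x| ≤ K * Real.exp (α * ‖x‖))
    (hd : ∀ t ∈ s, ∀ x, HasDerivAt (fun t => P t x * Real.exp (-Φ t x))
      (P' t x * Real.exp (-Φ t x)) t) {t : ℝ} (ht : t ∈ s) :
    HasDerivAt (fun t => ∫ x, P t x * Real.exp (-Φ t x))
      (∫ x, P' t x * Real.exp (-Φ t x)) t := by
  have hi : Integrable fun x : Euc n =>
      K * Real.exp (-c) * Real.exp (α * ‖x‖ - k * ‖x‖ ^ 2 / 2) :=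
    (integrable_exp_sub_sq hk α).const_mul _
  have hc (t : ℝ) : Continuous fun x => P t x * Real.exp (-Φ t x) :=
    (hP t).mul (Real.continuous_exp.comp (hΦ t).neg)
  refine (hasDerivAt_integral_of_dominated_loc_of_deriv_le (hs.mem_nhds ht)
    (Filter.Eventually.of_forall fun t => (hc t).aestronglyMeasurable) ?_
    ((hP' t).mul (Real.continuous_exp.comp (hΦ t).neg)).aestronglyMeasurable
    (Filter.Eventually.of_forall fun x t ht => abs_mul_exp_le (hb' t ht x) (hq t x)) hi
    (Filter.Eventually.of_forall fun x t ht => hd t ht x)).2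
  exact hi.mono' (hc t).aestronglyMeasurable
    (Filter.Eventually.of_forall fun x => abs_mul_exp_le (hb t ht x) (hq t x))

lemma abs_sum_pen₁_le (hN : 0 ≤ N) (ha : ∀ j, ‖a j‖ = 1) (hh : ∀ j, 0 ≤ h j)
    (hB : ∀ j, |h' j| ≤ B) (x : Euc n) :
    |∑ j, pen₁ N (⟪x, a j⟫ - h j) * h' j| ≤
      Fintype.card ι * (6 * (1 + N) ^ 2 * B) * Real.exp ((N + 1) * ‖x‖) := by
  refine (Finset.abs_sum_le_sum_abs _ _).trans ?_
  rw [mul_assoc, ← nsmul_eq_mul, ← Finset.card_univ]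
  refine Finset.sum_le_card_nsmul _ _ _ fun j _ => ?_
  rw [abs_mul]
  calc _ ≤ (6 * (1 + N) ^ 2 * Real.exp ((N + 1) * ‖x‖)) * B :=
        mul_le_mul (abs_pen_inner_le hN (ha j) (hh j) x).1 (hB j) (abs_nonneg _) (by positivity)
    _ = _ := by ring

lemma abs_sum_pen₂_le (hN : 0 ≤ N) (ha : ∀ j, ‖a j‖ = 1) (hh : ∀ j, 0 ≤ h j)
    (hB : ∀ j, |h' j| ≤ B) (x : Euc n) :
    |∑ j, pen₂ N (⟪x, a j⟫ - h j) * h' j| ≤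
      Fintype.card ι * (6 * (1 + N) ^ 2 * B) * Real.exp ((N + 1) * ‖x‖) := by
  refine (Finset.abs_sum_le_sum_abs _ _).trans ?_
  rw [mul_assoc, ← nsmul_eq_mul, ← Finset.card_univ]
  refine Finset.sum_le_card_nsmul _ _ _ fun j _ => ?_
  rw [abs_mul]
  calc _ ≤ (6 * (1 + N) ^ 2 * Real.exp ((N + 1) * ‖x‖)) * B :=
        mul_le_mul (abs_pen_inner_le hN (ha j) (hh j) x).2 (hB j) (abs_nonneg _) (by positivity)
    _ = _ := by ring

/-- The logarithmic derivative of `exp (-tilt V N a h)` along a moving `h`. -/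
def score (N : ℝ) (a : ι → Euc n) (h h' : ι → ℝ) (x : Euc n) : ℝ :=
  ∑ j, pen₁ N (⟪x, a j⟫ - h j) * h' j

/-- The second derivative of `exp (-tilt V N a h)`, divided by it, when `h` varies with velocity
`h'` and acceleration `h''`. -/
def score₂ (N : ℝ) (a : ι → Euc n) (h h' h'' : ι → ℝ) (x : Euc n) : ℝ :=
  (∑ j, pen₁ N (⟪x, a j⟫ - h j) * h' j) ^ 2 -
    ∑ j, (pen₂ N (⟪x, a j⟫ - h j) * h' j ^ 2 - pen₁ N (⟪x, a j⟫ - h j) * h'' j)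

lemma continuous_score : Continuous (score N a h h') :=
  continuous_finsetSum _ fun _ _ => (continuous_pen₁_inner _ _).mul continuous_const

lemma continuous_score₂ : Continuous (score₂ N a h h' h'') :=
  (continuous_score.pow 2).sub (continuous_finsetSum _ fun _ _ =>
    ((continuous_pen₂_inner _ _).mul continuous_const).sub
      ((continuous_pen₁_inner _ _).mul continuous_const))

lemma abs_score₂_le (hN : 0 ≤ N) (ha : ∀ j, ‖a j‖ = 1) (hh : ∀ j, 0 ≤ h j)
    (hB : ∀ j, |h' j| ≤ B) (hB' : ∀ j, |h'' j| ≤ B) (x : Euc n) :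
    |score₂ N a h h' h'' x| ≤ ((Fintype.card ι * (6 * (1 + N) ^ 2 * B)) ^ 2 +
      (Fintype.card ι * (6 * (1 + N) ^ 2 * B ^ 2) + Fintype.card ι * (6 * (1 + N) ^ 2 * |B|))) *
        Real.exp (2 * (N + 1) * ‖x‖) := by
  have h1 := abs_sum_pen₁_le hN ha hh hB x
  have h2 := abs_sum_pen₁_le hN ha hh (fun j => (hB' j).trans (le_abs_self B)) x
  have h3 := abs_sum_pen₂_le (h' := fun j => h' j ^ 2) (B := B ^ 2) hN ha hh (fun j => by
    rw [abs_pow]; exact pow_le_pow_left₀ (abs_nonneg _) (hB j) 2) x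
  set E := Real.exp ((N + 1) * ‖x‖) with hE
  have hE1 : 1 ≤ E := Real.one_le_exp (by positivity)
  have hE2 : Real.exp (2 * (N + 1) * ‖x‖) = E ^ 2 := by
    rw [hE, ← Real.exp_nat_mul]; congr 1; push_cast; ring
  have hEE : E ≤ E ^ 2 := by nlinarith
  rw [score₂, Finset.sum_sub_distrib, hE2]
  set S := ∑ j, pen₁ N (⟪x, a j⟫ - h j) * h' j
  have h4 : |S ^ 2| ≤ (Fintype.card ι * (6 * (1 + N) ^ 2 * B)) ^ 2 * E ^ 2 := by
    rw [abs_pow, ← mul_pow]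
    exact pow_le_pow_left₀ (abs_nonneg _) h1 2
  have h5 : Fintype.card ι * (6 * (1 + N) ^ 2 * B ^ 2) * E ≤
    Fintype.card ι * (6 * (1 + N) ^ 2 * B ^ 2) * E ^ 2 := by gcongr
  have h6 : Fintype.card ι * (6 * (1 + N) ^ 2 * |B|) * E ≤
    Fintype.card ι * (6 * (1 + N) ^ 2 * |B|) * E ^ 2 := by gcongr
  have h7 := abs_le.mp h2
  have h8 := abs_le.mp h3
  have h9 := abs_le.mp h4
  refine abs_le.mpr ⟨?_, ?_⟩ <;> linarith [h7.1, h7.2, h8.1, h8.2, h9.1, h9.2]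

lemma hasDerivAt_exp_neg_tilt {H : ι → ℝ → ℝ} {t : ℝ}
    (hd : ∀ j, HasDerivAt (H j) (h' j) t) (x : Euc n) :
    HasDerivAt (fun t => Real.exp (-tilt V N a (fun j => H j t) x))
      (score N a (fun j => H j t) h' x * Real.exp (-tilt V N a (fun j => H j t) x)) t := by
  have h1 : HasDerivAt (fun t => tilt V N a (fun j => H j t) x)
      (∑ j, pen₁ N (⟪x, a j⟫ - H j t) * -h' j) t :=
    (HasDerivAt.fun_sum fun j _ => (hasDerivAt_pen N _).comp t ((hd j).const_sub _)).const_add _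
  convert h1.fun_neg.exp using 1
  simp [score, mul_comm]

lemma hasDerivAt_score_mul_exp {H H' : ι → ℝ → ℝ} {t : ℝ}
    (hd : ∀ j, HasDerivAt (H j) (H' j t) t) (hd' : ∀ j, HasDerivAt (H' j) (h'' j) t) (x : Euc n) :
    HasDerivAt (fun t => score N a (fun j => H j t) (fun j => H' j t) x *
        Real.exp (-tilt V N a (fun j => H j t) x))
      (score₂ N a (fun j => H j t) (fun j => H' j t) h'' x *
        Real.exp (-tilt V N a (fun j => H j t) x)) t := by
  have h1 : HasDerivAt (fun t => score N a (fun j => H j t) (fun j => H' j t) x)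
      (∑ j, (pen₂ N (⟪x, a j⟫ - H j t) * -H' j t * H' j t +
        pen₁ N (⟪x, a j⟫ - H j t) * h'' j)) t :=
    HasDerivAt.fun_sum fun j _ =>
      ((hasDerivAt_pen₁ N _).comp t ((hd j).const_sub _)).mul (hd' j)
  refine (h1.fun_mul (hasDerivAt_exp_neg_tilt hd x)).congr_deriv ?_
  rw [score₂, ← mul_assoc, ← add_mul, score]
  congr 1
  rw [sq, sub_eq_add_neg, add_comm, ← Finset.sum_neg_distrib]
  congr 1
  exact Finset.sum_congr rfl fun j _ => by ring

/-- The mass of the tilted measure. -/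
def mass (V : Euc n → ℝ) (N : ℝ) (a : ι → Euc n) (h : ι → ℝ) : ℝ :=
  ∫ x, Real.exp (-tilt V N a h x)

lemma mass_eq (hV : ContDiff ℝ 2 V) :
    mass V N a h = (gibbs (tilt V N a h)).real Set.univ := by
  have := integral_gibbs (contDiff_tilt (a := a) (h := h) (N := N) hV).continuous fun _ => 1
  simpa [mass] using this.symm

lemma integrable_exp_neg_tilt (hk : 0 < k) (hV : ContDiff ℝ 2 V)
    (hq : ∀ x, c + k * ‖x‖ ^ 2 / 2 ≤ V x) :
    Integrable fun x => Real.exp (-tilt V N a h x) := by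
  have hT := (contDiff_tilt (a := a) (h := h) (N := N) hV).continuous
  have := integrable_gibbs_of_exp_bound hk hT (quadratic_le_tilt hq)
    (f := fun _ => 1) (C := 1) (α := 0) continuous_const (by simp)
  rw [integrable_gibbs_iff hT] at this
  simpa using this

lemma mass_pos (hk : 0 < k) (hV : ContDiff ℝ 2 V)
    (hq : ∀ x, c + k * ‖x‖ ^ 2 / 2 ≤ V x) : 0 < mass V N a h :=
  integral_exp_pos (integrable_exp_neg_tilt hk hV hq)

lemma continuousOn_mass (hk : 0 < k) (hV : ContDiff ℝ 2 V)
    (hq : ∀ x, c + k * ‖x‖ ^ 2 / 2 ≤ V x) {H : ι → ℝ → ℝ} {s : Set ℝ}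
    (hH : ∀ j, ContinuousOn (H j) s) :
    ContinuousOn (fun t => mass V N a fun j => H j t) s := by
  refine continuousOn_of_dominated (bound := fun x => Real.exp (-c - k * ‖x‖ ^ 2 / 2))
    (fun t _ => (Real.continuous_exp.comp (contDiff_tilt hV).continuous.neg).aestronglyMeasurable)
    (fun t _ => Filter.Eventually.of_forall fun x => ?_) ?_
    (Filter.Eventually.of_forall fun x => ?_)
  · rw [Real.norm_eq_abs, Real.abs_exp]
    exact Real.exp_le_exp.mpr (by
      have := quadratic_le_tilt (a := a) (h := fun j => H j t) (N := N) hq x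
      linarith)
  · have := (integrable_exp_sub_sq (n := n) hk 0).const_mul (Real.exp (-c))
    refine this.congr (Filter.Eventually.of_forall fun x => ?_)
    simp only [← Real.exp_add]
    congr 1; ring
  · refine Real.continuous_exp.comp_continuousOn (ContinuousOn.neg (continuousOn_const.add ?_))
    refine continuousOn_finsetSum _ fun j _ => ?_
    exact ((contDiff_pen N).continuous.comp_continuousOn (continuousOn_const.sub (hH j)))

lemma concaveOn_mass_rpow {k₁ k₂ p q C ε θ : ℝ} (hθ : θ = q / n) (Pm : Params n r k₁ k₂ p q C ε N)
    (hC : ∀ R x, |∑ i, x i * pd i (cutoff n R) x| ≤ C)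
    (hV : ContDiff ℝ 2 V) (hVe : ∀ x, V (-x) = V x)
    (hconv : ∀ x v, k₁ * (∑ i, v i ^ 2) ≤ hess V x v)
    (hlap : ∀ M : Set (Euc n), IsConvexBody M → M = -M → Metric.closedBall (0 : Euc n) r ⊆ M →
      ∫ x in M, ∑ i, pd i (pd i V) x ∂gibbs V ≤ k₂ * n * (gibbs V M).toReal)
    (σ : Equiv.Perm ι) (hσa : ∀ j, a (σ j) = - a j) (ha : ∀ j, ‖a j‖ = 1)
    {H H' H'' : ι → ℝ → ℝ} (hσH : ∀ j, H (σ j) = H j) (hσH' : ∀ j, H' (σ j) = H' j)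
    (hH : ∀ j, ∀ t ∈ Set.Icc (0 : ℝ) 1, r ≤ H j t)
    (hd : ∀ j, ∀ t ∈ Set.Icc (0 : ℝ) 1, HasDerivAt (H j) (H' j t) t)
    (hd' : ∀ j, ∀ t ∈ Set.Icc (0 : ℝ) 1, HasDerivAt (H' j) (H'' j t) t)
    (hB' : ∀ j, ∀ t ∈ Set.Icc (0 : ℝ) 1, |H' j t| ≤ B)
    (hB'' : ∀ j, ∀ t ∈ Set.Icc (0 : ℝ) 1, |H'' j t| ≤ B)
    (h2 : ∀ j, ∀ t ∈ Set.Icc (0 : ℝ) 1, H'' j t * H j t ≤ (1 - p) * H' j t ^ 2) :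
    ConcaveOn ℝ (Set.Icc 0 1) fun t => mass V N a (fun j => H j t) ^ θ := by
  have hk := Pm.k₁_pos
  have hN := Pm.N_pos.le
  have hq (x : Euc n) := quadratic_le hV hVe hconv x
  have hh0 {t : ℝ} (ht : t ∈ Set.Ioo (0 : ℝ) 1) (j : ι) : 0 ≤ H j t :=
    Pm.r_pos.le.trans (hH j t (Set.Ioo_subset_Icc_self ht))
  set F : ℝ → ℝ := fun t => mass V N a fun j => H j t with hF
  set F₁ : ℝ → ℝ := fun t => ∫ x, score N a (fun j => H j t) (fun j => H' j t) x *
    Real.exp (-tilt V N a (fun j => H j t) x) with hF₁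
  set F₂ : ℝ → ℝ := fun t => ∫ x, score₂ N a (fun j => H j t) (fun j => H' j t)
    (fun j => H'' j t) x * Real.exp (-tilt V N a (fun j => H j t) x) with hF₂
  have hF0 (t : ℝ) : 0 < F t := mass_pos hk hV hq
  have hTc (t : ℝ) : Continuous (tilt V N a fun j => H j t) := (contDiff_tilt hV).continuous
  have hTq (t : ℝ) (x : Euc n) := quadratic_le_tilt (a := a) (h := fun j => H j t) (N := N) hq x
  have hexp {α β : ℝ} (h : α ≤ β) (x : Euc n) : Real.exp (α * ‖x‖) ≤ Real.exp (β * ‖x‖) :=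
    Real.exp_le_exp.mpr (mul_le_mul_of_nonneg_right h (norm_nonneg x))
  set K₁ := |Fintype.card ι * (6 * (1 + N) ^ 2 * B)| with hK₁
  set K₂ := ((Fintype.card ι * (6 * (1 + N) ^ 2 * B)) ^ 2 +
      (Fintype.card ι * (6 * (1 + N) ^ 2 * B ^ 2) + Fintype.card ι * (6 * (1 + N) ^ 2 * |B|)))
    with hK₂
  have hK₂0 : 0 ≤ K₂ := by positivity
  have hs {t : ℝ} (ht : t ∈ Set.Ioo (0 : ℝ) 1) (x : Euc n) :
      |score N a (fun j => H j t) (fun j => H' j t) x| ≤ K₁ * Real.exp ((N + 1) * ‖x‖) :=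
    (abs_sum_pen₁_le hN ha (hh0 ht)
      (fun j => hB' j t (Set.Ioo_subset_Icc_self ht)) x).trans
      (mul_le_mul_of_nonneg_right (le_abs_self _) (Real.exp_nonneg _))
  have hF' {t : ℝ} (ht : t ∈ Set.Ioo (0 : ℝ) 1) : HasDerivAt F (F₁ t) t := by
    have := hasDerivAt_integral_mul_exp (P := fun _ _ => 1) (K := 1 + K₁) (α := N + 1)
      (P' := fun t => score N a (fun j => H j t) (fun j => H' j t))
      (Φ := fun t => tilt V N a fun j => H j t) hk (fun _ => continuous_const)
      (fun t => continuous_score) hTc hTq (isOpen_Ioo (a := (0 : ℝ)) (b := 1)) (fun t ht x => ?_)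
      (fun t ht x => ?_) (fun t ht x => ?_) ht
    · simp only [one_mul] at this
      exact this
    · have : 1 ≤ Real.exp ((N + 1) * ‖x‖) := Real.one_le_exp (by positivity)
      have : 0 ≤ K₁ := abs_nonneg _
      rw [abs_one]
      nlinarith
    · exact (hs ht x).trans (mul_le_mul_of_nonneg_right (by linarith) (Real.exp_nonneg _))
    · simpa using hasDerivAt_exp_neg_tilt (fun j => hd j t (Set.Ioo_subset_Icc_self ht)) x
  have hF'' {t : ℝ} (ht : t ∈ Set.Ioo (0 : ℝ) 1) : HasDerivAt F₁ (F₂ t) t := by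
    refine hasDerivAt_integral_mul_exp (K := K₁ + K₂) (α := 2 * (N + 1))
      (P' := fun t => score₂ N a (fun j => H j t) (fun j => H' j t) (fun j => H'' j t)) hk
      (fun _ => continuous_score) (fun t => continuous_score₂) hTc hTq
      (isOpen_Ioo (a := (0 : ℝ)) (b := 1)) (fun t ht x => ?_)
      (fun t ht x => ?_) (fun t ht x => ?_) ht
    · exact (hs ht x).trans (mul_le_mul (by linarith) (hexp (by linarith) x)
        (Real.exp_nonneg _) (add_nonneg (abs_nonneg _) hK₂0))
    · exact (abs_score₂_le hN ha (hh0 ht) (fun j => hB' j t (Set.Ioo_subset_Icc_self ht))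
        (fun j => hB'' j t (Set.Ioo_subset_Icc_self ht)) x).trans
        (mul_le_mul_of_nonneg_right (le_add_of_nonneg_left (abs_nonneg _)) (Real.exp_nonneg _))
    · exact hasDerivAt_score_mul_exp (fun j => hd j t (Set.Ioo_subset_Icc_self ht))
        (fun j => hd' j t (Set.Ioo_subset_Icc_self ht)) x
  have hmain {t : ℝ} (ht : t ∈ Set.Ioo (0 : ℝ) 1) : F t * F₂ t ≤ (1 - θ) * F₁ t ^ 2 := by
    have ht' := Set.Ioo_subset_Icc_self ht
    have := local_ineq Pm hC hV hVe hconv hlap σ hσa (fun j => by rw [hσH])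
      (fun j => by rw [hσH']) ha (fun j => hH j t ht') (fun j => h2 j t ht')
      (h' := fun j => H' j t)
    rw [← mass_eq hV, integral_gibbs (hTc t), integral_gibbs (hTc t), ← hθ] at this
    exact this
  have hθ0 : 0 ≤ θ := hθ ▸ div_nonneg Pm.q_nonneg (Nat.cast_nonneg n)
  rw [← interior_Icc] at hF' hF'' hmain
  refine concaveOn_of_hasDerivWithinAt2_nonpos (convex_Icc 0 1)
    (f' := fun t => F₁ t * θ * F t ^ (θ - 1))
    (f'' := fun t => F₂ t * θ * F t ^ (θ - 1) +
      F₁ t * θ * (F₁ t * (θ - 1) * F t ^ (θ - 1 - 1))) ?_ ?_ ?_ ?_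
  · exact (continuousOn_mass hk hV hq fun j t ht =>
      (hd j t ht).continuousAt.continuousWithinAt).rpow_const fun t _ => Or.inl (hF0 t).ne'
  · exact fun t ht => ((hF' ht).rpow_const (Or.inl (hF0 t).ne')).hasDerivWithinAt
  · exact fun t ht => (((hF'' ht).mul_const θ).mul
      ((hF' ht).rpow_const (Or.inl (hF0 t).ne'))).hasDerivWithinAt
  · intro t ht
    have e : F t ^ (θ - 1) = F t * F t ^ (θ - 1 - 1) := by
      rw [Real.rpow_sub_one (hF0 t).ne' (θ - 1)]
      field_simp [(hF0 t).ne']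
    rw [e]
    have h3 : 0 ≤ F t ^ (θ - 1 - 1) := Real.rpow_nonneg (hF0 t).le _
    have h4 : 0 ≤ θ * F t ^ (θ - 1 - 1) * ((1 - θ) * F₁ t ^ 2 - F t * F₂ t) :=
      mul_nonneg (mul_nonneg hθ0 h3) (sub_nonneg.mpr (hmain ht))
    linarith

end Family

section PowerMean

variable {p A B r t : ℝ}

/-- The `p`-mean of `A` and `B` with weights `t` and `1 - t`. -/
def pMean (p A B t : ℝ) : ℝ := (t * A ^ p + (1 - t) * B ^ p) ^ (1 / p)

lemma rpow_le_combo (hp : 0 < p) (hr : 0 < r) (hA : r ≤ A) (hB : r ≤ B)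
    (ht : t ∈ Set.Icc (0 : ℝ) 1) : r ^ p ≤ t * A ^ p + (1 - t) * B ^ p := by
  have h1 : r ^ p ≤ A ^ p := Real.rpow_le_rpow hr.le hA hp.le
  have h2 : r ^ p ≤ B ^ p := Real.rpow_le_rpow hr.le hB hp.le
  nlinarith [mul_le_mul_of_nonneg_left h1 ht.1, mul_le_mul_of_nonneg_left h2 (sub_nonneg.mpr ht.2)]

lemma le_pMean (hp : 0 < p) (hr : 0 < r) (hA : r ≤ A) (hB : r ≤ B)
    (ht : t ∈ Set.Icc (0 : ℝ) 1) : r ≤ pMean p A B t := by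
  have h1 := rpow_le_combo hp hr hA hB ht
  calc r = (r ^ p) ^ (1 / p) := by
        rw [← Real.rpow_mul hr.le, mul_one_div_cancel hp.ne', Real.rpow_one]
    _ ≤ _ := Real.rpow_le_rpow (by positivity) h1 (by positivity)

/-- The derivative of the `p`-mean in the weight. -/
def pMean₁ (p A B t : ℝ) : ℝ :=
  (A ^ p - B ^ p) * (1 / p) * (t * A ^ p + (1 - t) * B ^ p) ^ (1 / p - 1)

/-- The second derivative of the `p`-mean in the weight. -/
def pMean₂ (p A B t : ℝ) : ℝ :=
  (A ^ p - B ^ p) * (1 / p) *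
    ((A ^ p - B ^ p) * (1 / p - 1) * (t * A ^ p + (1 - t) * B ^ p) ^ (1 / p - 1 - 1))

lemma hasDerivAt_combo (u v t : ℝ) : HasDerivAt (fun t => t * u + (1 - t) * v) (u - v) t := by
  have := ((hasDerivAt_id t).mul_const u).fun_add (((hasDerivAt_id t).const_sub 1).mul_const v)
  exact this.congr_deriv (by ring)

lemma combo_pos (hp : 0 < p) (hr : 0 < r) (hA : r ≤ A) (hB : r ≤ B)
    (ht : t ∈ Set.Icc (0 : ℝ) 1) : 0 < t * A ^ p + (1 - t) * B ^ p :=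
  (Real.rpow_pos_of_pos hr p).trans_le (rpow_le_combo hp hr hA hB ht)

lemma hasDerivAt_pMean (hp : 0 < p) (hr : 0 < r) (hA : r ≤ A) (hB : r ≤ B)
    (ht : t ∈ Set.Icc (0 : ℝ) 1) : HasDerivAt (pMean p A B) (pMean₁ p A B t) t :=
  (hasDerivAt_combo _ _ t).rpow_const (Or.inl (combo_pos hp hr hA hB ht).ne')

lemma hasDerivAt_pMean₁ (hp : 0 < p) (hr : 0 < r) (hA : r ≤ A) (hB : r ≤ B)
    (ht : t ∈ Set.Icc (0 : ℝ) 1) : HasDerivAt (pMean₁ p A B) (pMean₂ p A B t) t :=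
  ((hasDerivAt_combo _ _ t).rpow_const (Or.inl (combo_pos hp hr hA hB ht).ne')).const_mul _

lemma pMean₂_mul_pMean (hp : 0 < p) (hr : 0 < r) (hA : r ≤ A) (hB : r ≤ B)
    (ht : t ∈ Set.Icc (0 : ℝ) 1) :
    pMean₂ p A B t * pMean p A B t = (1 - p) * pMean₁ p A B t ^ 2 := by
  have h0 := combo_pos hp hr hA hB ht
  unfold pMean pMean₁ pMean₂
  set g := t * A ^ p + (1 - t) * B ^ p
  have e : g ^ (1 / p - 1 - 1) * g ^ (1 / p) = (g ^ (1 / p - 1)) ^ 2 := by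
    rw [← Real.rpow_add h0, ← Real.rpow_mul_natCast h0.le]
    congr 1; push_cast; ring
  have e2 : 1 / p - 1 = (1 - p) * (1 / p) := by field_simp
  calc _ = (A ^ p - B ^ p) ^ 2 * (1 / p) * (1 / p - 1) *
        (g ^ (1 / p - 1 - 1) * g ^ (1 / p)) := by ring
    _ = (A ^ p - B ^ p) ^ 2 * (1 / p) * ((1 - p) * (1 / p)) * (g ^ (1 / p - 1)) ^ 2 := by
        rw [e, e2]
    _ = _ := by ring

lemma exists_bound_pMean (hp : 0 < p) (hr : 0 < r) (hA : r ≤ A) (hB : r ≤ B) :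
    ∃ c, ∀ t ∈ Set.Icc (0 : ℝ) 1, |pMean₁ p A B t| ≤ c ∧ |pMean₂ p A B t| ≤ c := by
  have hg {t : ℝ} (ht : t ∈ Set.Icc (0 : ℝ) 1) (s : ℝ) :
      ContinuousWithinAt (fun t => (t * A ^ p + (1 - t) * B ^ p) ^ s) (Set.Icc 0 1) t :=
    ((hasDerivAt_combo _ _ t).rpow_const
      (Or.inl (combo_pos hp hr hA hB ht).ne')).continuousAt.continuousWithinAt
  obtain ⟨c₁, h₁⟩ := (isCompact_Icc (a := (0 : ℝ)) (b := 1)).exists_bound_of_continuousOn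
    (f := pMean₁ p A B) fun t ht => continuousWithinAt_const.mul (hg ht _)
  obtain ⟨c₂, h₂⟩ := (isCompact_Icc (a := (0 : ℝ)) (b := 1)).exists_bound_of_continuousOn
    (f := pMean₂ p A B) fun t ht =>
      continuousWithinAt_const.mul (continuousWithinAt_const.mul (hg ht _))
  exact ⟨max c₁ c₂, fun t ht => ⟨(h₁ t ht).trans (le_max_left _ _),
    (h₂ t ht).trans (le_max_right _ _)⟩⟩

lemma pMean_zero (hp : p ≠ 0) (hB : 0 ≤ B) : pMean p A B 0 = B := by
  simp [pMean, ← Real.rpow_mul hB, hp]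

lemma pMean_one (hp : p ≠ 0) (hA : 0 ≤ A) : pMean p A B 1 = A := by
  simp [pMean, ← Real.rpow_mul hA, hp]

variable {n : ℕ} {ι : Type*} [Fintype ι] {a : ι → Euc n} {V : Euc n → ℝ} {N : ℝ}

lemma mass_pMean_ge {k₁ k₂ q C ε lam : ℝ} (hp : 0 < p) (Pm : Params n r k₁ k₂ p q C ε N)
    (hC : ∀ R x, |∑ i, x i * pd i (cutoff n R) x| ≤ C)
    (hV : ContDiff ℝ 2 V) (hVe : ∀ x, V (-x) = V x)
    (hconv : ∀ x v, k₁ * (∑ i, v i ^ 2) ≤ hess V x v)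
    (hlap : ∀ M : Set (Euc n), IsConvexBody M → M = -M → Metric.closedBall (0 : Euc n) r ⊆ M →
      ∫ x in M, ∑ i, pd i (pd i V) x ∂gibbs V ≤ k₂ * n * (gibbs V M).toReal)
    (σ : Equiv.Perm ι) (hσa : ∀ j, a (σ j) = - a j) (ha : ∀ j, ‖a j‖ = 1)
    {A B : ι → ℝ} (hσA : ∀ j, A (σ j) = A j) (hσB : ∀ j, B (σ j) = B j)
    (hA : ∀ j, r ≤ A j) (hB : ∀ j, r ≤ B j) (hl : lam ∈ Set.Icc (0 : ℝ) 1) :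
    lam * mass V N a A ^ (q / n) + (1 - lam) * mass V N a B ^ (q / n) ≤
      mass V N a (fun j => pMean p (A j) (B j) lam) ^ (q / n) := by
  have hr := Pm.r_pos
  choose c hc using fun j => exists_bound_pMean hp hr (hA j) (hB j)
  have hcb (j : ι) : c j ≤ ∑ i, |c i| := (le_abs_self _).trans
    (Finset.single_le_sum (f := fun i => |c i|) (fun i _ => abs_nonneg _) (Finset.mem_univ j))
  have := (concaveOn_mass_rpow rfl Pm hC hV hVe hconv hlap σ hσa ha
    (H := fun j => pMean p (A j) (B j)) (H' := fun j => pMean₁ p (A j) (B j))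
    (H'' := fun j => pMean₂ p (A j) (B j)) (B := ∑ i, |c i|) (fun j => by simp only [hσA, hσB])
    (fun j => by simp only [hσA, hσB]) (fun j t ht => le_pMean hp hr (hA j) (hB j) ht)
    (fun j t ht => hasDerivAt_pMean hp hr (hA j) (hB j) ht)
    (fun j t ht => hasDerivAt_pMean₁ hp hr (hA j) (hB j) ht)
    (fun j t ht => (hc j t ht).1.trans (hcb j)) (fun j t ht => (hc j t ht).2.trans (hcb j))
    (fun j t ht => (pMean₂_mul_pMean hp hr (hA j) (hB j) ht).le)).2
    (Set.right_mem_Icc.mpr zero_le_one) (Set.left_mem_Icc.mpr zero_le_one) hl.1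
    (sub_nonneg.mpr hl.2) (by ring)
  simpa [pMean_one hp.ne' (hr.le.trans (hA _)), pMean_zero hp.ne' (hr.le.trans (hB _))] using this

end PowerMean

section Support

variable {n : ℕ} {K L : Set (Euc n)} {u x : Euc n} {r : ℝ}

lemma suppFn_neg (h : K = -K) (u : Euc n) : suppFn K (-u) = suppFn K u := by
  unfold suppFn
  congr 1
  conv_lhs => rw [h]
  ext s
  simp only [Set.mem_image, Set.mem_neg]
  constructor
  · rintro ⟨y, hy, rfl⟩
    exact ⟨-y, hy, by simp⟩
  · rintro ⟨y, hy, rfl⟩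
    exact ⟨-y, by simpa using hy, by simp⟩

lemma inner_le_suppFn (hK : IsCompact K) (hx : x ∈ K) (u : Euc n) : ⟪x, u⟫ ≤ suppFn K u := by
  rw [real_inner_comm]
  exact le_csSup (hK.image (by fun_prop)).bddAbove (Set.mem_image_of_mem _ hx)

lemma le_suppFn (hr : 0 < r) (hK : IsCompact K) (hrK : Metric.closedBall (0 : Euc n) r ⊆ K)
    (hu : ‖u‖ = 1) : r ≤ suppFn K u := by
  have h1 : r • u ∈ K := hrK (by simp [norm_smul, hu, abs_of_pos hr])
  have h2 := inner_le_suppFn hK h1 u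
  rwa [inner_smul_left, real_inner_self_eq_norm_sq, hu, one_pow, mul_one] at h2

/-- The `p`-mean, completed by the geometric mean at `p = 0`. -/
def combMean (p lam A B : ℝ) : ℝ := if p = 0 then A ^ lam * B ^ (1 - lam) else pMean p A B lam

lemma mem_lpComb {p lam : ℝ} : x ∈ lpComb p lam K L ↔
    ∀ u : Euc n, ‖u‖ = 1 → ⟪x, u⟫ ≤ combMean p lam (suppFn K u) (suppFn L u) := by
  unfold lpComb combMean pMean
  split_ifs <;> rfl

lemma isClosed_lpComb (p lam : ℝ) (K L : Set (Euc n)) : IsClosed (lpComb p lam K L) := by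
  have : lpComb p lam K L = ⋂ u : Euc n, ⋂ _ : ‖u‖ = 1,
      {x | ⟪x, u⟫ ≤ combMean p lam (suppFn K u) (suppFn L u)} := by
    ext x
    simp [mem_lpComb]
  rw [this]
  exact isClosed_iInter fun u => isClosed_iInter fun _ =>
    isClosed_le (by fun_prop) continuous_const

lemma exists_seq_separating_lpComb (hn : 1 ≤ n) (p lam : ℝ) (K L : Set (Euc n)) :
    ∃ u : ℕ → Euc n, (∀ i, ‖u i‖ = 1) ∧ ∀ x ∉ lpComb p lam K L,
      ∃ i, combMean p lam (suppFn K (u i)) (suppFn L (u i)) < ⟪x, u i⟫ := by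
  let S (u : {u : Euc n // ‖u‖ = 1}) : Set (Euc n) :=
    {x | combMean p lam (suppFn K u) (suppFn L u) < ⟪x, u⟫}
  obtain ⟨T, hT, hTS⟩ := TopologicalSpace.isOpen_iUnion_countable S fun u =>
    isOpen_lt continuous_const (by fun_prop)
  let e : {u : Euc n // ‖u‖ = 1} := ⟨EuclideanSpace.single ⟨0, hn⟩ 1, by simp⟩
  obtain ⟨f, hf⟩ := (hT.insert e).exists_eq_range (Set.insert_nonempty _ _)
  refine ⟨fun i => f i, fun i => (f i).2, fun x hx => ?_⟩
  rw [mem_lpComb] at hx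
  push Not at hx
  obtain ⟨u, hu, hxu⟩ := hx
  have h1 : x ∈ ⋃ i ∈ T, S i := hTS ▸ Set.mem_iUnion.mpr ⟨⟨u, hu⟩, hxu⟩
  obtain ⟨v, hv, hxv⟩ := Set.mem_iUnion₂.mp h1
  have h2 : v ∈ Set.range f := hf ▸ Set.mem_insert_of_mem _ hv
  obtain ⟨i, rfl⟩ := h2
  exact ⟨i, hxv⟩

end Support

section Limits

open Filter Topology

variable {A B lam p : ℝ} {P : ℕ → ℝ}

lemma tendsto_log_combo_div (hA : 0 < A) (hB : 0 < B) :
    Tendsto (fun s : ℝ => Real.log (lam * A ^ s + (1 - lam) * B ^ s) * (1 / s)) (𝓝[≠] 0)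
      (𝓝 (lam * Real.log A + (1 - lam) * Real.log B)) := by
  have h1 : HasDerivAt (fun s : ℝ => lam * A ^ s + (1 - lam) * B ^ s)
      (lam * (A ^ (0 : ℝ) * Real.log A) + (1 - lam) * (B ^ (0 : ℝ) * Real.log B)) 0 :=
    ((Real.hasStrictDerivAt_const_rpow hA 0).hasDerivAt.const_mul lam).fun_add
      ((Real.hasStrictDerivAt_const_rpow hB 0).hasDerivAt.const_mul (1 - lam))
  have h2 := (h1.log (by simp)).tendsto_slope_zero
  simp only [zero_add, Real.rpow_zero, mul_one, one_mul, add_sub_cancel, Real.log_one, sub_zero,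
    div_one, smul_eq_mul] at h2
  refine h2.congr fun s => ?_
  rw [one_div, mul_comm]

lemma tendsto_pMean (hA : 0 < A) (hB : 0 < B) (hl : lam ∈ Set.Icc (0 : ℝ) 1)
    (hP : ∀ k, 0 < P k) (hp : Tendsto P atTop (𝓝 p)) :
    Tendsto (fun k => pMean (P k) A B lam) atTop (𝓝 (combMean p lam A B)) := by
  have hpos (s : ℝ) : 0 < lam * A ^ s + (1 - lam) * B ^ s := by
    have h1 := Real.rpow_pos_of_pos hA s
    have h2 := Real.rpow_pos_of_pos hB s
    rcases hl.1.eq_or_lt with h | h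
    · rw [← h]; simpa using h2
    · have : 0 ≤ 1 - lam := sub_nonneg.mpr hl.2
      positivity
  unfold combMean
  split_ifs with h0
  · subst h0
    have h1 : Tendsto P atTop (𝓝[≠] 0) :=
      tendsto_nhdsWithin_iff.mpr ⟨hp, Eventually.of_forall fun k => (hP k).ne'⟩
    have h2 := (Real.continuous_exp.tendsto _).comp
      ((tendsto_log_combo_div (lam := lam) hA hB).comp h1)
    have e : A ^ lam * B ^ (1 - lam) = Real.exp (lam * Real.log A + (1 - lam) * Real.log B) := by
      rw [Real.exp_add, Real.rpow_def_of_pos hA, Real.rpow_def_of_pos hB, mul_comm lam,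
        mul_comm (1 - lam)]
    rw [e]
    refine h2.congr fun k => ?_
    rw [pMean, Real.rpow_def_of_pos (hpos _)]
    rfl
  · have hc : Tendsto (fun k => lam * A ^ P k + (1 - lam) * B ^ P k) atTop
        (𝓝 (lam * A ^ p + (1 - lam) * B ^ p)) :=
      ((tendsto_const_nhds.rpow hp (Or.inl hA.ne')).const_mul _).add
        ((tendsto_const_nhds.rpow hp (Or.inl hB.ne')).const_mul _)
    exact hc.rpow (tendsto_const_nhds.div hp h0) (Or.inl (hpos p).ne')

lemma le_pen {N δ s : ℝ} (hN : 0 ≤ N) (hδ : 0 ≤ δ) (h : δ ≤ s) : δ ^ 4 * N ≤ pen N s := by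
  have h1 : N * δ ≤ Real.exp (N * s) := by
    have := Real.add_one_le_exp (N * s)
    have := mul_le_mul_of_nonneg_left h hN
    linarith
  have h2 : δ ^ 3 ≤ max s 0 ^ 3 := pow_le_pow_left₀ hδ (h.trans (le_max_left _ _)) 3
  calc δ ^ 4 * N = δ ^ 3 * (N * δ) := by ring
    _ ≤ _ := mul_le_mul h2 h1 (by positivity) (by positivity)

end Limits

section Parameters

open Filter Topology

variable {n : ℕ} {r k₁ k₂ p q C : ℝ}

lemma exists_params (hn : 1 ≤ n) (hr : 0 < r) (hk : 0 < k₁) (hk1 : k₁ ≤ 1) (hk2 : 0 ≤ k₂)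
    (hp : p ≤ 1) (hq : 0 ≤ q) (hC : 0 ≤ C)
    (h : (1 - p) * ((n : ℝ) + 1) / r ^ 2 + q * (1 + k₂) * (1 + k₁) < 2 * k₁) (M : ℝ) :
    ∃ ε N, M ≤ N ∧ Params n r k₁ k₂ p q C ε N := by
  set A := (1 - p) * ((n : ℝ) + 1) / r ^ 2 + q * (1 + k₂) * (1 + k₁) with hA
  set ε := (2 * k₁ - A) / (2 * k₁) with hε
  have hε0 : 0 < ε := div_pos (by linarith) (by linarith)
  set R := (1 + ε⁻¹) * ((1 - p) / r + q * (n + C) / (n * r))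
  refine ⟨ε, max (max M R) 1, (le_max_left _ _).trans (le_max_left _ _),
    ⟨hn, hr, hk, hk1, hk2, hp, hq, hC, hε0, one_pos.trans_le (le_max_right _ _), ?_,
      (le_max_right _ _).trans (le_max_left _ _)⟩⟩
  have h1 : ε * A ≤ ε * (2 * k₁) := mul_le_mul_of_nonneg_left h.le hε0.le
  have h2 : ε * (2 * k₁) = 2 * k₁ - A := by rw [hε]; field_simp
  linarith

lemma exists_params_seq (hn : 1 ≤ n) (hr : 0 < r) (hk : 0 < k₁) (hk1 : k₁ ≤ 1) (hk2 : 0 ≤ k₂)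
    (hp : p ∈ Set.Icc (0 : ℝ) 1) (hq : 0 ≤ q) (hC : 0 ≤ C)
    (h : (1 - p) * ((n : ℝ) + 1) / r ^ 2 + q * (1 + k₂) * (1 + k₁) ≤ 2 * k₁) :
    ∃ P Q E N : ℕ → ℝ, (∀ k, Params n r k₁ k₂ (P k) (Q k) C (E k) (N k)) ∧ (∀ k, 0 < P k) ∧
      (∀ k, 0 < Q k) ∧ (∀ k : ℕ, (k : ℝ) ≤ N k) ∧ Tendsto P atTop (𝓝 p) ∧
      Tendsto Q atTop (𝓝 q) := by
  set c := k₁ / ((1 + k₂) * (1 + k₁)) with hc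
  have hc0 : 0 < c := by positivity
  have hs := tendsto_one_div_add_atTop_nhds_zero_nat (𝕜 := ℝ)
  set P : ℕ → ℝ := fun k => p + (1 - p) * (1 / ((k : ℝ) + 1)) with hP
  set Q : ℕ → ℝ := fun k => q + (c - q) * (1 / ((k : ℝ) + 1)) with hQ
  have hs1 (k : ℕ) : 0 < 1 / ((k : ℝ) + 1) ∧ 1 / ((k : ℝ) + 1) ≤ 1 :=
    ⟨by positivity, by rw [div_le_one (by positivity)]; linarith [Nat.cast_nonneg (α := ℝ) k]⟩
  have hP1 (k : ℕ) : P k ≤ 1 := by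
    have := mul_le_mul_of_nonneg_left (hs1 k).2 (sub_nonneg.mpr hp.2)
    simp only [hP]; linarith
  have hP0 (k : ℕ) : 0 < P k := by
    have e : P k = p * (1 - 1 / ((k : ℝ) + 1)) + 1 / ((k : ℝ) + 1) := by simp only [hP]; ring
    have := mul_nonneg hp.1 (sub_nonneg.mpr (hs1 k).2)
    linarith [(hs1 k).1]
  have hQ0 (k : ℕ) : 0 < Q k := by
    have e : Q k = q * (1 - 1 / ((k : ℝ) + 1)) + c * (1 / ((k : ℝ) + 1)) := by
      simp only [hQ]; ring
    have := mul_nonneg hq (sub_nonneg.mpr (hs1 k).2)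
    linarith [mul_pos hc0 (hs1 k).1]
  have hcond (k : ℕ) :
      (1 - P k) * ((n : ℝ) + 1) / r ^ 2 + Q k * (1 + k₂) * (1 + k₁) < 2 * k₁ := by
    have e : (1 - P k) * ((n : ℝ) + 1) / r ^ 2 + Q k * (1 + k₂) * (1 + k₁) =
        (1 - 1 / ((k : ℝ) + 1)) *
          ((1 - p) * ((n : ℝ) + 1) / r ^ 2 + q * (1 + k₂) * (1 + k₁)) +
          1 / ((k : ℝ) + 1) * (c * ((1 + k₂) * (1 + k₁))) := by
      simp only [hP, hQ]; ring
    have e2 : c * ((1 + k₂) * (1 + k₁)) = k₁ := by rw [hc]; field_simp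
    rw [e, e2]
    have := mul_le_mul_of_nonneg_left h (sub_nonneg.mpr (hs1 k).2)
    have := mul_pos (hs1 k).1 hk
    linarith
  choose E N hN hPar using fun k : ℕ =>
    exists_params hn hr hk hk1 hk2 (hP1 k) (hQ0 k).le hC (hcond k) k
  refine ⟨P, Q, E, N, hPar, hP0, hQ0, hN, ?_, ?_⟩
  · have := (hs.const_mul (1 - p)).const_add p
    simp only [mul_zero, add_zero] at this
    exact this
  · have := (hs.const_mul (c - q)).const_add q
    simp only [mul_zero, add_zero] at this
    exact this

end Parameters

section Mass

open Filter Topology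

variable {n : ℕ} {ι : Type*} [Fintype ι] {a : ι → Euc n} {h : ι → ℝ} {N : ℝ} {V : Euc n → ℝ}
  {S : Set (Euc n)}

lemma mass_eq_integral_gibbs (hV : Continuous V) :
    mass V N a h = ∫ x, Real.exp (-pot N a h x) ∂gibbs V := by
  rw [integral_gibbs hV, mass]
  congr 1
  ext x
  rw [tilt, ← Real.exp_add]
  congr 1; ring

lemma exp_neg_pot_le_one (x : Euc n) : Real.exp (-pot N a h x) ≤ 1 :=
  Real.exp_le_one_iff.mpr (neg_nonpos.mpr (pot_nonneg x))

lemma continuous_exp_neg_pot : Continuous fun x => Real.exp (-pot N a h x) :=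
  Real.continuous_exp.comp contDiff_pot.continuous.neg

lemma integrable_exp_neg_pot {μ : Measure (Euc n)} [IsFiniteMeasure μ] :
    Integrable (fun x => Real.exp (-pot N a h x)) μ :=
  (integrable_const (1 : ℝ)).mono' continuous_exp_neg_pot.aestronglyMeasurable
    (Eventually.of_forall fun x => by
      rw [Real.norm_eq_abs, Real.abs_exp]; exact exp_neg_pot_le_one x)

lemma real_le_mass [IsFiniteMeasure (gibbs V)] (hV : Continuous V) (hS : MeasurableSet S)
    (h0 : ∀ x ∈ S, ∀ j, ⟪x, a j⟫ ≤ h j) : (gibbs V).real S ≤ mass V N a h := by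
  rw [mass_eq_integral_gibbs hV]
  have h1 : ∫ x in S, Real.exp (-pot N a h x) ∂gibbs V = (gibbs V).real S := by
    rw [setIntegral_congr_fun (g := fun _ => 1) hS fun x hx => ?_]
    · simp
    · have : pot N a h x = 0 :=
        Finset.sum_eq_zero fun j _ => pen_of_nonpos N (sub_nonpos.mpr (h0 x hx j))
      simp [this]
  rw [← h1]
  exact setIntegral_le_integral integrable_exp_neg_pot
    (Eventually.of_forall fun x => Real.exp_nonneg _)

lemma mass_le_real_add [IsFiniteMeasure (gibbs V)] (hV : Continuous V) (hS : MeasurableSet S) :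
    mass V N a h ≤ (gibbs V).real S + ∫ x in Sᶜ, Real.exp (-pot N a h x) ∂gibbs V := by
  rw [mass_eq_integral_gibbs hV, ← integral_add_compl hS integrable_exp_neg_pot]
  gcongr
  calc ∫ x in S, Real.exp (-pot N a h x) ∂gibbs V ≤ ∫ _ in S, (1 : ℝ) ∂gibbs V :=
        integral_mono integrable_exp_neg_pot (integrable_const _) fun x => exp_neg_pot_le_one x
    _ = _ := by simp

end Mass

section Family

open Filter Topology

variable {n : ℕ} {u : ℕ → Euc n} {K L : Set (Euc n)}

/-- The first `k` directions of a sequence, with both signs. -/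
def dirs (u : ℕ → Euc n) (k : ℕ) (j : Fin k × Bool) : Euc n := if j.2 then u j.1 else -u j.1

/-- The sign change on the index set of `dirs`. -/
def signFlip (k : ℕ) : Equiv.Perm (Fin k × Bool) := (Equiv.refl _).prodCongr Equiv.boolNot

lemma dirs_signFlip (u : ℕ → Euc n) (k : ℕ) (j : Fin k × Bool) :
    dirs u k (signFlip k j) = -dirs u k j := by
  obtain ⟨i, b⟩ := j
  cases b <;> simp [dirs, signFlip]

lemma norm_dirs (hu : ∀ i, ‖u i‖ = 1) (k : ℕ) (j : Fin k × Bool) : ‖dirs u k j‖ = 1 := by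
  unfold dirs
  split_ifs <;> simp [hu]

lemma tendsto_exp_neg_pot {N : ℕ → ℝ} (hN : ∀ k : ℕ, (k : ℝ) ≤ N k)
    {H : ℕ → Euc n → ℝ} {x : Euc n} {i : ℕ} {c : ℝ} (hc : c < ⟪x, u i⟫)
    (hH : Tendsto (fun k => H k (u i)) atTop (𝓝 c)) :
    Tendsto (fun k => Real.exp (-pot (N k) (dirs u k) (fun j => H k (dirs u k j)) x)) atTop
      (𝓝 0) := by
  obtain ⟨d, hcd, hd⟩ := exists_between hc
  set δ := ⟪x, u i⟫ - d with hδ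
  have hδ0 : 0 < δ := sub_pos.mpr hd
  have h1 : Tendsto (fun k : ℕ => Real.exp (-(δ ^ 4 * (k : ℝ)))) atTop (𝓝 0) :=
    Real.tendsto_exp_neg_atTop_nhds_zero.comp
      (tendsto_natCast_atTop_atTop.const_mul_atTop (by positivity))
  refine squeeze_zero' (Eventually.of_forall fun _ => Real.exp_nonneg _) ?_ h1
  filter_upwards [hH.eventually_le_const hcd, eventually_gt_atTop i] with k hk hik
  refine Real.exp_le_exp.mpr (neg_le_neg ?_)
  calc δ ^ 4 * (k : ℝ) ≤ δ ^ 4 * N k := mul_le_mul_of_nonneg_left (hN k) (by positivity)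
    _ ≤ pen (N k) (⟪x, u i⟫ - H k (u i)) :=
        le_pen ((Nat.cast_nonneg k).trans (hN k)) hδ0.le (by linarith)
    _ ≤ _ := by
        have := Finset.single_le_sum (s := Finset.univ)
          (f := fun j => pen (N k) (⟪x, dirs u k j⟫ - H k (dirs u k j)))
          (fun j _ => pen_nonneg _ _) (Finset.mem_univ (⟨i, hik⟩, true))
        simpa [dirs, pot] using this

end Family

section Main

open Filter Topology

variable {n : ℕ} {r k₁ k₂ p q lam : ℝ} {V : Euc n → ℝ} {K L : Set (Euc n)}

/-- The approximate inequality along a sequence of parameters. -/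
lemma exists_seq_combo_le (hn : 1 ≤ n) (hr : 0 < r) (hk : 0 < k₁) (hk1 : k₁ ≤ 1) (hk2 : 0 ≤ k₂)
    (hp : p ∈ Set.Icc (0 : ℝ) 1) (hq : 0 ≤ q)
    (hcond : (1 - p) * ((n : ℝ) + 1) / r ^ 2 + q * (1 + k₂) * (1 + k₁) ≤ 2 * k₁)
    (hV : ContDiff ℝ 2 V) (hVe : ∀ x, V (-x) = V x)
    (hconv : ∀ x v, k₁ * (∑ i, v i ^ 2) ≤ hess V x v)
    (hlap : ∀ M : Set (Euc n), IsConvexBody M → M = -M → Metric.closedBall (0 : Euc n) r ⊆ M →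
      ∫ x in M, ∑ i, pd i (pd i V) x ∂gibbs V ≤ k₂ * n * (gibbs V M).toReal)
    (hK : IsCompact K) (hL : IsCompact L) (hKs : K = -K) (hLs : L = -L)
    (hrK : Metric.closedBall (0 : Euc n) r ⊆ K) (hrL : Metric.closedBall (0 : Euc n) r ⊆ L)
    (hl : lam ∈ Set.Icc (0 : ℝ) 1) :
    ∃ Q η : ℕ → ℝ, (∀ k, 0 < Q k) ∧ (∀ k, 0 ≤ η k) ∧ Tendsto Q atTop (𝓝 q) ∧
      Tendsto η atTop (𝓝 0) ∧
      ∀ k, lam * (gibbs V).real K ^ (Q k / n) + (1 - lam) * (gibbs V).real L ^ (Q k / n) ≤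
        ((gibbs V).real (lpComb p lam K L) + η k) ^ (Q k / n) := by
  obtain ⟨C, hC0, hC⟩ := exists_euler_cutoff_le n
  obtain ⟨P, Q, E, N, hPar, hP, hQ, hN, hPt, hQt⟩ :=
    exists_params_seq hn hr hk hk1 hk2 hp hq hC0 hcond
  obtain ⟨u, hu, hux⟩ := exists_seq_separating_lpComb hn p lam K L
  have : IsFiniteMeasure (gibbs V) :=
    isFiniteMeasure_gibbs hk hV.continuous (quadratic_le hV hVe hconv)
  have hS := (isClosed_lpComb p lam K L).measurableSet
  have hKr {v : Euc n} (hv : ‖v‖ = 1) : r ≤ suppFn K v := le_suppFn hr hK hrK hv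
  have hLr {v : Euc n} (hv : ‖v‖ = 1) : r ≤ suppFn L v := le_suppFn hr hL hrL hv
  set H : ℕ → Euc n → ℝ := fun k v => pMean (P k) (suppFn K v) (suppFn L v) lam with hH
  set η : ℕ → ℝ := fun k => ∫ x in (lpComb p lam K L)ᶜ,
    Real.exp (-pot (N k) (dirs u k) (fun j => H k (dirs u k j)) x) ∂gibbs V with hη
  refine ⟨Q, η, hQ, fun k => integral_nonneg fun x => Real.exp_nonneg _, hQt, ?_, fun k => ?_⟩
  · have h0 : ∫ x in (lpComb p lam K L)ᶜ, (0 : ℝ) ∂gibbs V = 0 := by simp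
    rw [← h0]
    refine tendsto_integral_of_dominated_convergence (fun _ => 1)
      (fun k => continuous_exp_neg_pot.aestronglyMeasurable) (integrable_const _)
      (fun k => Eventually.of_forall fun x => ?_)
      (ae_restrict_of_forall_mem hS.compl fun x hx => ?_)
    · rw [Real.norm_eq_abs, Real.abs_exp]
      exact exp_neg_pot_le_one x
    · obtain ⟨i, hi⟩ := hux x hx
      exact tendsto_exp_neg_pot hN hi (tendsto_pMean (hr.trans_le (hKr (hu i)))
        (hr.trans_le (hLr (hu i))) hl hP hPt)
  · have hd := norm_dirs hu k
    have h1 := mass_pMean_ge (hP k) (hPar k) hC hV hVe hconv hlap (signFlip k) (dirs_signFlip u k)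
      hd
      (A := fun j => suppFn K (dirs u k j)) (B := fun j => suppFn L (dirs u k j))
      (fun j => by rw [dirs_signFlip, suppFn_neg hKs])
      (fun j => by rw [dirs_signFlip, suppFn_neg hLs])
      (fun j => hKr (hd j)) (fun j => hLr (hd j)) hl
    have hθ : 0 ≤ Q k / n := div_nonneg (hQ k).le (Nat.cast_nonneg n)
    have hKm : (gibbs V).real K ≤ mass V (N k) (dirs u k) fun j => suppFn K (dirs u k j) :=
      real_le_mass hV.continuous hK.measurableSet fun x hx j => inner_le_suppFn hK hx _
    have hLm : (gibbs V).real L ≤ mass V (N k) (dirs u k) fun j => suppFn L (dirs u k j) :=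
      real_le_mass hV.continuous hL.measurableSet fun x hx j => inner_le_suppFn hL hx _
    have h2 := Real.rpow_le_rpow measureReal_nonneg hKm hθ
    have h3 := Real.rpow_le_rpow measureReal_nonneg hLm hθ
    have h4 : mass V (N k) (dirs u k) (fun j => H k (dirs u k j)) ^ (Q k / n) ≤
        ((gibbs V).real (lpComb p lam K L) + η k) ^ (Q k / n) :=
      Real.rpow_le_rpow (integral_nonneg fun x => Real.exp_nonneg _)
        (mass_le_real_add hV.continuous hS) hθ
    refine le_trans ?_ (h1.trans h4)
    exact add_le_add (mul_le_mul_of_nonneg_left h2 hl.1)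
      (mul_le_mul_of_nonneg_left h3 (sub_nonneg.mpr hl.2))

lemma geom_mean_le_of_combo_rpow_le {x y z θ : ℝ} (hx : 0 ≤ x) (hy : 0 ≤ y) (hz : 0 ≤ z)
    (hθ : 0 < θ) (hl : lam ∈ Set.Icc (0 : ℝ) 1)
    (h : lam * x ^ θ + (1 - lam) * y ^ θ ≤ z ^ θ) : x ^ lam * y ^ (1 - lam) ≤ z := by
  have h1 := Real.geom_mean_le_arith_mean2_weighted hl.1 (sub_nonneg.mpr hl.2)
    (Real.rpow_nonneg hx θ) (Real.rpow_nonneg hy θ) (by ring)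
  have e : (x ^ lam * y ^ (1 - lam)) ^ θ = (x ^ θ) ^ lam * (y ^ θ) ^ (1 - lam) := by
    rw [Real.mul_rpow (Real.rpow_nonneg hx _) (Real.rpow_nonneg hy _), ← Real.rpow_mul hx,
      ← Real.rpow_mul hx, ← Real.rpow_mul hy, ← Real.rpow_mul hy, mul_comm lam,
      mul_comm (1 - lam)]
  rw [← Real.rpow_le_rpow_iff (by positivity) hz hθ, e]
  exact h1.trans h

lemma pqIneq_gibbs (hn : 1 ≤ n) (hr : 0 < r) (hk : 0 < k₁) (hk1 : k₁ ≤ 1) (hk2 : 0 ≤ k₂)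
    (hp : p ∈ Set.Icc (0 : ℝ) 1) (hq : 0 ≤ q)
    (hcond : (1 - p) * ((n : ℝ) + 1) / r ^ 2 + q * (1 + k₂) * (1 + k₁) ≤ 2 * k₁)
    (hV : ContDiff ℝ 2 V) (hVe : ∀ x, V (-x) = V x)
    (hconv : ∀ x v, k₁ * (∑ i, v i ^ 2) ≤ hess V x v)
    (hlap : ∀ M : Set (Euc n), IsConvexBody M → M = -M → Metric.closedBall (0 : Euc n) r ⊆ M →
      ∫ x in M, ∑ i, pd i (pd i V) x ∂gibbs V ≤ k₂ * n * (gibbs V M).toReal)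
    (hK : IsCompact K) (hL : IsCompact L) (hKs : K = -K) (hLs : L = -L)
    (hrK : Metric.closedBall (0 : Euc n) r ⊆ K) (hrL : Metric.closedBall (0 : Euc n) r ⊆ L) :
    PQIneq (gibbs V) p q K L := by
  intro lam hl
  have hn0 : (0 : ℝ) < n := by exact_mod_cast hn
  have : IsFiniteMeasure (gibbs V) :=
    isFiniteMeasure_gibbs hk hV.continuous (quadratic_le hV hVe hconv)
  obtain ⟨Q, η, hQ, hη0, hQt, hηt, hQη⟩ := exists_seq_combo_le (K := K) (L := L) hn hr hk hk1 hk2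
    hp hq hcond hV hVe hconv hlap hK hL hKs hLs hrK hrL hl
  have hl' : 0 ≤ 1 - lam := sub_nonneg.mpr hl.2
  set x := (gibbs V).real K with hx
  set y := (gibbs V).real L with hy
  set z := (gibbs V).real (lpComb p lam K L) with hz
  have hx0 : 0 ≤ x := measureReal_nonneg
  have hy0 : 0 ≤ y := measureReal_nonneg
  have hz0 : 0 ≤ z := measureReal_nonneg
  have hzη : Tendsto (fun k => z + η k) atTop (𝓝 z) := by simpa using hηt.const_add z
  rw [← ofReal_measureReal (μ := gibbs V) (s := K), ← ofReal_measureReal (μ := gibbs V) (s := L),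
    ← ofReal_measureReal (μ := gibbs V) (s := lpComb p lam K L)]
  constructor
  · rintro -
    rw [ENNReal.ofReal_rpow_of_nonneg hx0 hl.1, ENNReal.ofReal_rpow_of_nonneg hy0 hl',
      ← ENNReal.ofReal_mul (by positivity)]
    exact ENNReal.ofReal_le_ofReal (ge_of_tendsto' hzη fun k =>
      geom_mean_le_of_combo_rpow_le hx0 hy0 (add_nonneg hz0 (hη0 k)) (div_pos (hQ k) hn0) hl
        (hQη k))
  · intro hq0
    have hqn : 0 < q / n := div_pos (hq.lt_of_ne' hq0) hn0
    have hQn : Tendsto (fun k => Q k / n) atTop (𝓝 (q / n)) := hQt.div_const _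
    rw [ENNReal.ofReal_rpow_of_nonneg hx0 hqn.le, ENNReal.ofReal_rpow_of_nonneg hy0 hqn.le,
      ENNReal.ofReal_rpow_of_nonneg hz0 hqn.le, ← ENNReal.ofReal_mul hl.1,
      ← ENNReal.ofReal_mul hl', ← ENNReal.ofReal_add
        (mul_nonneg hl.1 (Real.rpow_nonneg hx0 _)) (mul_nonneg hl' (Real.rpow_nonneg hy0 _))]
    refine ENNReal.ofReal_le_ofReal (le_of_tendsto_of_tendsto'
      (((tendsto_const_nhds.rpow hQn (Or.inr hqn)).const_mul _).add
        ((tendsto_const_nhds.rpow hQn (Or.inr hqn)).const_mul _))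
      (hzη.rpow hQn (Or.inr hqn)) hQη)

lemma lapl_eq_sum (hV : ContDiff ℝ 2 V) (x : Euc n) : lapl V x = ∑ i, pd i (pd i V) x := by
  refine Finset.sum_congr rfl fun i _ => ?_
  rw [iteratedFDeriv_two_eq_sum hV]
  simp

end Main

end Auxiliary

/-- Theorem 1.5, first case: if `k₁ ∈ [1/n, 1]`, `∇²V ≥ k₁ Id`, `∫_M ΔV dμ ≤ k₂ n μ(M)`
for all origin-symmetric convex bodies `M ⊇ rB₂ⁿ`, and
`(1-p)(n+1)/r² + q(1+k₂)(1+k₁) ≤ 2k₁`, then `μ` satisfies the `(p,q)`-inequality for all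
pairs of origin-symmetric convex bodies containing `rB₂ⁿ`. -/
theorem pq_inequality_case_one (n : ℕ) (hn : 1 ≤ n) (r k₁ k₂ : ℝ) (hr : 0 < r)
    (hk₁ : k₁ ∈ Set.Icc (1 / (n : ℝ)) 1) (hk₂ : 0 ≤ k₂)
    (V : Euc n → ℝ) (hV : ContDiff ℝ 2 V) (hVconv : ConvexOn ℝ Set.univ V)
    (hVeven : ∀ x, V (-x) = V x)
    (hVhess : ∀ x v : Euc n, k₁ * ‖v‖ ^ 2 ≤ iteratedFDeriv ℝ 2 V x ![v, v])
    (μ : Measure (Euc n))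
    (hμ : μ = volume.withDensity fun x => ENNReal.ofReal (Real.exp (-V x)))
    (hlapV : ∀ M : Set (Euc n), IsConvexBody M → M = -M →
      Metric.closedBall (0 : Euc n) r ⊆ M →
        ∫ x in M, lapl V x ∂μ ≤ k₂ * n * (μ M).toReal)
    (p q : ℝ) (hp : p ∈ Set.Icc (0:ℝ) 1) (hq : q ∈ Set.Icc (0:ℝ) p)
    (hcond : (1 - p) * ((n : ℝ) + 1) / r ^ 2 + q * (1 + k₂) * (1 + k₁) ≤ 2 * k₁) :
    ∀ K L : Set (Euc n), IsConvexBody K → IsConvexBody L → K = -K → L = -L →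
      Metric.closedBall (0 : Euc n) r ⊆ K → Metric.closedBall (0 : Euc n) r ⊆ L →
        PQIneq μ p q K L := by
  subst hμ
  intro K L hK hL hKs hLs hrK hrL
  have hn0 : (0 : ℝ) < 1 / n := by
    have : (0 : ℝ) < n := by exact_mod_cast hn
    positivity
  refine pqIneq_gibbs hn hr (hn0.trans_le hk₁.1) hk₁.2 hk₂ hp hq.1 hcond hV hVeven (fun x v => ?_)
    (fun M hM hMs hrM => ?_) hK.1 hL.1 hKs hLs hrK hrL
  · have h := hVhess x (WithLp.toLp 2 v)
    rw [iteratedFDeriv_two_eq_sum hV, EuclideanSpace.real_norm_sq_eq] at h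
    exact h
  · have h := hlapV M hM hMs hrM
    simp_rw [lapl_eq_sum hV] at h
    exact h

end
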